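/- arXiv:0711.0909 — 4 statements merged into one kernel-verified Lean document; each statement's English description precedes it below -/
import Mathlib

section
/- The dimension of the quotient ring C[x_1,...,x_n] / ⟨QInv_{n,m}^+⟩ as a C-vector space is m^n · C_n = m^n · (1/(n+1))·binom(2n, n). -/
open MvPolynomial

/-- The composition obtained from an exponent vector by deleting its zero parts. -/
def qcomp {n : ℕ} (ν : Fin n →₀ ℕ) : List ℕ :=
  (List.ofFn fun i => ν i).filter (· ≠ 0)

/-- A quasi-symmetric polynomial: coefficients on `x^ν` and `x^μ` agree whenever the
compositions obtained by deleting zeros from `ν` and `μ` coincide. -/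
def IsQuasiSym {n : ℕ} (P : MvPolynomial (Fin n) ℂ) : Prop :=
  ∀ ν μ : Fin n →₀ ℕ, qcomp ν = qcomp μ → P.coeff ν = P.coeff μ

/-- The quasi-invariants of `G_{n,m}`: polynomials of the form `Q(x₁^m, …, xₙ^m)`
with `Q` quasi-symmetric. -/
def QInv (n m : ℕ) : Set (MvPolynomial (Fin n) ℂ) :=
  {P | ∃ Q : MvPolynomial (Fin n) ℂ, IsQuasiSym Q ∧
    P = MvPolynomial.bind₁ (fun i => (X i : MvPolynomial (Fin n) ℂ) ^ m) Q}

/-- The quasi-invariants with zero constant term. -/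
def QInvPlus (n m : ℕ) : Set (MvPolynomial (Fin n) ℂ) :=
  {P | P ∈ QInv n m ∧ constantCoeff P = 0}


namespace SuperCov

/-! ### Spanning -/

/-- Fundamental quasi-symmetric polynomials, defined by recursion on the number of variables. -/
noncomputable def fund : (n : ℕ) → List ℕ → MvPolynomial (Fin n) ℂ
  | 0, [] => 1
  | 0, _ :: _ => 0
  | _ + 1, [] => 1
  | n + 1, a :: β =>
      (∑ j ∈ Finset.range a, X 0 ^ j * rename Fin.succ (fund n ((a - j) :: β)))
        + X 0 ^ a * rename Fin.succ (fund n β)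

/-- Coefficients of the fundamental quasi-symmetric polynomials. -/
def fcoef : List ℕ → List ℕ → ℂ
  | [], [] => 1
  | [], _ :: _ => 0
  | e :: l, [] => if e = 0 then fcoef l [] else 0
  | e :: l, a :: β =>
      if e < a then fcoef l ((a - e) :: β) else if e = a then fcoef l β else 0

theorem fcoef_filter (l : List ℕ) : ∀ β : List ℕ, (∀ a ∈ β, 0 < a) →
    fcoef (l.filter (· ≠ 0)) β = fcoef l β := by
  induction l with
  | nil => intro β _; rfl
  | cons e l ih =>
    intro β hβ
    by_cases he : e = 0
    · subst he
      rw [List.filter_cons_of_neg (by simp)]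
      rw [ih β hβ]
      cases β with
      | nil => simp [fcoef]
      | cons a β =>
        have : 0 < a := hβ a (by simp)
        simp [fcoef, this]
    · rw [List.filter_cons_of_pos (by simpa using he)]
      cases β with
      | nil => simp [fcoef, he]
      | cons a β =>
        simp only [fcoef]
        rw [ih β (fun b hb => hβ b (by simp [hb]))]
        by_cases h : e < a
        · rw [ih]
          intro b hb
          simp only [List.mem_cons] at hb
          rcases hb with rfl | hb
          · omega
          · exact hβ b (by simp [hb])
        · simp [h]

theorem coeff_X_pow_mul_rename {n : ℕ} (j : ℕ) (p : MvPolynomial (Fin n) ℂ)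
    (ν : Fin (n + 1) →₀ ℕ) :
    coeff ν (X 0 ^ j * rename Fin.succ p) = if ν 0 = j then coeff ν.tail p else 0 := by
  have h : finSuccEquiv ℂ n (X 0 ^ j * rename Fin.succ p)
      = Polynomial.C p * Polynomial.X ^ j := by
    have h2 : ((finSuccEquiv ℂ n : MvPolynomial (Fin (n + 1)) ℂ →ₐ[ℂ] _).comp
        (rename Fin.succ)) = (Algebra.ofId (MvPolynomial (Fin n) ℂ)
          (Polynomial (MvPolynomial (Fin n) ℂ))).restrictScalars ℂ := by
      apply MvPolynomial.algHom_ext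
      intro i
      simp [finSuccEquiv_X_succ, Algebra.ofId_apply]
    have h3 := DFunLike.congr_fun h2 p
    simp only [AlgHom.comp_apply] at h3
    rw [map_mul, map_pow, finSuccEquiv_X_zero, mul_comm]
    congr 1
  rw [← Finsupp.cons_tail ν, ← finSuccEquiv_coeff_coeff, h, Polynomial.coeff_C_mul_X_pow]
  simp only [Finsupp.cons_zero, Finsupp.tail_cons]
  split_ifs <;> simp

theorem coeff_fund (n : ℕ) : ∀ (β : List ℕ) (ν : Fin n →₀ ℕ),
    coeff ν (fund n β) = fcoef (List.ofFn fun i => ν i) β := by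
  induction n with
  | zero =>
    intro β ν
    have : ν = 0 := Subsingleton.elim _ _
    subst this
    cases β <;> simp [fund, fcoef]
  | succ n ih =>
    intro β ν
    rw [List.ofFn_succ]
    have ht : ∀ β, fcoef (List.ofFn fun i : Fin n => ν i.succ) β = coeff ν.tail (fund n β) :=
      fun β => (ih β ν.tail).symm
    cases β with
    | nil =>
      simp only [fund, fcoef]
      rw [ht]
      have h1 : fund n [] = 1 := by cases n <;> rfl
      rw [h1, coeff_one, coeff_one]
      by_cases h0 : ν 0 = 0
      · simp only [h0, if_true]
        congr 1
        apply propext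
        constructor
        · rintro rfl; ext i; rfl
        · intro h
          rw [← Finsupp.cons_tail ν, ← h, h0]; simp
      · simp only [h0, if_false]
        rw [if_neg]
        rintro rfl
        simp at h0
    | cons a β =>
      simp only [fund, fcoef]
      rw [coeff_add, coeff_sum, ht, ht]
      simp only [coeff_X_pow_mul_rename]
      rw [Finset.sum_ite_eq]
      simp only [Finset.mem_range]
      by_cases h : ν 0 < a
      · simp [h, h.ne]
      · simp [h]

theorem isQuasiSym_fund (n : ℕ) (β : List ℕ) (hβ : ∀ a ∈ β, 0 < a) : IsQuasiSym (fund n β) := by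
  intro ν μ h
  rw [coeff_fund, coeff_fund, ← fcoef_filter _ β hβ, ← fcoef_filter (List.ofFn fun i => μ i) β hβ]
  exact congrArg (fun l => fcoef l β) h

theorem constantCoeff_fund (n a : ℕ) (β : List ℕ) (ha : 0 < a) (hβ : ∀ b ∈ β, 0 < b) :
    constantCoeff (fund n (a :: β)) = 0 := by
  rw [constantCoeff_eq, coeff_fund, ← fcoef_filter _ _ (by simpa using ⟨ha, hβ⟩)]
  have : (List.ofFn fun i : Fin n => (0 : Fin n →₀ ℕ) i).filter (· ≠ 0) = [] := by
    simp
  rw [this]; rfl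

/-- The compositions at level `s`. -/
def Adm (s : ℕ) (β : List ℕ) : Prop :=
  β ≠ [] ∧ (∀ a ∈ β, 0 < a) ∧ β.length + s ≤ β.sum

/-- The ideal at level `s`. -/
noncomputable def JJ (n s : ℕ) : Ideal (MvPolynomial (Fin n) ℂ) :=
  Ideal.span {p | ∃ β, Adm s β ∧ p = fund n β}

theorem fund_mem {n s : ℕ} {β : List ℕ} (h : Adm s β) : fund n β ∈ JJ n s :=
  Ideal.subset_span ⟨β, h, rfl⟩

/-- Exponents staying below the diagonal. -/
def Dy : (n : ℕ) → ℕ → (Fin n → ℕ) → Prop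
  | 0, _, _ => True
  | n + 1, s, v => v 0 ≤ s ∧ Dy n (s + 1 - v 0) (fun i => v i.succ)

theorem fund_cons_succ (n a : ℕ) (β : List ℕ) :
    fund (n + 1) ((a + 1) :: β) = rename Fin.succ (fund n ((a + 1) :: β))
      + X 0 * (if a = 0 then rename Fin.succ (fund n β) else fund (n + 1) (a :: β)) := by
  split_ifs with h
  · subst h
    simp [fund]
  · simp only [fund]
    rw [Finset.sum_range_succ']
    simp only [pow_zero, one_mul, Nat.sub_zero, Nat.add_sub_add_right]
    rw [mul_add, Finset.mul_sum]
    have : ∀ j, X 0 * (X 0 ^ j * rename Fin.succ (fund n ((a - j) :: β)))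
        = (X 0 : MvPolynomial (Fin (n + 1)) ℂ) ^ (j + 1)
          * rename Fin.succ (fund n ((a - j) :: β)) := by
      intro j; ring
    simp only [this]
    ring

theorem rename_fund_mem (n s : ℕ) : ∀ (β : List ℕ), Adm (s + 1) β →
    rename Fin.succ (fund n β) ∈ JJ (n + 1) s := by
  intro β
  induction β with
  | nil => intro h; exact absurd rfl h.1
  | cons a β ih =>
    rintro ⟨-, hpos, hsum⟩
    have ha : 0 < a := hpos a (by simp)
    have hβ : ∀ b ∈ β, 0 < b := fun b hb => hpos b (by simp [hb])
    obtain ⟨a, rfl⟩ : ∃ b, a = b + 1 := ⟨a - 1, by omega⟩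
    simp only [List.length_cons, List.sum_cons] at hsum
    have h := fund_cons_succ n a β
    rw [eq_sub_of_add_eq h.symm]
    refine Ideal.sub_mem _ (fund_mem ⟨by simp, hpos, by simp; omega⟩) (Ideal.mul_mem_left _ _ ?_)
    split_ifs with h0
    · refine ih ⟨?_, hβ, by omega⟩
      rintro rfl
      simp at hsum
      omega
    · exact fund_mem ⟨by simp, by simpa using ⟨by omega, hβ⟩, by simp; omega⟩

/-- Span of the sub-diagonal monomials. -/
noncomputable def WW (n s : ℕ) : Submodule ℂ (MvPolynomial (Fin n) ℂ) :=
  Submodule.span ℂ {p | ∃ ν : Fin n →₀ ℕ, Dy n s ν ∧ p = monomial ν 1}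

/-- The sum of the ideal and the span of monomials. -/
noncomputable def MM (n s : ℕ) : Submodule ℂ (MvPolynomial (Fin n) ℂ) :=
  (JJ n s).restrictScalars ℂ ⊔ WW n s

theorem JJ_MM {n s : ℕ} {p : MvPolynomial (Fin n) ℂ} (h : p ∈ JJ n s) : p ∈ MM n s :=
  Submodule.mem_sup_left (by simpa using h)

theorem monomial_cons {n : ℕ} (e : ℕ) (ν : Fin n →₀ ℕ) :
    (X 0 ^ e * rename Fin.succ (monomial ν 1) : MvPolynomial (Fin (n + 1)) ℂ)
      = monomial (ν.cons e) 1 := by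
  ext μ
  rw [coeff_X_pow_mul_rename, coeff_monomial, coeff_monomial]
  conv_rhs => rw [← Finsupp.cons_tail μ]
  have : (ν.cons e = Finsupp.cons (μ 0) μ.tail) ↔ (e = μ 0 ∧ ν = μ.tail) := by
    constructor
    · intro h; exact Finsupp.cons_injective2 h
    · rintro ⟨h1, h2⟩; rw [h1, h2]
  simp only [this]
  by_cases h1 : μ 0 = e
  · simp [h1]
  · simp [h1, Ne.symm h1]

theorem step_aux {n s e : ℕ} (β : List ℕ) (q : MvPolynomial (Fin n) ℂ) (h : Adm s (e :: β))
    (ih : ∀ j < e, ∀ r : MvPolynomial (Fin n) ℂ, X 0 ^ j * rename Fin.succ r ∈ MM (n + 1) s) :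
    X 0 ^ e * rename Fin.succ (q * fund n β) ∈ MM (n + 1) s := by
  have h1 : X 0 ^ e * rename Fin.succ (q * fund n β)
      = rename Fin.succ q * fund (n + 1) (e :: β)
        - ∑ j ∈ Finset.range e, X 0 ^ j * rename Fin.succ (q * fund n ((e - j) :: β)) := by
    simp only [fund, map_mul, mul_add, Finset.mul_sum]
    have : ∀ j, rename Fin.succ q * (X 0 ^ j * rename Fin.succ (fund n ((e - j) :: β)))
        = (X 0 : MvPolynomial (Fin (n + 1)) ℂ) ^ j
          * (rename Fin.succ q * rename Fin.succ (fund n ((e - j) :: β))) := by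
      intro j; ring
    simp only [this]
    ring
  rw [h1]
  refine Submodule.sub_mem _ (JJ_MM (Ideal.mul_mem_left _ _ (fund_mem h))) ?_
  exact Submodule.sum_mem _ fun j hj => ih j (Finset.mem_range.1 hj) _

theorem fund_nil (n : ℕ) : fund n [] = 1 := by cases n <;> rfl

theorem span_all (n : ℕ) : ∀ (s : ℕ) (f : MvPolynomial (Fin n) ℂ), f ∈ MM n s := by
  induction n with
  | zero =>
    intro s f
    refine Submodule.mem_sup_right ?_
    rw [f.as_sum]
    refine Submodule.sum_mem _ fun ν _ => ?_
    rw [← mul_one (coeff ν f), ← smul_eq_mul, ← smul_monomial]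
    exact Submodule.smul_mem _ _ (Submodule.subset_span ⟨ν, trivial, rfl⟩)
  | succ n ihn =>
    intro s
    have key : ∀ e : ℕ, ∀ r : MvPolynomial (Fin n) ℂ,
        X 0 ^ e * rename Fin.succ r ∈ MM (n + 1) s := by
      intro e
      induction e using Nat.strong_induction_on with
      | _ e ih =>
        intro r
        by_cases hes : e ≤ s
        · obtain ⟨j, hj, w, hw, rfl⟩ := Submodule.mem_sup.1 (ihn (s + 1 - e) r)
          rw [map_add, mul_add]
          refine Submodule.add_mem _ ?_ ?_
          · have hj' : j ∈ JJ n (s + 1 - e) := by simpa using hj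
            suffices H : ∀ q : MvPolynomial (Fin n) ℂ,
                X 0 ^ e * rename Fin.succ (q * j) ∈ MM (n + 1) s by
              simpa using H 1
            clear hj ihn
            refine Submodule.span_induction (p := fun j _ => ∀ q : MvPolynomial (Fin n) ℂ,
                X 0 ^ e * rename Fin.succ (q * j) ∈ MM (n + 1) s) ?_ ?_ ?_ ?_ hj'
            · rintro x ⟨β, hβ, rfl⟩ q
              rcases Nat.eq_zero_or_pos e with rfl | he
              · apply JJ_MM
                rw [map_mul]
                exact Ideal.mul_mem_left _ _ (Ideal.mul_mem_left _ _ (rename_fund_mem n s β hβ))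
              · refine step_aux β q ⟨by simp, ?_, ?_⟩ ih
                · simpa using ⟨he, hβ.2.1⟩
                · have := hβ.2.2
                  simp; omega
            · intro q; simp
            · intro x y _ _ hx hy q
              rw [mul_add, map_add, mul_add]
              exact Submodule.add_mem _ (hx q) (hy q)
            · intro a x _ hx q
              rw [smul_eq_mul, ← mul_assoc]
              exact hx _
          · refine Submodule.mem_sup_right ?_
            refine Submodule.span_induction (p := fun w _ =>
                X 0 ^ e * rename Fin.succ w ∈ WW (n + 1) s) ?_ ?_ ?_ ?_ hw
            · rintro x ⟨ν, hν, rfl⟩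
              refine Submodule.subset_span ⟨ν.cons e, ?_, monomial_cons e ν⟩
              refine ⟨by simpa using hes, ?_⟩
              simpa using hν
            · simp
            · intro x y _ _ hx hy
              rw [map_add, mul_add]
              exact Submodule.add_mem _ hx hy
            · intro a x _ hx
              rw [map_smul, mul_smul_comm]
              exact Submodule.smul_mem _ _ hx
        · have := step_aux (n := n) (s := s) (e := e) [] r
            ⟨by simp, by simp; omega, by simp; omega⟩ ih
          rwa [fund_nil, mul_one] at this
    intro f
    rw [f.as_sum]
    refine Submodule.sum_mem _ fun ν _ => ?_
    rw [← mul_one (coeff ν f), ← smul_eq_mul, ← smul_monomial, ← Finsupp.cons_tail ν, ← monomial_cons]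
    exact Submodule.smul_mem _ _ (key _ _)

/-! ### Independence -/

/-- The ideal generated by quasi-symmetric polynomials without constant term. -/
noncomputable def QJ (n : ℕ) : Ideal (MvPolynomial (Fin n) ℂ) :=
  Ideal.span {p | IsQuasiSym p ∧ constantCoeff p = 0}

theorem JJ_le_QJ (n : ℕ) : JJ n 0 ≤ QJ n := by
  refine Ideal.span_mono ?_
  rintro p ⟨β, hβ, rfl⟩
  refine ⟨isQuasiSym_fund n β hβ.2.1, ?_⟩
  cases β with
  | nil => exact absurd rfl hβ.1
  | cons a β =>
    exact constantCoeff_fund n a β (hβ.2.1 a (by simp)) (fun b hb => hβ.2.1 b (by simp [hb]))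

/-- Insert a zero at position `i`. -/
noncomputable def ins {n : ℕ} (i : Fin (n + 1)) (μ : Fin n →₀ ℕ) : Fin (n + 1) →₀ ℕ :=
  μ.mapDomain i.succAbove

theorem ins_same {n : ℕ} (i : Fin (n + 1)) (μ : Fin n →₀ ℕ) : ins i μ i = 0 :=
  Finsupp.mapDomain_of_notMem_range _ _ (by simp)

theorem ins_succAbove {n : ℕ} (i : Fin (n + 1)) (μ : Fin n →₀ ℕ) (j : Fin n) :
    ins i μ (i.succAbove j) = μ j :=
  Finsupp.mapDomain_apply Fin.succAbove_right_injective _ _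

theorem ins_eq {n : ℕ} (i : Fin (n + 1)) (μ : Fin n →₀ ℕ) :
    (ins i μ : Fin (n + 1) → ℕ) = i.insertNth (α := fun _ => ℕ) 0 (μ : Fin n → ℕ) := by
  rw [Fin.eq_insertNth_iff]
  exact ⟨ins_same i μ, funext fun j => ins_succAbove i μ j⟩

theorem filter_insertNth {n : ℕ} : ∀ (i : Fin (n + 1)) (v : Fin n → ℕ),
    (List.ofFn (i.insertNth (α := fun _ => ℕ) 0 v)).filter (· ≠ 0)
      = (List.ofFn v).filter (· ≠ 0) := by
  induction n with
  | zero =>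
    intro i v
    have : i = 0 := Fin.fin_one_eq_zero i
    subst this
    rw [Fin.insertNth_zero']
    simp
  | succ n ih =>
    intro i v
    refine Fin.cases ?_ (fun i => ?_) i
    · rw [Fin.insertNth_zero', List.ofFn_cons]
      simp
    · conv_lhs => rw [← Fin.cons_self_tail v, Fin.insertNth_succ_cons]
      conv_rhs => rw [← Fin.cons_self_tail v]
      rw [List.ofFn_cons, List.ofFn_cons, List.filter_cons, List.filter_cons, ih]

theorem qcomp_ins {n : ℕ} (i : Fin (n + 1)) (μ : Fin n →₀ ℕ) : qcomp (ins i μ) = qcomp μ := by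
  unfold qcomp
  have := filter_insertNth i (μ : Fin n → ℕ)
  rw [← ins_eq] at this
  exact this

/-- Set the variable `i` to zero and relabel. -/
noncomputable def RR {n : ℕ} (i : Fin (n + 1)) :
    MvPolynomial (Fin (n + 1)) ℂ →ₐ[ℂ] MvPolynomial (Fin n) ℂ :=
  killCompl (Fin.succAbove_right_injective (p := i))

theorem coeff_RR {n : ℕ} (i : Fin (n + 1)) (f : MvPolynomial (Fin (n + 1)) ℂ) (μ : Fin n →₀ ℕ) :
    coeff μ (RR i f) = coeff (ins i μ) f := by
  unfold RR ins
  rw [coeff_killCompl]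

theorem RR_X_same {n : ℕ} (i : Fin (n + 1)) : RR i (X i) = 0 := by
  ext μ
  rw [coeff_RR, coeff_X, coeff_zero, if_neg]
  intro h
  have := ins_same i μ
  rw [← h] at this
  simp at this

theorem RR_X_succAbove {n : ℕ} (i : Fin (n + 1)) (j : Fin n) : RR i (X (i.succAbove j)) = X j := by
  have := killCompl_rename_app (R := ℂ) (Fin.succAbove_right_injective (p := i)) (X j)
  rwa [rename_X] at this

theorem RR_quasi {n : ℕ} (i j : Fin (n + 1)) (g : MvPolynomial (Fin (n + 1)) ℂ)
    (hg : IsQuasiSym g) : RR i g = RR j g := by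
  ext μ
  rw [coeff_RR, coeff_RR]
  exact hg _ _ (by rw [qcomp_ins, qcomp_ins])

theorem RR_mem {n : ℕ} (i : Fin (n + 1)) (g : MvPolynomial (Fin (n + 1)) ℂ)
    (hg : IsQuasiSym g) (h0 : constantCoeff g = 0) : RR i g ∈ QJ n := by
  refine Ideal.subset_span ⟨?_, ?_⟩
  · intro ν μ h
    rw [coeff_RR, coeff_RR]
    exact hg _ _ (by rw [qcomp_ins, qcomp_ins, h])
  · rw [constantCoeff_eq, coeff_RR]
    have : ins i 0 = 0 := by simp [ins]
    rw [this]; exact h0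

theorem RR_sub_dvd {n : ℕ} (i : Fin n) (p : MvPolynomial (Fin (n + 1)) ℂ) :
    X i ∣ RR i.succ p - RR i.castSucc p := by
  rw [← Ideal.mem_span_singleton, ← Ideal.Quotient.eq]
  have : (Ideal.Quotient.mkₐ ℂ (Ideal.span {(X i : MvPolynomial (Fin n) ℂ)})).comp (RR i.succ)
      = (Ideal.Quotient.mkₐ ℂ (Ideal.span {(X i : MvPolynomial (Fin n) ℂ)})).comp
        (RR i.castSucc) := by
    apply MvPolynomial.algHom_ext
    intro j
    simp only [AlgHom.comp_apply, Ideal.Quotient.mkₐ_eq_mk]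
    have hX : (Ideal.Quotient.mk (Ideal.span {(X i : MvPolynomial (Fin n) ℂ)})) (X i) = 0 :=
      Ideal.Quotient.eq_zero_iff_mem.2 (Ideal.mem_span_singleton_self _)
    rcases lt_trichotomy j i.castSucc with h | h | h
    · obtain ⟨k, rfl⟩ : ∃ k : Fin n, j = k.castSucc := ⟨j.castPred (by
        rintro rfl
        exact absurd h (not_lt.2 (Fin.le_last _))), by simp⟩
      have h1 := RR_X_succAbove i.succ k
      have h2 := RR_X_succAbove i.castSucc k
      rw [Fin.succAbove_of_castSucc_lt _ _ (h.trans (Fin.castSucc_lt_succ))] at h1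
      rw [Fin.succAbove_of_castSucc_lt _ _ h] at h2
      rw [h1, h2]
    · subst h
      have h1 := RR_X_succAbove i.succ i
      rw [Fin.succAbove_of_castSucc_lt _ _ (Fin.castSucc_lt_succ)] at h1
      rw [RR_X_same, h1, hX, map_zero]
    · obtain ⟨k, rfl⟩ : ∃ k : Fin n, j = k.succ := ⟨j.pred (by
        rintro rfl
        exact absurd h (Fin.not_lt_zero _)), by simp⟩
      have hik : i ≤ k := by
        rw [Fin.lt_def] at h; rw [Fin.le_def]; simp at h; omega
      rcases hik.eq_or_lt with rfl | hik
      · have h2 := RR_X_succAbove i.castSucc i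
        rw [Fin.succAbove_of_le_castSucc _ _ le_rfl] at h2
        rw [RR_X_same, h2, hX, map_zero]
      · have h1 := RR_X_succAbove i.succ k
        have h2 := RR_X_succAbove i.castSucc k
        rw [Fin.succAbove_of_le_castSucc _ _ (by
          rw [Fin.lt_def] at hik; rw [Fin.le_def]; simp; omega)] at h1
        rw [Fin.succAbove_of_le_castSucc _ _ (by
          rw [Fin.lt_def] at hik; rw [Fin.le_def]; simp; omega)] at h2
        rw [h1, h2]
  exact DFunLike.congr_fun this p

theorem trim {n : ℕ} (i : Fin n) (f : MvPolynomial (Fin (n + 1)) ℂ) (hf : f ∈ QJ (n + 1)) :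
    ∃ h ∈ QJ n, RR i.succ f - RR i.castSucc f = X i * h := by
  suffices H : ∀ q : MvPolynomial (Fin (n + 1)) ℂ,
      ∃ h ∈ QJ n, RR i.succ (q * f) - RR i.castSucc (q * f) = X i * h by
    simpa using H 1
  refine Submodule.span_induction (p := fun f _ => ∀ q : MvPolynomial (Fin (n + 1)) ℂ,
      ∃ h ∈ QJ n, RR i.succ (q * f) - RR i.castSucc (q * f) = X i * h) ?_ ?_ ?_ ?_ hf
  · rintro g ⟨hg, h0⟩ q
    obtain ⟨r, hr⟩ := RR_sub_dvd i q
    refine ⟨r * RR i.castSucc g, Ideal.mul_mem_left _ _ (RR_mem _ g hg h0), ?_⟩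
    rw [map_mul, map_mul, RR_quasi i.succ i.castSucc g hg, ← sub_mul, hr, mul_assoc]
  · intro q
    exact ⟨0, Ideal.zero_mem _, by simp⟩
  · intro x y _ _ hx hy q
    obtain ⟨a, ha, ha'⟩ := hx q
    obtain ⟨b, hb, hb'⟩ := hy q
    refine ⟨a + b, Ideal.add_mem _ ha hb, ?_⟩
    rw [mul_add, mul_add, map_add, map_add, ← ha', ← hb']
    ring
  · intro a x _ hx q
    rw [smul_eq_mul, ← mul_assoc]
    exact hx _

theorem Dy_ins {n : ℕ} : ∀ (s : ℕ) (i : Fin n) (v : Fin n → ℕ),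
    Dy (n + 1) s (i.castSucc.insertNth (α := fun _ => ℕ) 0 (v + Pi.single i 1)) → Dy n s v := by
  induction n with
  | zero => intro s i; exact i.elim0
  | succ n ih =>
    intro s i v
    refine Fin.cases ?_ (fun i => ?_) i
    · rw [Fin.castSucc_zero, Fin.insertNth_zero']
      rintro ⟨-, h1, h2⟩
      simp only [Fin.cons_succ, Fin.cons_zero, Pi.add_apply, Pi.single_eq_same] at h1 h2
      refine ⟨by omega, ?_⟩
      convert h2 using 1
      · omega
      · funext j; simp
    · have h1 : v + Pi.single i.succ 1 = Fin.cons (α := fun _ => ℕ) (v 0)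
          ((fun j => v j.succ) + Pi.single i 1) := by
        funext j
        refine Fin.cases ?_ (fun j => ?_) j
        · simp
        · simp [Pi.single_apply]
      rw [h1, ← Fin.succ_castSucc, Fin.insertNth_succ_cons]
      rintro ⟨h2, h3⟩
      simp only [Fin.cons_succ, Fin.cons_zero] at h2 h3
      exact ⟨h2, ih _ i _ h3⟩

theorem constantCoeff_QJ {n : ℕ} (f : MvPolynomial (Fin n) ℂ) (hf : f ∈ QJ n) :
    constantCoeff f = 0 := by
  have : QJ n ≤ RingHom.ker (constantCoeff : MvPolynomial (Fin n) ℂ →+* ℂ) := by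
    refine Ideal.span_le.2 ?_
    rintro g ⟨_, h0⟩
    exact h0
  exact this hf

theorem indep (n : ℕ) : ∀ f : MvPolynomial (Fin n) ℂ, f ∈ QJ n →
    (∀ ν, coeff ν f ≠ 0 → Dy n 0 ν) → f = 0 := by
  induction n with
  | zero =>
    intro f hf _
    ext ν
    have : ν = 0 := Subsingleton.elim _ _
    rw [this, coeff_zero]
    exact constantCoeff_QJ f hf
  | succ n ih =>
    intro f hf hD
    have key : ∀ i : Fin (n + 1), ∀ ν, coeff ν f ≠ 0 → ∀ j ≤ i, ν j = 0 := by
      intro i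
      induction i using Fin.induction with
      | zero =>
        intro ν hν j hj
        have : j = 0 := Fin.le_zero_iff.1 hj
        subst this
        exact Nat.le_zero.1 (hD ν hν).1
      | succ i ihi =>
        obtain ⟨h, hh, hEq⟩ := trim i f hf
        have hc : ∀ μ, coeff μ h = - coeff (ins i.castSucc (μ + Finsupp.single i 1)) f := by
          intro μ
          have h1 := congrArg (coeff (Finsupp.single i 1 + μ)) hEq
          rw [coeff_X_mul, coeff_sub, coeff_RR, coeff_RR] at h1
          have h2 : coeff (ins i.succ (Finsupp.single i 1 + μ)) f = 0 := by
            by_contra hne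
            have h3 := ihi _ hne i.castSucc le_rfl
            have h4 := ins_succAbove i.succ (Finsupp.single i 1 + μ) i
            rw [Fin.succAbove_of_castSucc_lt _ _ (Fin.castSucc_lt_succ), h3] at h4
            simp at h4
            omega
          rw [h2, zero_sub] at h1
          rw [← h1, add_comm (Finsupp.single i 1) μ]
        have hz : h = 0 := by
          refine ih h hh ?_
          intro μ hμ
          rw [hc, neg_ne_zero] at hμ
          have h5 := hD _ hμ
          rw [ins_eq] at h5
          refine Dy_ins 0 i μ ?_
          convert h5 using 2
          ext j
          simp [Finsupp.single_apply, Pi.single_apply, eq_comm]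
        intro ν hν j hj
        rcases hj.eq_or_lt with rfl | hj
        · by_contra hne
          apply hν
          have h6 := hc (Finsupp.equivFunOnFinite.symm
            (fun k => ν (i.castSucc.succAbove k)) - Finsupp.single i 1)
          rw [hz, coeff_zero] at h6
          have h7 : ν = ins i.castSucc (Finsupp.equivFunOnFinite.symm
              (fun k => ν (i.castSucc.succAbove k)) - Finsupp.single i 1
                + Finsupp.single i 1) := by
            rw [tsub_add_cancel_of_le]
            · apply DFunLike.coe_injective
              rw [ins_eq, Fin.eq_insertNth_iff]
              exact ⟨ihi ν hν _ le_rfl, rfl⟩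
            · rw [Finsupp.single_le_iff]
              simp only [Finsupp.equivFunOnFinite_symm_apply_apply]
              rw [Fin.succAbove_of_le_castSucc _ _ le_rfl]
              omega
          rw [← h7] at h6
          exact neg_eq_zero.1 h6.symm
        · exact ihi ν hν j (by
            rw [Fin.lt_def] at hj; rw [Fin.le_def]; simp at hj ⊢; omega)
    ext ν
    rw [coeff_zero]
    by_contra hν
    have h0 : ν = 0 := by
      ext j
      exact key (Fin.last n) ν hν j (Fin.le_last j)
    subst h0
    exact hν (constantCoeff_QJ f hf)

/-! ### Counting -/

/-- Ballot numbers. -/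
def dd : ℕ → ℕ → ℕ
  | 0, _ => 1
  | n + 1, s => ∑ e ∈ Finset.range (s + 1), dd n (s + 1 - e)

theorem dd_succ_succ (n s : ℕ) : dd (n + 1) (s + 1) = dd (n + 1) s + dd n (s + 2) := by
  simp only [dd]
  rw [Finset.sum_range_succ' _ (s + 1)]
  simp

theorem dd_succ_zero (n : ℕ) : dd (n + 1) 0 = dd n 1 := by
  simp [dd]

theorem dd_choose (n : ℕ) : ∀ s, dd (n + 1) s + (2 * n + s + 2).choose n
    = (2 * n + s + 2).choose (n + 1) := by
  induction n with
  | zero =>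
    intro s
    simp [dd]
  | succ n ih =>
    intro s
    induction s with
    | zero =>
      rw [dd_succ_zero]
      have h1 := ih 1
      have h2 : (2 * n + 3).choose (n + 2) = (2 * n + 3).choose (n + 1) :=
        Nat.choose_symm_of_eq_add (by omega)
      have e1 : 2 * (n + 1) + 0 + 2 = (2 * n + 3) + 1 := by ring
      rw [e1, Nat.choose_succ_succ (2 * n + 3) n, Nat.choose_succ_succ (2 * n + 3) (n + 1)]
      simp only [Nat.succ_eq_add_one] at *
      rw [show n + 1 + 1 = n + 2 from rfl]
      rw [show 2 * n + 1 + 2 = 2 * n + 3 from rfl] at h1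
      omega
    | succ s ihs =>
      rw [dd_succ_succ]
      have h1 := ih (s + 2)
      have e1 : 2 * (n + 1) + (s + 1) + 2 = (2 * n + s + 4) + 1 := by ring
      have e2 : 2 * (n + 1) + s + 2 = 2 * n + s + 4 := by ring
      have e3 : 2 * n + (s + 2) + 2 = 2 * n + s + 4 := by ring
      rw [e1, Nat.choose_succ_succ _ n, Nat.choose_succ_succ _ (n + 1)]
      rw [e2] at ihs
      rw [e3] at h1
      simp only [Nat.succ_eq_add_one] at *
      omega

theorem dd_catalan (n : ℕ) : dd n 0 = catalan n := by
  cases n with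
  | zero => simp [dd]
  | succ n =>
    have h1 := dd_choose n 0
    have h2 := succ_mul_catalan_eq_centralBinom (n + 1)
    rw [Nat.centralBinom_eq_two_mul_choose] at h2
    have h3 := Nat.choose_succ_right_eq (2 * n + 2) n
    have e1 : 2 * (n + 1) = 2 * n + 2 := by ring
    have e2 : 2 * n + 2 - n = n + 2 := by omega
    rw [e2] at h3
    rw [e1] at h2
    rw [add_zero] at h1
    have h4 : (n + 2) * dd (n + 1) 0 = (n + 2) * catalan (n + 1) := by
      nlinarith
    exact Nat.eq_of_mul_eq_mul_left (by omega) h4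

/-- First-coordinate decomposition of sub-diagonal exponents. -/
def DyEquiv (n s : ℕ) :
    {v : Fin (n + 1) → ℕ // Dy (n + 1) s v} ≃
      Σ e : Fin (s + 1), {v : Fin n → ℕ // Dy n (s + 1 - e) v} where
  toFun v := ⟨⟨v.1 0, Nat.lt_succ_of_le v.2.1⟩, ⟨fun i => v.1 i.succ, v.2.2⟩⟩
  invFun w := ⟨Fin.cons (α := fun _ => ℕ) (w.1 : ℕ) w.2.1,
    ⟨by simpa using Nat.le_of_lt_succ w.1.2, by simpa using w.2.2⟩⟩
  left_inv v := by
    apply Subtype.ext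
    exact Fin.cons_self_tail v.1
  right_inv w := rfl

theorem Dy_card (n : ℕ) : ∀ s, Finite {v : Fin n → ℕ // Dy n s v} ∧
    Nat.card {v : Fin n → ℕ // Dy n s v} = dd n s := by
  induction n with
  | zero =>
    intro s
    haveI : Unique {v : Fin 0 → ℕ // Dy 0 s v} :=
      ⟨⟨⟨fun i => i.elim0, trivial⟩⟩, fun v => Subtype.ext (Subsingleton.elim _ _)⟩
    exact ⟨inferInstance, Nat.card_unique⟩
  | succ n ih =>
    intro s
    haveI : ∀ e : Fin (s + 1), Finite {v : Fin n → ℕ // Dy n (s + 1 - e) v} :=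
      fun e => (ih _).1
    refine ⟨Finite.of_equiv _ (DyEquiv n s).symm, ?_⟩
    rw [Nat.card_congr (DyEquiv n s), Nat.card_sigma]
    simp only [dd, (ih _).2]
    exact Fin.sum_univ_eq_sum_range (fun e => dd n (s + 1 - e)) (s + 1)

/-- Division with remainder of exponents. -/
noncomputable def divEquiv (n m : ℕ) (hm : 0 < m) :
    {ν : Fin n →₀ ℕ // Dy n 0 (fun i => ν i / m)} ≃
      {v : Fin n → ℕ // Dy n 0 v} × (Fin n → Fin m) where
  toFun ν := ⟨⟨fun i => ν.1 i / m, ν.2⟩, fun i => ⟨ν.1 i % m, Nat.mod_lt _ hm⟩⟩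
  invFun w := ⟨Finsupp.equivFunOnFinite.symm (fun i => m * w.1.1 i + w.2 i), by
    have : (fun i => (Finsupp.equivFunOnFinite.symm
        (fun i => m * w.1.1 i + (w.2 i : ℕ))) i / m) = w.1.1 := by
      funext i
      simp [Nat.mul_add_div hm, Nat.div_eq_of_lt (w.2 i).2]
    rw [this]
    exact w.1.2⟩
  left_inv ν := by
    apply Subtype.ext
    ext i
    simp [Nat.div_add_mod]
  right_inv w := by
    refine Prod.ext (Subtype.ext (funext fun i => ?_)) (funext fun i => Fin.ext ?_)
    · simp [Nat.mul_add_div hm, Nat.div_eq_of_lt (w.2 i).2]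
    · simp [Nat.mul_add_mod, Nat.mod_eq_of_lt (w.2 i).2]

/-! ### Passing to `m`-th powers -/

theorem constantCoeff_expand {n m : ℕ} (hm : 0 < m) (g : MvPolynomial (Fin n) ℂ) :
    constantCoeff (expand m g) = constantCoeff g := by
  have h : ∀ p : MvPolynomial (Fin n) ℂ, constantCoeff p = eval 0 p := by
    intro p; simp
  rw [h, h, eval_expand]
  congr 2
  funext i
  simp [hm.ne']

theorem expand_mem {n m : ℕ} (hm : 0 < m) {g : MvPolynomial (Fin n) ℂ} (hg : g ∈ QJ n) :
    expand m g ∈ Ideal.span (QInvPlus n m) := by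
  have : QJ n ≤ (Ideal.span (QInvPlus n m)).comap (expand m) := by
    refine Ideal.span_le.2 ?_
    rintro g ⟨hg, h0⟩
    refine Ideal.subset_span ⟨⟨g, hg, rfl⟩, ?_⟩
    rw [constantCoeff_expand hm, h0]
  exact this hg

theorem proj_aux {n m : ℕ} (hm : 0 < m) (ρ : Fin n →₀ ℕ) (hρ : ∀ i, ρ i < m)
    (p : MvPolynomial (Fin n) ℂ) : ∃ q : MvPolynomial (Fin n) ℂ, ∀ g ε,
      coeff (m • ε + ρ) (p * expand m g) = coeff ε (q * g) := by
  induction p using MvPolynomial.induction_on' with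
  | monomial ν c =>
    by_cases h : ∀ i, ν i % m = ρ i
    · refine ⟨monomial (Finsupp.equivFunOnFinite.symm fun i => ν i / m) c, fun g ε => ?_⟩
      rw [coeff_monomial_mul', coeff_monomial_mul']
      have hν : ν = m • (Finsupp.equivFunOnFinite.symm fun i => ν i / m) + ρ := by
        ext i
        simp [← h i, Nat.div_add_mod]
      have hiff : ν ≤ m • ε + ρ ↔ (Finsupp.equivFunOnFinite.symm fun i => ν i / m) ≤ ε := by
        conv_lhs => rw [hν]
        rw [add_le_add_iff_right, Finsupp.le_def, Finsupp.le_def]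
        refine forall_congr' fun i => ?_
        simp only [Finsupp.smul_apply, smul_eq_mul]
        exact Nat.mul_le_mul_left_iff hm
      simp only [hiff]
      split_ifs with hle
      · congr 1
        have : m • ε + ρ - ν = m • (ε - Finsupp.equivFunOnFinite.symm fun i => ν i / m) := by
          conv_lhs => rw [hν]
          ext i
          simp [Nat.mul_sub, Nat.add_sub_add_right]
        rw [this, coeff_expand_smul _ hm.ne']
      · rfl
    · push Not at h
      obtain ⟨i, hi⟩ := h
      refine ⟨0, fun g ε => ?_⟩
      rw [zero_mul, coeff_zero, coeff_monomial_mul']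
      split_ifs with hle
      · rw [coeff_expand_of_not_dvd (i := i), mul_zero]
        intro hdvd
        apply hi
        have hle' := hle i
        obtain ⟨k, hk⟩ := hdvd
        simp only [Finsupp.tsub_apply, Finsupp.add_apply, Finsupp.smul_apply, smul_eq_mul]
          at hk hle'
        have h1 : m * ε i + ρ i = ν i + m * k := by omega
        have h2 := congrArg (· % m) h1
        simp only [Nat.mul_add_mod, Nat.add_mul_mod_self_left] at h2
        rw [← h2, Nat.mod_eq_of_lt (hρ i)]
      · rfl
  | add p q hp hq =>
    obtain ⟨a, ha⟩ := hp
    obtain ⟨b, hb⟩ := hq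
    refine ⟨a + b, fun g ε => ?_⟩
    rw [add_mul, add_mul, coeff_add, coeff_add, ha, hb]

theorem proj {n m : ℕ} (hm : 0 < m) (ρ : Fin n →₀ ℕ) (hρ : ∀ i, ρ i < m)
    (f : MvPolynomial (Fin n) ℂ) (hf : f ∈ Ideal.span (QInvPlus n m)) :
    ∃ g ∈ QJ n, ∀ ε, coeff (m • ε + ρ) f = coeff ε g := by
  suffices H : ∀ p : MvPolynomial (Fin n) ℂ,
      ∃ g ∈ QJ n, ∀ ε, coeff (m • ε + ρ) (p * f) = coeff ε g by
    simpa using H 1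
  refine Submodule.span_induction (p := fun f _ => ∀ p : MvPolynomial (Fin n) ℂ,
      ∃ g ∈ QJ n, ∀ ε, coeff (m • ε + ρ) (p * f) = coeff ε g) ?_ ?_ ?_ ?_ hf
  · rintro x ⟨⟨g, hg, rfl⟩, h0⟩ p
    obtain ⟨q, hq⟩ := proj_aux hm ρ hρ p
    have h0' : constantCoeff g = 0 := (constantCoeff_expand hm g).symm.trans h0
    exact ⟨q * g, Ideal.mul_mem_left _ _ (Ideal.subset_span ⟨hg, h0'⟩), fun ε => hq g ε⟩
  · intro p
    exact ⟨0, Ideal.zero_mem _, by simp⟩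
  · intro x y _ _ hx hy p
    obtain ⟨a, ha, ha'⟩ := hx p
    obtain ⟨b, hb, hb'⟩ := hy p
    refine ⟨a + b, Ideal.add_mem _ ha hb, fun ε => ?_⟩
    rw [mul_add, coeff_add, coeff_add, ha', hb']
  · intro a x _ hx p
    rw [smul_eq_mul, ← mul_assoc]
    exact hx _

/-- The monomials forming a basis of the quotient. -/
noncomputable def bas (n m : ℕ) :
    {ν : Fin n →₀ ℕ // Dy n 0 (fun i => ν i / m)} → MvPolynomial (Fin n) ℂ :=
  fun ν => monomial ν.1 1

theorem bas_indep (n m : ℕ) : LinearIndependent ℂ (bas n m) := by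
  have := (basisMonomials (Fin n) ℂ).linearIndependent.comp
    (Subtype.val : {ν : Fin n →₀ ℕ // Dy n 0 (fun i => ν i / m)} → _) Subtype.val_injective
  have h2 : bas n m = (basisMonomials (Fin n) ℂ) ∘ Subtype.val := by
    funext ν
    simp [bas]
  rw [h2]
  exact this

theorem coeff_of_mem_span {n m : ℕ} (f : MvPolynomial (Fin n) ℂ)
    (hf : f ∈ Submodule.span ℂ (Set.range (bas n m))) :
    ∀ ν, coeff ν f ≠ 0 → Dy n 0 (fun i => ν i / m) := by
  intro ν
  contrapose!
  intro hν
  refine Submodule.span_induction (p := fun f _ => coeff ν f = 0) ?_ ?_ ?_ ?_ hf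
  · rintro _ ⟨μ, rfl⟩
    simp only [bas]
    rw [coeff_monomial, if_neg]
    rintro rfl
    exact hν μ.2
  · simp
  · intro x y _ _ hx hy
    rw [coeff_add, hx, hy, add_zero]
  · intro a x _ hx
    rw [coeff_smul, hx, smul_zero]

theorem compl {n m : ℕ} (hm : 0 < m) :
    IsCompl ((Ideal.span (QInvPlus n m)).restrictScalars ℂ)
      (Submodule.span ℂ (Set.range (bas n m))) := by
  constructor
  · rw [Submodule.disjoint_def]
    intro f hf hW
    have hf' : f ∈ Ideal.span (QInvPlus n m) := by simpa using hf
    have hs := coeff_of_mem_span f hW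
    ext ν
    rw [coeff_zero]
    have hmod : ∀ i, (Finsupp.equivFunOnFinite.symm (fun i => ν i % m) : Fin n →₀ ℕ) i < m :=
      fun i => Nat.mod_lt _ hm
    obtain ⟨g, hg, hgc⟩ := proj hm _ hmod f hf'
    have hg0 : g = 0 := by
      refine indep n g hg fun ε hε => ?_
      rw [← hgc] at hε
      have := hs _ hε
      convert this using 1
      funext i
      simp [Nat.mul_add_div hm, Nat.div_eq_of_lt (Nat.mod_lt (ν i) hm)]
    have hν : ν = m • (Finsupp.equivFunOnFinite.symm (fun i => ν i / m) : Fin n →₀ ℕ)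
        + Finsupp.equivFunOnFinite.symm (fun i => ν i % m) := by
      ext i
      simp [Nat.div_add_mod]
    rw [hν, hgc, hg0, coeff_zero]
  · rw [codisjoint_iff, eq_top_iff]
    intro f _
    rw [f.as_sum]
    refine Submodule.sum_mem _ fun ν _ => ?_
    rw [← mul_one (coeff ν f), ← smul_eq_mul, ← smul_monomial]
    refine Submodule.smul_mem _ _ ?_
    let ρ : Fin n →₀ ℕ := Finsupp.equivFunOnFinite.symm (fun i => ν i % m)
    let ε : Fin n →₀ ℕ := Finsupp.equivFunOnFinite.symm (fun i => ν i / m)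
    have hν : ν = ρ + m • ε := by
      ext i
      simp [ρ, ε, Nat.mod_add_div]
    have hmon : (monomial ν 1 : MvPolynomial (Fin n) ℂ)
        = monomial ρ 1 * expand m (monomial ε 1) := by
      rw [expand_monomial, monomial_mul, ← hν, mul_one]
    rw [hmon]
    obtain ⟨j, hj, w, hw, hjw⟩ := Submodule.mem_sup.1 (span_all n 0 (monomial ε 1))
    rw [← hjw, map_add, mul_add]
    have hj' : j ∈ QJ n := JJ_le_QJ n (by simpa using hj)
    refine Submodule.add_mem _ (Submodule.mem_sup_left ?_) (Submodule.mem_sup_right ?_)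
    · rw [Submodule.restrictScalars_mem]
      exact Ideal.mul_mem_left _ _ (expand_mem hm hj')
    · refine Submodule.span_induction (p := fun w _ => monomial ρ 1 * expand m w ∈
          Submodule.span ℂ (Set.range (bas n m))) ?_ ?_ ?_ ?_ hw
      · rintro x ⟨μ, hμ, rfl⟩
        rw [expand_monomial, monomial_mul, mul_one]
        refine Submodule.subset_span ⟨⟨ρ + m • μ, ?_⟩, rfl⟩
        convert hμ using 1
        funext i
        simp [ρ, Nat.add_mul_div_left _ _ hm, Nat.div_eq_of_lt (Nat.mod_lt (ν i) hm)]
      · simp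
      · intro x y _ _ hx hy
        rw [map_add, mul_add]
        exact Submodule.add_mem _ hx hy
      · intro a x _ hx
        rw [map_smul, mul_smul_comm]
        exact Submodule.smul_mem _ _ hx

theorem main (n m : ℕ) (hm : 0 < m) :
    Module.finrank ℂ (MvPolynomial (Fin n) ℂ ⧸ Ideal.span (QInvPlus n m))
      = m ^ n * catalan n := by
  haveI := (Dy_card n 0).1
  haveI : Finite {ν : Fin n →₀ ℕ // Dy n 0 (fun i => ν i / m)} :=
    Finite.of_equiv _ (divEquiv n m hm).symm
  haveI := Fintype.ofFinite {ν : Fin n →₀ ℕ // Dy n 0 (fun i => ν i / m)}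
  have e1 : (MvPolynomial (Fin n) ℂ ⧸ Ideal.span (QInvPlus n m)) ≃ₗ[ℂ]
      (MvPolynomial (Fin n) ℂ ⧸ (Ideal.span (QInvPlus n m)).restrictScalars ℂ) :=
    (Submodule.Quotient.restrictScalarsEquiv ℂ (Ideal.span (QInvPlus n m))).symm
  rw [e1.finrank_eq, (Submodule.quotientEquivOfIsCompl _ _ (compl hm)).finrank_eq,
    finrank_span_eq_card (bas_indep n m), ← Nat.card_eq_fintype_card,
    Nat.card_congr (divEquiv n m hm), Nat.card_prod, (Dy_card n 0).2, dd_catalan, mul_comm]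
  simp

end SuperCov

/-- `dim_ℂ ℂ[x₁,…,xₙ]/⟨QInv⁺_{n,m}⟩ = m^n · Cₙ`. -/
theorem finrank_super_coinvariants (n m : ℕ) (hn : 0 < n) (hm : 0 < m) :
    Module.finrank ℂ (MvPolynomial (Fin n) ℂ ⧸ Ideal.span (QInvPlus n m))
      = m ^ n * catalan n :=
  SuperCov.main n m hm
end

section
/- For the case m = 1: the dimension of C[x_1,...,x_n] / ⟨QSym_n^+⟩ equals the n-th Catalan number C_n, where QSym_n^+ is the set of quasi-symmetric polynomials in n variables with no constant term. -/
open MvPolynomial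

/-- Quasi-symmetric polynomials in `n` variables with zero constant term. -/
def QSymPlus (n : ℕ) : Set (MvPolynomial (Fin n) ℂ) :=
  {P | IsQuasiSym P ∧ constantCoeff P = 0}


namespace QS

/-- Prefix (Dyck path) condition, in recursive form with slack `r`. -/
def Good : (n : ℕ) → ℕ → (Fin n → ℕ) → Prop
  | 0, _, _ => True
  | n + 1, r, ε => ε 0 ≤ r ∧ Good n (r + 1 - ε 0) (Fin.tail ε)

def goodEquiv (n r : ℕ) : {ε : Fin (n + 1) → ℕ // Good (n + 1) r ε} ≃
    Σ a : Fin (r + 1), {ε : Fin n → ℕ // Good n (r + 1 - a) ε} where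
  toFun ε := ⟨⟨ε.1 0, Nat.lt_succ_of_le ε.2.1⟩, ⟨Fin.tail ε.1, ε.2.2⟩⟩
  invFun x := ⟨Fin.cons (x.1 : ℕ) x.2.1, by
    refine ⟨?_, ?_⟩
    · simpa using Nat.le_of_lt_succ x.1.2
    · simpa using x.2.2⟩
  left_inv ε := by
    apply Subtype.ext
    exact Fin.cons_self_tail ε.1
  right_inv x := by
    obtain ⟨a, w, hw⟩ := x
    rfl

theorem good_finite (n : ℕ) : ∀ r, Finite {ε : Fin n → ℕ // Good n r ε} := by
  induction n with
  | zero => intro r; infer_instance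
  | succ n ih =>
    intro r
    have := ih
    exact Finite.of_equiv _ (goodEquiv n r).symm

theorem card_succ (n r : ℕ) : Nat.card {ε : Fin (n + 1) → ℕ // Good (n + 1) r ε} =
    ∑ a ∈ Finset.range (r + 1), Nat.card {ε : Fin n → ℕ // Good n (r + 1 - a) ε} := by
  have := good_finite n
  have h2 : ∀ r, Fintype {ε : Fin n → ℕ // Good n r ε} := fun r => Fintype.ofFinite _
  rw [Nat.card_congr (goodEquiv n r), Nat.card_sigma, Finset.sum_range]

theorem card_succ_succ (n r : ℕ) : Nat.card {ε : Fin (n + 1) → ℕ // Good (n + 1) (r + 1) ε} =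
    Nat.card {ε : Fin n → ℕ // Good n (r + 2) ε} +
    Nat.card {ε : Fin (n + 1) → ℕ // Good (n + 1) r ε} := by
  rw [card_succ, Finset.sum_range_succ', card_succ, add_comm]
  congr 1
  refine Finset.sum_congr rfl fun a _ => ?_
  rw [show r + 1 + 1 - (a + 1) = r + 1 - a by omega]

theorem card_succ_zero (n : ℕ) : Nat.card {ε : Fin (n + 1) → ℕ // Good (n + 1) 0 ε} =
    Nat.card {ε : Fin n → ℕ // Good n 1 ε} := by
  rw [card_succ]; simp

theorem card_zero (r : ℕ) : Nat.card {ε : Fin 0 → ℕ // Good 0 r ε} = 1 := by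
  rw [Nat.card_eq_one_iff_unique]
  exact ⟨⟨fun a b => Subtype.ext (Subsingleton.elim _ _)⟩, ⟨⟨Fin.elim0, trivial⟩⟩⟩

theorem card_formula (n : ℕ) : ∀ r, Nat.card {ε : Fin (n + 1) → ℕ // Good (n + 1) r ε} +
    (2 * (n + 1) + r).choose n = (2 * (n + 1) + r).choose (n + 1) := by
  induction n with
  | zero =>
    intro r
    induction r with
    | zero => rw [card_succ_zero, card_zero]; simp
    | succ r ih =>
      rw [card_succ_succ, card_zero]
      simp at ih ⊢
      omega
  | succ n ih =>
    intro r
    induction r with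
    | zero =>
      rw [card_succ_zero]
      have h := ih 1
      have e1 : 2 * (n + 1 + 1) + 0 = (2 * (n + 1) + 1) + 1 := by ring
      rw [e1, Nat.choose_succ_succ' _ (n + 1), Nat.choose_succ_succ' _ n]
      have h3 : (2 * (n + 1) + 1).choose (n + 1 + 1) = (2 * (n + 1) + 1).choose (n + 1) :=
        Nat.choose_symm_of_eq_add (by ring)
      omega
    | succ r ihr =>
      rw [card_succ_succ]
      have h := ih (r + 2)
      have e1 : 2 * (n + 1 + 1) + (r + 1) = (2 * (n + 1) + (r + 2)) + 1 := by ring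
      have e2 : 2 * (n + 1 + 1) + r = (2 * (n + 1) + (r + 2)) := by ring
      rw [e2] at ihr
      rw [e1, Nat.choose_succ_succ' _ (n + 1), Nat.choose_succ_succ' _ n]
      omega

theorem card_good (n : ℕ) (hn : 0 < n) : Nat.card {ε : Fin n → ℕ // Good n 0 ε} = catalan n := by
  obtain ⟨n, rfl⟩ : ∃ m, n = m + 1 := ⟨n - 1, by omega⟩
  have h := card_formula n 0
  have h1 := succ_mul_catalan_eq_centralBinom (n + 1)
  rw [Nat.centralBinom] at h1
  have h2 := Nat.choose_succ_right_eq (2 * (n + 1)) n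
  rw [show 2 * (n + 1) - n = n + 2 by omega] at h2
  simp only [add_zero] at h
  rw [← h] at h1 h2
  set N := Nat.card {ε : Fin (n + 1) → ℕ // Good (n + 1) 0 ε}
  nlinarith

end QS

namespace QS

noncomputable section

/-- Shift of variables. -/
def sh {n : ℕ} : MvPolynomial (Fin n) ℂ →ₐ[ℂ] MvPolynomial (Fin (n + 1)) ℂ := rename Fin.succ

theorem finSucc_sh {n : ℕ} (p : MvPolynomial (Fin n) ℂ) :
    finSuccEquiv ℂ n (sh p) = Polynomial.C p := by
  induction p using MvPolynomial.induction_on with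
  | C a => simp [sh, finSuccEquiv_apply]
  | add p q hp hq => simp [map_add, hp, hq]
  | mul_X p i hp => rw [map_mul, map_mul, hp]; simp [sh, finSuccEquiv_X_succ]

theorem coeff_sh_zero {n : ℕ} (p : MvPolynomial (Fin n) ℂ) (ν : Fin n →₀ ℕ) :
    coeff (ν.cons 0) (sh p) = coeff ν p := by
  rw [← finSuccEquiv_coeff_coeff, finSucc_sh]; simp

theorem coeff_sh_succ {n : ℕ} (p : MvPolynomial (Fin n) ℂ) (ν : Fin n →₀ ℕ) (i : ℕ) (hi : 0 < i) :
    coeff (ν.cons i) (sh p) = 0 := by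
  rw [← finSuccEquiv_coeff_coeff, finSucc_sh, Polynomial.coeff_C_of_ne_zero (by omega)]; simp

theorem coeff_X_succ {n : ℕ} (p : MvPolynomial (Fin (n + 1)) ℂ) (ν : Fin n →₀ ℕ) (i : ℕ) :
    coeff (ν.cons (i + 1)) (X 0 * p) = coeff (ν.cons i) p := by
  rw [← finSuccEquiv_coeff_coeff, ← finSuccEquiv_coeff_coeff, map_mul, finSuccEquiv_X_zero,
    Polynomial.coeff_X_mul]

theorem coeff_X_zero {n : ℕ} (p : MvPolynomial (Fin (n + 1)) ℂ) (ν : Fin n →₀ ℕ) :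
    coeff (ν.cons 0) (X 0 * p) = 0 := by
  rw [← finSuccEquiv_coeff_coeff, map_mul, finSuccEquiv_X_zero]
  simp

/-- Fundamental quasi-symmetric polynomials; the list entry `b` stands for the part `b + 1`. -/
def qF : (n : ℕ) → List ℕ → MvPolynomial (Fin n) ℂ
  | 0, [] => 1
  | 0, _ :: _ => 0
  | _ + 1, [] => 1
  | n + 1, b :: β => Nat.rec (X 0 * sh (qF n β) + sh (qF n (0 :: β)))
      (fun b p => X 0 * p + sh (qF n ((b + 1) :: β))) b

theorem qF_nil (n : ℕ) : qF n [] = 1 := by cases n <;> rfl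

theorem qF_zero_cons (n : ℕ) (β : List ℕ) :
    qF (n + 1) (0 :: β) = X 0 * sh (qF n β) + sh (qF n (0 :: β)) := rfl

theorem qF_succ_cons (n b : ℕ) (β : List ℕ) :
    qF (n + 1) ((b + 1) :: β) = X 0 * qF (n + 1) (b :: β) + sh (qF n ((b + 1) :: β)) := rfl

/-- The coefficient of `qF n α` as a function of the composition. -/
def qc : List ℕ → List ℕ → ℂ
  | [], [] => 1
  | _ :: _, [] => 0
  | [], _ :: _ => 0
  | b :: β, a :: γ => if a = b + 1 then qc β γ else if a ≤ b then qc ((b - a) :: β) γ else 0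

theorem qcomp_cons_zero {n : ℕ} (ν : Fin n →₀ ℕ) : qcomp (ν.cons 0) = qcomp ν := by
  simp [qcomp, List.ofFn_succ]

theorem qcomp_cons_succ {n : ℕ} (ν : Fin n →₀ ℕ) (a : ℕ) :
    qcomp (ν.cons (a + 1)) = (a + 1) :: qcomp ν := by
  simp [qcomp, List.ofFn_succ]

theorem qcomp_zero {n : ℕ} : qcomp (0 : Fin n →₀ ℕ) = [] := by
  simp [qcomp]

theorem qcomp_eq_nil {n : ℕ} (ν : Fin n →₀ ℕ) : qcomp ν = [] ↔ ν = 0 := by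
  constructor
  · intro h
    ext i
    simp [qcomp] at h
    simpa using h i
  · rintro rfl; exact qcomp_zero

theorem qc_nil {n : ℕ} (ν : Fin n →₀ ℕ) : coeff ν (1 : MvPolynomial (Fin n) ℂ) = qc [] (qcomp ν) := by
  rw [coeff_one]
  by_cases h : ν = 0
  · subst h; simp [qcomp_zero, qc]
  · rw [if_neg (fun h' => h h'.symm)]
    have := mt (qcomp_eq_nil ν).1 h
    revert this
    cases qcomp ν <;> simp [qc]

theorem coeff_qF (n : ℕ) : ∀ (α : List ℕ) (ν : Fin n →₀ ℕ), coeff ν (qF n α) = qc α (qcomp ν) := by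
  induction n with
  | zero =>
    intro α ν
    obtain rfl : ν = 0 := Subsingleton.elim _ _
    cases α <;> simp [qF, qcomp_zero, qc]
  | succ n ih =>
    intro α ν
    cases α with
    | nil => rw [qF_nil, qc_nil]
    | cons b β =>
      rw [← Finsupp.cons_tail ν]
      generalize ν 0 = a
      generalize ν.tail = μ
      induction b generalizing a with
      | zero =>
        rw [qF_zero_cons, coeff_add]
        rcases a with _ | a
        · rw [coeff_X_zero, coeff_sh_zero, ih, qcomp_cons_zero, zero_add]
        · rw [coeff_X_succ, coeff_sh_succ (qF n (0 :: β)) _ _ (by omega), qcomp_cons_succ]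
          rcases a with _ | a
          · rw [coeff_sh_zero, ih]; simp [qc]
          · rw [coeff_sh_succ _ _ _ (by omega)]; simp [qc]
      | succ b ihb =>
        rw [qF_succ_cons, coeff_add]
        rcases a with _ | a
        · rw [coeff_X_zero, coeff_sh_zero, ih, qcomp_cons_zero, zero_add]
        · rw [coeff_X_succ, coeff_sh_succ _ _ _ (by omega), qcomp_cons_succ, ihb]
          rcases a with _ | a
          · rw [qcomp_cons_zero]; simp [qc]
          · rw [qcomp_cons_succ]; simp [qc]

theorem qF_mem (n : ℕ) (α : List ℕ) (hα : α ≠ []) : qF n α ∈ Ideal.span (QSymPlus n) := by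
  apply Ideal.subset_span
  refine ⟨fun ν μ h => ?_, ?_⟩
  · rw [coeff_qF, coeff_qF, h]
  · rw [constantCoeff_eq, coeff_qF, qcomp_zero]
    cases α with
    | nil => exact absurd rfl hα
    | cons => simp [qc]

variable {R : Type*} [CommRing R]

/-- Prepending a zero. -/
def Z (x : R) (f : List ℕ → R) : List ℕ → R
  | [] => f []
  | 0 :: β => f (0 :: β) - x * Z x f β
  | (b + 1) :: β => f ((b + 1) :: β) - x * f (b :: β)

/-- Consuming one letter. -/
def stp (x : R) (f : List ℕ → R) : ℕ → List ℕ → R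
  | 0 => Z x f
  | a + 1 => fun β => f (a :: β)

/-- The Aval-Bergeron-Bergeron polynomials. -/
def G : (n : ℕ) → (Fin n → R) → (List ℕ → R) → (Fin n → ℕ) → R
  | 0, _, f, _ => f []
  | n + 1, x, f, ε => G n (Fin.tail x) (stp (x 0) f (ε 0)) (Fin.tail ε)

theorem Z_lin (x y : R) (f g : List ℕ → R) (α : List ℕ) :
    Z x (fun β => y * f β + g β) α = y * Z x f α + Z x g α := by
  induction α with
  | nil => simp [Z]
  | cons b β ih =>
    cases b with
    | zero => simp only [Z, ih]; ring
    | succ b => simp only [Z]; ring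

theorem stp_lin (x y : R) (f g : List ℕ → R) (a : ℕ) :
    stp x (fun β => y * f β + g β) a = fun β => y * stp x f a β + stp x g a β := by
  funext β
  cases a with
  | zero => exact Z_lin x y f g β
  | succ a => rfl

theorem G_lin (n : ℕ) (y : R) : ∀ (x : Fin n → R) (f g : List ℕ → R) (ε : Fin n → ℕ),
    G n x (fun β => y * f β + g β) ε = y * G n x f ε + G n x g ε := by
  induction n with
  | zero => intros; rfl
  | succ n ih =>
    intro x f g ε
    rw [G, stp_lin, ih]; rfl

theorem Z_map {S : Type*} [CommRing S] (φ : R →+* S) (x : R) (f : List ℕ → R) (α : List ℕ) :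
    Z (φ x) (fun β => φ (f β)) α = φ (Z x f α) := by
  induction α with
  | nil => simp [Z]
  | cons b β ih =>
    cases b with
    | zero => simp only [Z, ih]; simp
    | succ b => simp [Z]

theorem G_map {S : Type*} [CommRing S] (φ : R →+* S) (n : ℕ) :
    ∀ (x : Fin n → R) (f : List ℕ → R) (ε : Fin n → ℕ),
    G n (fun i => φ (x i)) (fun β => φ (f β)) ε = φ (G n x f ε) := by
  induction n with
  | zero => intros; rfl
  | succ n ih =>
    intro x f ε
    rw [G, G, ← ih]
    congr 1
    funext β
    cases ε 0 with
    | zero => exact Z_map φ _ _ _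
    | succ a => rfl

/-- Membership invariants. -/
theorem Z_mem (I : Ideal R) (x : R) (f : List ℕ → R) (r : ℕ)
    (h : ∀ α, α ≠ [] → r ≤ α.sum → f α ∈ I) :
    ∀ α, α ≠ [] → r + 1 ≤ α.sum → Z x f α ∈ I := by
  intro α
  induction α with
  | nil => intro h; exact absurd rfl h
  | cons b β ih =>
    intro _ hs
    cases b with
    | zero =>
      simp at hs
      have hb : β ≠ [] := by rintro rfl; simp at hs
      exact I.sub_mem (h _ (by simp) (by simp; omega)) (I.mul_mem_left _ (ih hb hs))
    | succ b =>
      simp at hs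
      exact I.sub_mem (h _ (by simp) (by simp; omega))
        (I.mul_mem_left _ (h _ (by simp) (by simp; omega)))

theorem Z_mem_all (I : Ideal R) (x : R) (f : List ℕ → R)
    (h : ∀ α, f α ∈ I) (α : List ℕ) : Z x f α ∈ I := by
  induction α with
  | nil => exact h _
  | cons b β ih =>
    cases b with
    | zero => exact I.sub_mem (h _) (I.mul_mem_left _ ih)
    | succ b => exact I.sub_mem (h _) (I.mul_mem_left _ (h _))

theorem G_mem_all (I : Ideal R) (n : ℕ) : ∀ (x : Fin n → R) (f : List ℕ → R) (ε : Fin n → ℕ)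
    (_ : ∀ α, f α ∈ I), G n x f ε ∈ I := by
  induction n with
  | zero => intro x f ε h; exact h _
  | succ n ih =>
    intro x f ε h
    rw [G]
    apply ih
    intro α
    cases ε 0 with
    | zero => exact Z_mem_all I _ _ h α
    | succ a => exact h _

theorem G_mem (I : Ideal R) (n : ℕ) : ∀ (x : Fin n → R) (f : List ℕ → R) (ε : Fin n → ℕ) (r : ℕ)
    (_ : ∀ α, α ≠ [] → r ≤ α.sum → f α ∈ I) (_ : ¬ Good n r ε), G n x f ε ∈ I := by
  induction n with
  | zero => intro x f ε r h hb; exact absurd trivial hb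
  | succ n ih =>
    intro x f ε r h hb
    rw [G]
    rw [Good] at hb
    rcases hε : ε 0 with _ | a
    · rw [hε] at hb
      refine ih _ _ _ (r + 1) (Z_mem I _ _ _ h) ?_
      simpa using hb
    · rw [hε] at hb
      by_cases har : a < r
      · refine ih _ _ _ (r - a) ?_ ?_
        · intro β _ hs
          exact h _ (by simp) (by simp; omega)
        · intro hg
          apply hb
          refine ⟨by omega, ?_⟩
          rwa [show r + 1 - (a + 1) = r - a by omega]
      · apply G_mem_all
        intro β
        exact h _ (by simp) (by simp; omega)

theorem Z_qF (n : ℕ) (α : List ℕ) : Z (X 0) (qF (n + 1)) α = sh (qF n α) := by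
  induction α with
  | nil => simp [Z, qF_nil]
  | cons b β ih =>
    cases b with
    | zero => rw [Z, ih, qF_zero_cons]; ring
    | succ b => rw [Z, qF_succ_cons]; ring

/-- The polynomial attached to `ε`. -/
def GG (n : ℕ) (ε : Fin n → ℕ) : MvPolynomial (Fin n) ℂ := G n X (qF n) ε

theorem G_sh (n : ℕ) (f : List ℕ → MvPolynomial (Fin n) ℂ) (ε : Fin n → ℕ) :
    G n (Fin.tail (X : Fin (n + 1) → MvPolynomial (Fin (n + 1)) ℂ)) (fun β => sh (f β)) ε
      = sh (G n X f ε) := by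
  rw [← AlgHom.coe_toRingHom sh, ← G_map]
  congr 1
  funext i
  simp [sh, Fin.tail]

theorem GG_coeff (n : ℕ) (ε : Fin (n + 1) → ℕ) (ν : Fin n →₀ ℕ) :
    coeff (ν.cons (ε 0)) (GG (n + 1) ε) = coeff ν (GG n (Fin.tail ε)) ∧
    ∀ i, ε 0 < i → coeff (ν.cons i) (GG (n + 1) ε) = 0 := by
  rw [GG, G]
  rcases ε 0 with _ | a
  · have : stp (X 0) (qF (n + 1)) 0 = fun β => sh (qF n β) := funext fun α => Z_qF n α
    rw [this, G_sh]
    exact ⟨coeff_sh_zero _ _, fun i hi => coeff_sh_succ _ _ _ hi⟩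
  · simp only [stp]
    induction a with
    | zero =>
      simp only [qF_zero_cons]
      rw [G_lin, G_sh, G_sh n (fun β => qF n (0 :: β))]
      constructor
      · rw [coeff_add, coeff_X_succ, coeff_sh_zero, coeff_sh_succ _ _ _ (by omega), add_zero]; rfl
      · intro i hi
        obtain ⟨i, rfl⟩ : ∃ j, i = j + 1 := ⟨i - 1, by omega⟩
        rw [coeff_add, coeff_X_succ, coeff_sh_succ _ _ _ (by omega),
          coeff_sh_succ _ _ _ (by omega), add_zero]
    | succ a ih =>
      simp only [qF_succ_cons]
      rw [G_lin, G_sh n (fun β => qF n ((a + 1) :: β))]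
      constructor
      · rw [coeff_add, coeff_X_succ, coeff_sh_succ _ _ _ (by omega), add_zero]
        exact ih.1
      · intro i hi
        obtain ⟨i, rfl⟩ : ∃ j, i = j + 1 := ⟨i - 1, by omega⟩
        rw [coeff_add, coeff_X_succ, coeff_sh_succ _ _ _ (by omega), add_zero]
        exact ih.2 i (by omega)

/-- Lexicographic order. -/
def LexLt {n : ℕ} (d c : Fin n → ℕ) : Prop := Pi.Lex (· < ·) (· < ·) d c

theorem lexLt_wf (n : ℕ) : WellFounded (LexLt (n := n)) :=
  Pi.Lex.wellFounded (· < ·) fun _ => Nat.lt_wfRel.wf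

theorem GG_lead (n : ℕ) : ∀ (ε δ : Fin n →₀ ℕ), coeff ε (GG n ε) = 1 ∧
    (coeff δ (GG n ε) ≠ 0 → δ = ε ∨ LexLt δ ε) := by
  induction n with
  | zero =>
    intro ε δ
    obtain rfl : ε = 0 := Subsingleton.elim _ _
    obtain rfl : δ = 0 := Subsingleton.elim _ _
    simp [GG, G, qF]
  | succ n ih =>
    intro ε δ
    have ht : (Fin.tail ε : Fin n → ℕ) = ε.tail := rfl
    have hε := Finsupp.cons_tail ε
    have hδ := Finsupp.cons_tail δ
    constructor
    · have := (GG_coeff n ε ε.tail).1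
      rw [hε] at this
      rw [this, ht]
      exact (ih ε.tail ε.tail).1
    · intro h
      rcases lt_trichotomy (δ 0) (ε 0) with h1 | h1 | h1
      · exact Or.inr ⟨0, fun j hj => absurd hj (Fin.not_lt_zero j), h1⟩
      · have := (GG_coeff n ε δ.tail).1
        rw [← h1, hδ, ht] at this
        rw [this] at h
        rcases (ih ε.tail δ.tail).2 h with h2 | ⟨k, hk, hk'⟩
        · left
          rw [← hε, ← hδ, h1, h2]
        · right
          refine ⟨k.succ, fun j hj => ?_, hk'⟩
          refine Fin.cases (fun _ => h1) (fun j hj => ?_) j hj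
          exact hk j (by simpa using hj)
      · have := (GG_coeff n ε δ.tail).2 (δ 0) h1
        rw [hδ] at this
        exact absurd this h

theorem GG_mem (n : ℕ) (ε : Fin n → ℕ) (h : ¬ Good n 0 ε) :
    GG n ε ∈ Ideal.span (QSymPlus n) :=
  G_mem _ n _ _ _ 0 (fun α hα _ => qF_mem n α hα) h

/-- Spanning. -/
theorem mem_span_good (n : ℕ) (M : Submodule ℂ (MvPolynomial (Fin n) ℂ))
    (hI : ∀ p ∈ Ideal.span (QSymPlus n), p ∈ M)
    (hg : ∀ ε : Fin n →₀ ℕ, Good n 0 ε → monomial ε 1 ∈ M) : M = ⊤ := by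
  have key : ∀ ε : Fin n →₀ ℕ, monomial ε (1 : ℂ) ∈ M := by
    intro ε
    induction ε using (InvImage.wf (fun ε : Fin n →₀ ℕ => (ε : Fin n → ℕ)) (lexLt_wf n)).induction with
    | _ ε ih =>
    by_cases h : Good n 0 ε
    · exact hg ε h
    · have h1 := hI _ (GG_mem n ε h)
      have h2 : monomial ε (1 : ℂ) = GG n ε - (GG n ε - monomial ε 1) := by ring
      rw [h2]
      refine M.sub_mem h1 ?_
      rw [← support_sum_monomial_coeff (GG n ε - monomial ε 1)]
      refine M.sum_mem fun δ hδ => ?_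
      rw [mem_support_iff, coeff_sub, coeff_monomial] at hδ
      have h3 : monomial δ (coeff δ (GG n ε - monomial ε 1)) =
          coeff δ (GG n ε - monomial ε 1) • monomial δ (1 : ℂ) := by
        rw [smul_monomial, smul_eq_mul, mul_one]
      rw [h3]
      apply M.smul_mem
      by_cases he : ε = δ
      · subst he
        rw [if_pos rfl, (GG_lead n ε ε).1] at hδ
        simp at hδ
      · rw [if_neg he, sub_zero] at hδ
        rcases (GG_lead n ε δ).2 hδ with h4 | h4
        · exact absurd h4.symm he
        · exact ih δ h4
  rw [eq_top_iff]
  intro p _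
  rw [← support_sum_monomial_coeff p]
  refine M.sum_mem fun δ _ => ?_
  have h3 : monomial δ (coeff δ p) = coeff δ p • monomial δ (1 : ℂ) := by
    rw [smul_monomial, smul_eq_mul, mul_one]
  rw [h3]
  exact M.smul_mem _ (key δ)

end

end QS

namespace QS

noncomputable section

/-- Insert a zero at position `i`. -/
def ins {n : ℕ} (i : Fin (n + 1)) (ν : Fin n →₀ ℕ) : Fin (n + 1) →₀ ℕ :=
  ν.mapDomain i.succAbove

theorem ins_self {n : ℕ} (i : Fin (n + 1)) (ν : Fin n →₀ ℕ) : ins i ν i = 0 := by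
  apply Finsupp.mapDomain_of_notMem_range
  simp

theorem ins_succAbove {n : ℕ} (i : Fin (n + 1)) (ν : Fin n →₀ ℕ) (j : Fin n) :
    ins i ν (i.succAbove j) = ν j :=
  Finsupp.mapDomain_apply Fin.succAbove_right_injective _ _

theorem ins_inj {n : ℕ} (i : Fin (n + 1)) {ν μ : Fin n →₀ ℕ} (h : ins i ν = ins i μ) : ν = μ := by
  ext j
  rw [← ins_succAbove i ν, h, ins_succAbove]

theorem ins_zero {n : ℕ} (ν : Fin n →₀ ℕ) : ins 0 ν = ν.cons 0 := by
  ext j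
  refine Fin.cases ?_ (fun j => ?_) j
  · rw [ins_self]; rfl
  · rw [Finsupp.cons_succ]
    exact ins_succAbove 0 ν j

theorem ins_succ {n : ℕ} (i : Fin (n + 1)) (ν : Fin (n + 1) →₀ ℕ) :
    ins i.succ ν = (ins i ν.tail).cons (ν 0) := by
  ext j
  refine Fin.cases ?_ (fun j => ?_) j
  · have := ins_succAbove i.succ ν 0
    rw [Fin.succ_succAbove_zero] at this
    rw [this]; rfl
  · rw [Finsupp.cons_succ]
    induction j using Fin.succAboveCases i with
    | x => rw [ins_self, ins_self]
    | p j =>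
      rw [ins_succAbove, ← Fin.succ_succAbove_succ, ins_succAbove]; rfl

theorem qcomp_ins {n : ℕ} (i : Fin (n + 1)) (ν : Fin n →₀ ℕ) : qcomp (ins i ν) = qcomp ν := by
  induction n with
  | zero =>
    obtain rfl : i = 0 := Fin.fin_one_eq_zero i
    rw [ins_zero, qcomp_cons_zero]
  | succ n ih =>
    refine Fin.cases ?_ (fun i => ?_) i
    · rw [ins_zero, qcomp_cons_zero]
    · rw [ins_succ]
      conv_rhs => rw [← Finsupp.cons_tail ν]
      cases ν 0 with
      | zero => rw [qcomp_cons_zero, qcomp_cons_zero, ih]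
      | succ a => rw [qcomp_cons_succ, qcomp_cons_succ, ih]

/-- Set the variable `i` to zero and relabel. -/
def Rm {n : ℕ} (i : Fin (n + 1)) : MvPolynomial (Fin (n + 1)) ℂ →ₐ[ℂ] MvPolynomial (Fin n) ℂ :=
  killCompl (Fin.succAbove_right_injective (p := i))

theorem coeff_Rm {n : ℕ} (i : Fin (n + 1)) (f : MvPolynomial (Fin (n + 1)) ℂ) (ν : Fin n →₀ ℕ) :
    coeff ν (Rm i f) = coeff (ins i ν) f := coeff_killCompl _

/-- Trimming operators. -/
def T {n : ℕ} (p : Fin n) : MvPolynomial (Fin (n + 1)) ℂ →ₗ[ℂ] MvPolynomial (Fin n) ℂ where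
  toFun f := (Rm p.succ f - Rm p.castSucc f).divMonomial (Finsupp.single p 1)
  map_add' f g := by
    ext ν
    simp only [coeff_divMonomial, coeff_add, map_add, coeff_sub]
    ring
  map_smul' a f := by
    ext ν
    simp only [coeff_divMonomial, coeff_smul, map_smul, coeff_sub, smul_eq_mul, RingHom.id_apply]
    ring

theorem coeff_T {n : ℕ} (p : Fin n) (f : MvPolynomial (Fin (n + 1)) ℂ) (ν : Fin n →₀ ℕ) :
    coeff ν (T p f) = coeff (ins p.succ (Finsupp.single p 1 + ν)) f -
      coeff (ins p.castSucc (Finsupp.single p 1 + ν)) f := by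
  simp only [T, LinearMap.coe_mk, AddHom.coe_mk, coeff_divMonomial, coeff_sub, coeff_Rm]

theorem ins_eq {n : ℕ} (p : Fin n) (ν : Fin n →₀ ℕ) (h : ν p = 0) :
    ins p.succ ν = ins p.castSucc ν := by
  ext j
  induction j using Fin.succAboveCases p.succ with
  | x =>
    rw [ins_self]
    have := ins_succAbove p.castSucc ν p
    rw [Fin.succAbove_castSucc_self] at this
    rw [this, h]
  | p j =>
    rw [ins_succAbove]
    rcases lt_trichotomy j p with hj | hj | hj
    · rw [Fin.succAbove_of_castSucc_lt _ _ (by have := Fin.lt_def.1 hj; rw [Fin.lt_def]; simp only [Fin.val_castSucc, Fin.val_succ]; omega),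
        ← Fin.succAbove_of_castSucc_lt p.castSucc j (by simpa using hj), ins_succAbove]
    · subst hj
      rw [Fin.succAbove_succ_self, ins_self, h]
    · rw [Fin.succAbove_of_le_castSucc _ _ (by
          have := Fin.lt_def.1 hj; rw [Fin.le_def]; simp only [Fin.val_castSucc, Fin.val_succ]; omega),
        ← Fin.succAbove_of_le_castSucc p.castSucc j (by
          have := Fin.lt_def.1 hj; rw [Fin.le_def]; simp only [Fin.val_castSucc, Fin.val_succ]; omega), ins_succAbove]

theorem X_mul_T {n : ℕ} (p : Fin n) (f : MvPolynomial (Fin (n + 1)) ℂ) :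
    X p * T p f = Rm p.succ f - Rm p.castSucc f := by
  have h := divMonomial_add_modMonomial_single (Rm p.succ f - Rm p.castSucc f) p
  have h0 : (Rm p.succ f - Rm p.castSucc f).modMonomial (Finsupp.single p 1) = 0 := by
    ext ν
    by_cases hν : Finsupp.single p 1 ≤ ν
    · rw [coeff_modMonomial_of_le _ hν]; simp
    · rw [coeff_modMonomial_of_not_le _ hν, coeff_sub, coeff_Rm, coeff_Rm, ins_eq, sub_self]
      · simp
      · rw [Finsupp.single_le_iff] at hν; omega
  rw [h0, add_zero] at h
  exact h

theorem Rm_qsym {n : ℕ} (i : Fin (n + 1)) {g : MvPolynomial (Fin (n + 1)) ℂ}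
    (hg : g ∈ QSymPlus (n + 1)) : Rm i g ∈ QSymPlus n := by
  refine ⟨fun ν μ h => ?_, ?_⟩
  · rw [coeff_Rm, coeff_Rm]
    apply hg.1
    rw [qcomp_ins, qcomp_ins, h]
  · rw [constantCoeff_eq, coeff_Rm, ← hg.2, constantCoeff_eq]
    simp [ins]

theorem T_mul_qsym {n : ℕ} (p : Fin n) (f : MvPolynomial (Fin (n + 1)) ℂ)
    {g : MvPolynomial (Fin (n + 1)) ℂ} (hg : g ∈ QSymPlus (n + 1)) :
    T p (f * g) = T p f * Rm p.succ g := by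
  have h1 : Rm p.castSucc g = Rm p.succ g := by
    ext ν
    rw [coeff_Rm, coeff_Rm]
    apply hg.1
    rw [qcomp_ins, qcomp_ins]
  apply mul_left_cancel₀ (X_ne_zero (R := ℂ) p)
  rw [X_mul_T, ← mul_assoc, X_mul_T, map_mul, map_mul, h1]
  ring

theorem T_mem {n : ℕ} (p : Fin n) (f : MvPolynomial (Fin (n + 1)) ℂ)
    (hf : f ∈ Ideal.span (QSymPlus (n + 1))) : T p f ∈ Ideal.span (QSymPlus n) := by
  suffices ∀ a, T p (a * f) ∈ Ideal.span (QSymPlus n) by simpa using this 1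
  induction hf using Submodule.span_induction with
  | mem g hg =>
    intro a
    rw [T_mul_qsym p a hg]
    exact Ideal.mul_mem_left _ _ (Ideal.subset_span (Rm_qsym _ hg))
  | zero => intro a; simp
  | add x y _ _ hx hy => intro a; rw [mul_add, map_add]; exact Ideal.add_mem _ (hx a) (hy a)
  | smul b x _ hx => intro a; rw [smul_eq_mul, ← mul_assoc]; exact hx _

/-- Colexicographic order. -/
def ColexLt {n : ℕ} (d c : Fin n → ℕ) : Prop := Pi.Lex (· > ·) (· < ·) d c

theorem colexLt_wf (n : ℕ) : WellFounded (ColexLt (n := n)) :=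
  Pi.Lex.wellFounded (· > ·) fun _ => Nat.lt_wfRel.wf

theorem exists_ins (n : ℕ) : ∀ (r : ℕ) (c : Fin (n + 1) →₀ ℕ), Good (n + 1) r c → c ≠ 0 → c 0 = 0 →
    ∃ (p : Fin n) (c' : Fin n →₀ ℕ), c = ins p.castSucc (Finsupp.single p 1 + c') ∧ Good n r c' := by
  induction n with
  | zero =>
    intro r c _ h0 h1
    exfalso
    apply h0
    ext i
    obtain rfl : i = 0 := Fin.fin_one_eq_zero i
    exact h1
  | succ n ih =>
    intro r c hg h0 h1
    have hc : c = c.tail.cons 0 := by rw [← h1]; exact (Finsupp.cons_tail c).symm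
    obtain ⟨_, hg2⟩ := hg
    rw [h1] at hg2
    change Good (n + 1) (r + 1) c.tail at hg2
    by_cases h2 : c.tail 0 = 0
    · have h3 : c.tail ≠ 0 := by
        intro h; apply h0; rw [hc, h]; simp
      obtain ⟨p, c', hp, hc'⟩ := ih (r + 1) c.tail hg2 h3 h2
      refine ⟨p.succ, c'.cons 0, ?_, ?_, ?_⟩
      · rw [← Fin.succ_castSucc, ins_succ, hc, hp]
        have e1 : (Finsupp.single p.succ 1 + c'.cons 0).tail = Finsupp.single p 1 + c' := by
          ext j
          rw [Finsupp.tail_apply, Finsupp.add_apply, Finsupp.cons_succ]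
          simp [Finsupp.single_apply]
        rw [e1]
        simp
      · simp
      · exact hc'
    · obtain ⟨a, ha⟩ : ∃ a, c.tail 0 = a + 1 := ⟨c.tail 0 - 1, by omega⟩
      refine ⟨0, c.tail.tail.cons a, ?_, ?_, ?_⟩
      · rw [Fin.castSucc_zero, ins_zero]
        conv_lhs => rw [hc, ← Finsupp.cons_tail c.tail, ha]
        congr 1
        ext j
        refine Fin.cases ?_ (fun j => ?_) j
        · simp [add_comm]
        · simp
      · have := hg2.1
        simp
        omega
      · have := hg2.2
        rw [ha] at this
        rw [show r + 1 + 1 - (a + 1) = r + 1 - a by omega] at this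
        exact this

theorem T_castSucc {n : ℕ} (p : Fin n) (d : Fin n →₀ ℕ) :
    T p (monomial (ins p.castSucc (Finsupp.single p 1 + d)) 1) = - monomial d 1 := by
  ext ν
  rw [coeff_T, coeff_monomial, coeff_monomial, coeff_neg, coeff_monomial, if_neg, zero_sub]
  · congr 2
    apply propext
    constructor
    · intro h; exact add_left_cancel (ins_inj _ h)
    · rintro rfl; rfl
  · intro h
    have h1 := DFunLike.congr_fun h p.succ
    rw [ins_self] at h1
    have h2 := ins_succAbove p.castSucc (Finsupp.single p 1 + d) p
    rw [Fin.succAbove_castSucc_self, h1] at h2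
    simp at h2
    omega

theorem T_succ {n : ℕ} (p : Fin n) (d : Fin n →₀ ℕ) :
    T p (monomial (ins p.succ (Finsupp.single p 1 + d)) 1) = monomial d 1 := by
  ext ν
  rw [coeff_T, coeff_monomial, coeff_monomial, coeff_monomial,
    if_neg (c := _ = ins p.castSucc _), sub_zero]
  · congr 1
    apply propext
    constructor
    · intro h; exact add_left_cancel (ins_inj _ h)
    · rintro rfl; rfl
  · intro h
    have h1 := DFunLike.congr_fun h p.castSucc
    rw [ins_self] at h1
    have h2 := ins_succAbove p.succ (Finsupp.single p 1 + d) p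
    rw [Fin.succAbove_succ_self, h1] at h2
    simp at h2
    omega

theorem T_other {n : ℕ} (p : Fin n) (d : Fin (n + 1) →₀ ℕ) (h : T p (monomial d 1) ≠ 0) :
    (∃ d', d = ins p.castSucc (Finsupp.single p 1 + d')) ∨
    (∃ d', d = ins p.succ (Finsupp.single p 1 + d')) := by
  obtain ⟨ν, hν⟩ := ne_zero_iff.1 h
  rw [coeff_T, coeff_monomial, coeff_monomial] at hν
  by_cases h1 : d = ins p.castSucc (Finsupp.single p 1 + ν)
  · exact Or.inl ⟨ν, h1⟩
  · by_cases h2 : d = ins p.succ (Finsupp.single p 1 + ν)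
    · exact Or.inr ⟨ν, h2⟩
    · simp [h1, h2] at hν

theorem colex_castSucc {n : ℕ} (p : Fin n) {d c : Fin n →₀ ℕ} (h : ColexLt d c) :
    ColexLt (ins p.castSucc (Finsupp.single p 1 + d)) (ins p.castSucc (Finsupp.single p 1 + c)) := by
  obtain ⟨k, hk, hk'⟩ := h
  refine ⟨p.castSucc.succAbove k, ?_, ?_⟩
  · intro j hj
    induction j using Fin.succAboveCases p.castSucc with
    | x => rw [ins_self, ins_self]
    | p j =>
      rw [ins_succAbove, ins_succAbove]
      have := hk j ((Fin.strictMono_succAbove p.castSucc).lt_iff_lt.1 hj)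
      simp [this]
  · rw [ins_succAbove, ins_succAbove]
    simpa using hk'

theorem ins_succ_gt {n : ℕ} (p j : Fin n) (h : p < j) (d : Fin n →₀ ℕ) :
    ins p.succ d j.succ = d j := by
  rw [← Fin.succAbove_of_le_castSucc p.succ j (by
      have := Fin.lt_def.1 h; rw [Fin.le_def]; simp only [Fin.val_castSucc, Fin.val_succ]; omega),
    ins_succAbove]

theorem ins_castSucc_ge {n : ℕ} (p j : Fin n) (h : p ≤ j) (d : Fin n →₀ ℕ) :
    ins p.castSucc d j.succ = d j := by
  rw [← Fin.succAbove_of_le_castSucc p.castSucc j (by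
      have := Fin.le_def.1 h; rw [Fin.le_def]; simp only [Fin.val_castSucc]; omega),
    ins_succAbove]

theorem colex_succ {n : ℕ} (p : Fin n) {d c : Fin n →₀ ℕ} (h : d = c ∨ ColexLt d c) :
    ColexLt (ins p.succ (Finsupp.single p 1 + d)) (ins p.castSucc (Finsupp.single p 1 + c)) := by
  by_cases hd : ∃ k, p < k ∧ (∀ j, k < j → d j = c j) ∧ d k < c k
  · obtain ⟨k, hpk, hk, hk'⟩ := hd
    refine ⟨k.succ, ?_, ?_⟩
    · intro j hj
      obtain ⟨j, rfl⟩ : ∃ i : Fin n, j = i.succ := Fin.exists_succ_eq.2 (by rintro rfl; simp at hj) |>.imp fun _ h => h.symm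
      have hj : k < j := by simpa using hj
      rw [ins_succ_gt p j (hpk.trans hj), ins_castSucc_ge p j (hpk.trans hj).le]
      simp [hk j hj]
    · rw [ins_succ_gt p k hpk, ins_castSucc_ge p k hpk.le]
      simpa using hk'
  · have h2 : ∀ j, p < j → d j = c j := by
      rcases h with rfl | ⟨k, hk, hk'⟩
      · intros; rfl
      · intro j hj
        rcases lt_or_ge k j with h1 | h1
        · exact hk j h1
        · exact absurd ⟨k, hj.trans_le h1, hk, hk'⟩ hd
    refine ⟨p.succ, ?_, ?_⟩
    · intro j hj
      obtain ⟨j, rfl⟩ : ∃ i : Fin n, j = i.succ := Fin.exists_succ_eq.2 (by rintro rfl; simp at hj) |>.imp fun _ h => h.symm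
      have hj : p < j := by simpa using hj
      rw [ins_succ_gt p j hj, ins_castSucc_ge p j hj.le]
      simp [h2 j hj]
    · rw [ins_self, ins_castSucc_ge p p le_rfl]
      simp

theorem span_constantCoeff {n : ℕ} {f : MvPolynomial (Fin n) ℂ}
    (hf : f ∈ Ideal.span (QSymPlus n)) : constantCoeff f = 0 := by
  have : Ideal.span (QSymPlus n) ≤ RingHom.ker (constantCoeff (R := ℂ) (σ := Fin n)) :=
    Ideal.span_le.2 fun g hg => hg.2
  exact this hf

theorem exists_functional_zero (n : ℕ) : ∃ φ : MvPolynomial (Fin n) ℂ →ₗ[ℂ] ℂ,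
    (∀ f ∈ Ideal.span (QSymPlus n), φ f = 0) ∧ φ (monomial 0 1) ≠ 0 ∧
    ∀ d : Fin n →₀ ℕ, φ (monomial d 1) ≠ 0 → d = 0 ∨ ColexLt d (0 : Fin n →₀ ℕ) := by
  refine ⟨lcoeff ℂ 0, ?_, ?_, ?_⟩
  · intro f hf
    exact span_constantCoeff hf
  · simp
  · intro d hd
    left
    by_contra h
    simp [coeff_monomial, h] at hd

theorem exists_functional (n : ℕ) : ∀ c : Fin n →₀ ℕ, Good n 0 c →
    ∃ φ : MvPolynomial (Fin n) ℂ →ₗ[ℂ] ℂ,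
    (∀ f ∈ Ideal.span (QSymPlus n), φ f = 0) ∧ φ (monomial c 1) ≠ 0 ∧
    ∀ d : Fin n →₀ ℕ, φ (monomial d 1) ≠ 0 → d = c ∨ ColexLt d c := by
  induction n with
  | zero =>
    intro c _
    obtain rfl : c = 0 := Subsingleton.elim _ _
    exact exists_functional_zero 0
  | succ n ih =>
    intro c hc
    by_cases h0 : c = 0
    · subst h0; exact exists_functional_zero _
    · obtain ⟨p, c', rfl, hg⟩ := exists_ins n 0 c hc h0 (by simpa using hc.1)
      obtain ⟨φ, h1, h2, h3⟩ := ih c' hg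
      refine ⟨φ ∘ₗ T p, fun f hf => h1 _ (T_mem p f hf), ?_, ?_⟩
      · rw [LinearMap.comp_apply, T_castSucc, map_neg]
        exact neg_ne_zero.2 h2
      · intro d hd
        rw [LinearMap.comp_apply] at hd
        have hT : T p (monomial d 1) ≠ 0 := by
          intro h; rw [h, map_zero] at hd; exact hd rfl
        rcases T_other p d hT with ⟨d', rfl⟩ | ⟨d', rfl⟩
        · rw [T_castSucc, map_neg, neg_ne_zero] at hd
          rcases h3 d' hd with rfl | h
          · exact Or.inl rfl
          · exact Or.inr (colex_castSucc p h)
        · rw [T_succ] at hd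
          exact Or.inr (colex_succ p (h3 d' hd))

/-- The index set of the basis. -/
abbrev GoodF (n : ℕ) := {ε : Fin n →₀ ℕ // Good n 0 ε}

/-- The candidate basis. -/
def bv (n : ℕ) (c : GoodF n) : MvPolynomial (Fin n) ℂ ⧸ Ideal.span (QSymPlus n) :=
  Ideal.Quotient.mkₐ ℂ (Ideal.span (QSymPlus n)) (monomial c.1 1)

theorem bv_li (n : ℕ) : LinearIndependent ℂ (bv n) := by
  rw [linearIndependent_iff']
  intro s a hs
  have hs' : ∑ c ∈ s, a c • monomial c.1 (1 : ℂ) ∈ Ideal.span (QSymPlus n) := by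
    rw [← Ideal.Quotient.eq_zero_iff_mem]
    change Ideal.Quotient.mkₐ ℂ (Ideal.span (QSymPlus n)) _ = 0
    rw [map_sum, ← hs]
    simp [bv]
  intro c
  induction c using (InvImage.wf (fun ε : GoodF n => (ε.1 : Fin n → ℕ)) (colexLt_wf n)).induction with
  | _ c ih =>
  intro hcs
  obtain ⟨φ, h1, h2, h3⟩ := exists_functional n c.1 c.2
  have h4 := h1 _ hs'
  rw [map_sum, Finset.sum_eq_single c] at h4
  · rw [map_smul, smul_eq_mul] at h4
    exact (mul_eq_zero.1 h4).resolve_right h2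
  · intro d hd hdc
    rw [map_smul, smul_eq_mul]
    by_cases hφ : φ (monomial d.1 1) = 0
    · rw [hφ, mul_zero]
    · rcases h3 _ hφ with h | h
      · exact absurd (Subtype.ext h) hdc
      · rw [ih d h hd, zero_mul]
  · intro h; exact absurd hcs h

theorem bv_span (n : ℕ) : ⊤ ≤ Submodule.span ℂ (Set.range (bv n)) := by
  have h := mem_span_good n ((Submodule.span ℂ (Set.range (bv n))).comap
    (Ideal.Quotient.mkₐ ℂ (Ideal.span (QSymPlus n))).toLinearMap) ?_ ?_
  · intro x _
    obtain ⟨p, rfl⟩ := Ideal.Quotient.mkₐ_surjective ℂ _ x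
    have : p ∈ (⊤ : Submodule ℂ (MvPolynomial (Fin n) ℂ)) := trivial
    rw [← h] at this
    exact this
  · intro p hp
    rw [Submodule.mem_comap]
    have : (Ideal.Quotient.mkₐ ℂ (Ideal.span (QSymPlus n))).toLinearMap p = 0 :=
      Ideal.Quotient.eq_zero_iff_mem.2 hp
    rw [this]
    exact Submodule.zero_mem _
  · intro ε hε
    exact Submodule.subset_span ⟨⟨ε, hε⟩, rfl⟩

theorem card_goodF (n : ℕ) (hn : 0 < n) : Nat.card (GoodF n) = catalan n := by
  rw [← card_good n hn]
  exact Nat.card_congr (Finsupp.equivFunOnFinite.subtypeEquiv fun _ => Iff.rfl)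

end

end QS

/-- `dim_ℂ ℂ[x₁,…,xₙ]/⟨QSymₙ⁺⟩ = Cₙ`, the n-th Catalan number. -/
theorem finrank_quotient_qsym (n : ℕ) (hn : 0 < n) :
    Module.finrank ℂ (MvPolynomial (Fin n) ℂ ⧸ Ideal.span (QSymPlus n))
      = catalan n := by
  rw [Module.finrank_eq_nat_card_basis (Module.Basis.mk (QS.bv_li n) (QS.bv_span n)),
    QS.card_goodF n hn]
end

section
/- The Hilbert series of the quotient C[x_1,...,x_n]/⟨QSym_n^+⟩ (equivalently, the generating polynomial by total degree of Dyck vectors in N^n) is F_n(t) = Σ_{k=0}^{n-1} ((n-k)/(n+k))·binom(n+k, k)·t^k. -/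
open MvPolynomial

/-- A Dyck vector. -/
def IsDyck {n : ℕ} (η : Fin n → ℕ) : Prop :=
  ∀ k : Fin n, ∑ i ∈ Finset.univ.filter (· ≤ k), η i ≤ (k : ℕ)

/-! ### Fundamental quasi-symmetric polynomials -/

/-- Coefficient of the fundamental quasi-symmetric function indexed by a composition,
at an exponent list. -/
def fundCoef : List ℕ → List ℕ → ℂ
  | α, [] => if α = [] then 1 else 0
  | α, g :: γ => if g = 0 then fundCoef α γ else
      match α with
      | [] => 0
      | a :: β => if g < a then fundCoef ((a - g) :: β) γ
          else if g = a then fundCoef β γ else 0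

theorem fundCoef_filter (l : List ℕ) : ∀ α : List ℕ,
    fundCoef α (l.filter (· ≠ 0)) = fundCoef α l := by
  induction l with
  | nil => intro α; rfl
  | cons g γ ih =>
    intro α
    by_cases hg : g = 0
    · subst hg
      simpa [fundCoef] using ih α
    · rw [List.filter_cons_of_pos (by simpa using hg)]
      cases α with
      | nil => simp [fundCoef, hg]
      | cons a β =>
        simp only [fundCoef, hg, if_false]
        rw [ih, ih]

theorem fundCoef_sum (l : List ℕ) : ∀ α : List ℕ, fundCoef α l ≠ 0 → l.sum = α.sum := by
  induction l with
  | nil =>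
    intro α h
    by_cases hα : α = []
    · simp [hα]
    · simp [fundCoef, hα] at h
  | cons g γ ih =>
    intro α h
    by_cases hg : g = 0
    · subst hg
      simp only [fundCoef, if_true] at h
      simpa using ih α h
    · cases α with
      | nil => simp [fundCoef, hg] at h
      | cons a β =>
        simp only [fundCoef, hg, if_false] at h
        split_ifs at h with h1 h2
        · have := ih _ h
          simp only [List.sum_cons] at this ⊢
          omega
        · have := ih _ h
          simp only [List.sum_cons] at this ⊢
          omega
        · exact absurd rfl h

/-- Fundamental quasi-symmetric polynomial in `n` variables. -/
noncomputable def fund (n : ℕ) (α : List ℕ) : MvPolynomial (Fin n) ℂ :=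
  ∑ ν ∈ Finset.finsuppAntidiag (Finset.univ : Finset (Fin n)) α.sum,
    monomial ν (fundCoef α (List.ofFn ν))

theorem coeff_fund (n : ℕ) (α : List ℕ) (ν : Fin n →₀ ℕ) :
    (fund n α).coeff ν = fundCoef α (List.ofFn ν) := by
  classical
  unfold fund
  rw [coeff_sum]
  simp only [coeff_monomial]
  rw [Finset.sum_ite_eq']
  split_ifs with h
  · rfl
  · by_contra hne
    apply h
    have := fundCoef_sum _ _ (fun h0 => hne h0.symm)
    rw [Finset.mem_finsuppAntidiag]
    refine ⟨?_, by simp⟩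
    rw [← this, List.sum_ofFn]

theorem fund_homog (n : ℕ) (α : List ℕ) : (fund n α).IsHomogeneous α.sum := by
  unfold fund
  apply IsHomogeneous.sum
  intro ν hν
  apply isHomogeneous_monomial
  rw [Finset.mem_finsuppAntidiag] at hν
  rw [Finsupp.degree_eq_sum]
  exact hν.1

theorem fund_quasi (n : ℕ) (α : List ℕ) : IsQuasiSym (fund n α) := by
  intro ν μ h
  rw [coeff_fund, coeff_fund, ← fundCoef_filter, ← fundCoef_filter (List.ofFn μ)]
  unfold qcomp at h
  exact congrArg _ h

theorem fund_nil (n : ℕ) : fund n [] = 1 := by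
  ext ν
  rw [coeff_fund, coeff_one]
  by_cases h : 0 = ν
  · subst h
    rw [← fundCoef_filter]
    have : (List.ofFn ⇑(0 : Fin n →₀ ℕ)).filter (· ≠ 0) = [] := by
      rw [List.filter_eq_nil_iff]
      intro a ha
      rw [List.mem_ofFn] at ha
      obtain ⟨i, rfl⟩ := ha
      simp
    rw [this]
    simp [fundCoef]
  · rw [if_neg h]
    by_contra hne
    have := fundCoef_sum _ _ hne
    rw [List.sum_ofFn] at this
    simp only [List.sum_nil, Finset.sum_eq_zero_iff] at this
    apply h
    ext i
    simpa using (this i (Finset.mem_univ i)).symm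

theorem ofFn_cons {n : ℕ} (j : ℕ) (ν : Fin n →₀ ℕ) :
    List.ofFn ⇑(Finsupp.cons j ν) = j :: List.ofFn ν := by
  rw [List.ofFn_succ]
  simp

theorem fund_coeff_zero (n : ℕ) (α : List ℕ) :
    (finSuccEquiv ℂ n (fund (n + 1) α)).coeff 0 = fund n α := by
  ext ν
  rw [finSuccEquiv_coeff_coeff, coeff_fund, coeff_fund, ofFn_cons]
  simp [fundCoef]

theorem fund_coeff_lt (n a j : ℕ) (β : List ℕ) (h : j < a) :
    (finSuccEquiv ℂ n (fund (n + 1) (a :: β))).coeff j = fund n ((a - j) :: β) := by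
  ext ν
  rw [finSuccEquiv_coeff_coeff, coeff_fund, coeff_fund, ofFn_cons]
  by_cases hj : j = 0
  · simp [fundCoef, hj]
  · simp [fundCoef, hj, h]

theorem fund_coeff_eq (n a : ℕ) (β : List ℕ) (h : 0 < a) :
    (finSuccEquiv ℂ n (fund (n + 1) (a :: β))).coeff a = fund n β := by
  ext ν
  rw [finSuccEquiv_coeff_coeff, coeff_fund, coeff_fund, ofFn_cons]
  simp [fundCoef, h.ne']

theorem fund_coeff_gt (n a j : ℕ) (β : List ℕ) (h : a < j) :
    (finSuccEquiv ℂ n (fund (n + 1) (a :: β))).coeff j = 0 := by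
  ext ν
  rw [finSuccEquiv_coeff_coeff, coeff_fund, ofFn_cons]
  have h1 : j ≠ 0 := by omega
  have h2 : ¬ j < a := by omega
  have h3 : j ≠ a := by omega
  simp [fundCoef, h1, h2, h3]

/-! ### The polynomials `G` of Aval, Bergeron and Bergeron -/

/-- Treatment of a zero of the exponent vector which is followed by nonzero entries. -/
def gInner {R : Type*} [CommRing R] (x : R) (g : List ℕ → R) : List ℕ → R
  | [] => g []
  | a :: β => if a = 1 then g (1 :: β) - x * gInner x g β
      else g (a :: β) - x * g ((a - 1) :: β)

/-- The `m`-th variable. -/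
noncomputable def xv (n m : ℕ) : MvPolynomial (Fin n) ℂ :=
  if h : m < n then X ⟨m, h⟩ else 0

/-- The polynomial `G` for the exponent vector `p.reverse ++ β`. -/
noncomputable def gPoly (n : ℕ) : List ℕ → List ℕ → MvPolynomial (Fin n) ℂ
  | [] => fund n
  | c :: p => fun β => if c = 0 then gInner (xv n p.length) (gPoly n p) β
      else gPoly n p (c :: β)

/-- All parts are positive. -/
def AllPos (β : List ℕ) : Prop := ∀ b ∈ β, 0 < b

theorem AllPos.cons {b : ℕ} {β : List ℕ} (hb : 0 < b) (h : AllPos β) : AllPos (b :: β) := by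
  intro c hc
  rcases List.mem_cons.1 hc with rfl | hc
  · exact hb
  · exact h c hc

theorem AllPos.nil : AllPos [] := by intro b hb; simp at hb

theorem AllPos.head {b : ℕ} {β : List ℕ} (h : AllPos (b :: β)) : 0 < b := h b (by simp)

theorem AllPos.tail {b : ℕ} {β : List ℕ} (h : AllPos (b :: β)) : AllPos β :=
  fun c hc => h c (by simp [hc])

theorem xv_homog (n m : ℕ) : (xv n m).IsHomogeneous 1 := by
  unfold xv
  split_ifs
  · exact isHomogeneous_X _ _
  · exact isHomogeneous_zero _ _ _

theorem gInner_homog {n s : ℕ} (x : MvPolynomial (Fin n) ℂ) (hx : x.IsHomogeneous 1)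
    (g : List ℕ → MvPolynomial (Fin n) ℂ)
    (hg : ∀ β, AllPos β → (g β).IsHomogeneous (s + β.sum)) :
    ∀ β, AllPos β → (gInner x g β).IsHomogeneous (s + β.sum) := by
  intro β
  induction β with
  | nil => intro h; exact hg _ h
  | cons a β ih =>
    intro h
    have ha := h.head
    simp only [gInner]
    split_ifs with h1
    · subst h1
      refine (hg _ h).sub ?_
      have := hx.mul (ih h.tail)
      rw [show s + (1 :: β).sum = 1 + (s + β.sum) by simp only [List.sum_cons]; omega]
      exact this
    · refine (hg _ h).sub ?_
      have := hx.mul (hg ((a - 1) :: β) (h.tail.cons (by omega)))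
      rw [show s + (a :: β).sum = 1 + (s + ((a - 1) :: β).sum) by
        simp only [List.sum_cons]; omega]
      exact this

theorem gPoly_homog (n : ℕ) (p : List ℕ) : ∀ β, AllPos β →
    (gPoly n p β).IsHomogeneous (p.sum + β.sum) := by
  induction p with
  | nil => intro β _; simpa [gPoly] using fund_homog n β
  | cons c p ih =>
    intro β hβ
    simp only [gPoly]
    split_ifs with h
    · subst h
      simpa using gInner_homog _ (xv_homog _ _) _ ih β hβ
    · have := ih (c :: β) (hβ.cons (by omega))
      convert this using 1
      simp only [List.sum_cons]; omega

/-- The ideal generated by the fundamental quasi-symmetric polynomials of positive degree. -/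
noncomputable def fIdeal (n : ℕ) : Ideal (MvPolynomial (Fin n) ℂ) :=
  Ideal.span {f | ∃ α : List ℕ, 0 < α.sum ∧ f = fund n α}

theorem gInner_mem {n s l : ℕ} (x : MvPolynomial (Fin n) ℂ)
    (g : List ℕ → MvPolynomial (Fin n) ℂ)
    (hg : ∀ β, AllPos β → l + β.length ≤ s + β.sum → 0 < s + β.sum → g β ∈ fIdeal n) :
    ∀ β, AllPos β → l + 1 + β.length ≤ s + β.sum → 0 < s + β.sum →
      gInner x g β ∈ fIdeal n := by
  intro β
  induction β with
  | nil => intro h h1 h2; exact hg _ h (by simp at h1 ⊢; omega) h2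
  | cons a β ih =>
    intro h h1 h2
    have ha := h.head
    simp only [gInner]
    simp only [List.sum_cons, List.length_cons] at h1 h2
    split_ifs with h3
    · subst h3
      refine Ideal.sub_mem _ (hg _ h ?_ ?_) (Ideal.mul_mem_left _ _ (ih h.tail ?_ ?_)) <;>
        (try simp only [List.sum_cons, List.length_cons]) <;> omega
    · refine Ideal.sub_mem _ (hg _ h ?_ ?_)
        (Ideal.mul_mem_left _ _ (hg _ (h.tail.cons (by omega)) ?_ ?_)) <;>
        simp only [List.sum_cons, List.length_cons] <;> omega

theorem gPoly_mem (n : ℕ) (p : List ℕ) : ∀ β, AllPos β →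
    p.length + β.length ≤ p.sum + β.sum → 0 < p.sum + β.sum → gPoly n p β ∈ fIdeal n := by
  induction p with
  | nil =>
    intro β _ _ h
    exact Ideal.subset_span ⟨β, by simpa using h, rfl⟩
  | cons c p ih =>
    intro β hβ h1 h2
    simp only [List.sum_cons, List.length_cons] at h1 h2
    simp only [gPoly]
    split_ifs with h
    · subst h
      exact gInner_mem _ _ ih β hβ (by omega) (by omega)
    · refine ih (c :: β) (hβ.cons (by omega)) ?_ ?_ <;>
        simp only [List.sum_cons, List.length_cons] <;> omega

/-- `f` has degree at most `a` in the first variable, with `a`-th coefficient `u`. -/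
def Lead {n : ℕ} (a : ℕ) (f : MvPolynomial (Fin (n + 1)) ℂ) (u : MvPolynomial (Fin n) ℂ) : Prop :=
  (∀ j, a < j → (finSuccEquiv ℂ n f).coeff j = 0) ∧ (finSuccEquiv ℂ n f).coeff a = u

theorem Lead.sub {n a : ℕ} {f g : MvPolynomial (Fin (n + 1)) ℂ} {u v : MvPolynomial (Fin n) ℂ}
    (h : Lead a f u) (h' : Lead a g v) : Lead a (f - g) (u - v) := by
  refine ⟨fun j hj => ?_, ?_⟩
  · simp [h.1 j hj, h'.1 j hj]
  · simp [h.2, h'.2]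

theorem Lead.add {n a : ℕ} {f g : MvPolynomial (Fin (n + 1)) ℂ} {u v : MvPolynomial (Fin n) ℂ}
    (h : Lead a f u) (h' : Lead a g v) : Lead a (f + g) (u + v) := by
  refine ⟨fun j hj => ?_, ?_⟩
  · simp [h.1 j hj, h'.1 j hj]
  · simp [h.2, h'.2]

theorem Lead.smul {n a : ℕ} {f : MvPolynomial (Fin (n + 1)) ℂ} {u : MvPolynomial (Fin n) ℂ}
    (c : ℂ) (h : Lead a f u) : Lead a (c • f) (c • u) := by
  refine ⟨fun j hj => ?_, ?_⟩
  · simp [h.1 j hj]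
  · simp [h.2]

theorem Lead.xv_mul {n a m : ℕ} {f : MvPolynomial (Fin (n + 1)) ℂ} {u : MvPolynomial (Fin n) ℂ}
    (h : Lead a f u) : Lead a (xv (n + 1) (m + 1) * f) (xv n m * u) := by
  have key : finSuccEquiv ℂ n (xv (n + 1) (m + 1)) = Polynomial.C (xv n m) := by
    unfold xv
    by_cases hm : m < n
    · rw [dif_pos hm, dif_pos (by omega)]
      exact finSuccEquiv_X_succ (j := ⟨m, hm⟩)
    · rw [dif_neg hm, dif_neg (by omega)]
      simp
  refine ⟨fun j hj => ?_, ?_⟩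
  · rw [map_mul, key, Polynomial.coeff_C_mul, h.1 j hj, mul_zero]
  · rw [map_mul, key, Polynomial.coeff_C_mul, h.2]

theorem gInner_lead {n a m : ℕ} {g : List ℕ → MvPolynomial (Fin (n + 1)) ℂ}
    {g' : List ℕ → MvPolynomial (Fin n) ℂ} (hg : ∀ β, AllPos β → Lead a (g β) (g' β)) :
    ∀ β, AllPos β → Lead a (gInner (xv (n + 1) (m + 1)) g β) (gInner (xv n m) g' β) := by
  intro β
  induction β with
  | nil => intro h; exact hg _ h
  | cons b β ih =>
    intro h
    have hb := h.head
    simp only [gInner]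
    split_ifs with h1
    · subst h1
      exact (hg _ h).sub (ih h.tail).xv_mul
    · exact (hg _ h).sub (hg _ (h.tail.cons (by omega))).xv_mul

theorem xv_zero (n : ℕ) : finSuccEquiv ℂ n (xv (n + 1) 0) = Polynomial.X := by
  unfold xv
  rw [dif_pos (by omega)]
  exact finSuccEquiv_X_zero

theorem gInner_fund (n : ℕ) : ∀ β, AllPos β →
    finSuccEquiv ℂ n (gInner (xv (n + 1) 0) (fund (n + 1)) β) = Polynomial.C (fund n β) := by
  intro β
  induction β with
  | nil => intro h; simp [gInner, fund_nil]
  | cons b β ih =>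
    intro h
    have hb := h.head
    simp only [gInner]
    split_ifs with h1
    · subst h1
      rw [map_sub, map_mul, ih h.tail, xv_zero]
      ext1 j
      rw [Polynomial.coeff_sub, Polynomial.coeff_C]
      rcases j with _ | _ | j
      · rw [fund_coeff_zero]; simp
      · rw [fund_coeff_eq _ _ _ (by omega)]; simp
      · rw [fund_coeff_gt _ _ _ _ (by omega), Polynomial.coeff_X_mul, Polynomial.coeff_C]; simp
    · rw [map_sub, map_mul, xv_zero]
      ext1 j
      rw [Polynomial.coeff_sub, Polynomial.coeff_C]
      rcases j with _ | j
      · rw [fund_coeff_zero]; simp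
      · rw [Polynomial.coeff_X_mul, if_neg (by omega)]
        rcases lt_trichotomy (j + 1) b with hj | hj | hj
        · rw [fund_coeff_lt _ _ _ _ hj, fund_coeff_lt _ _ _ _ (by omega)]
          rw [show b - (j + 1) = b - 1 - j by omega, sub_self]
        · subst hj
          rw [fund_coeff_eq _ _ _ (by omega)]
          simp only [Nat.add_sub_cancel]
          rw [fund_coeff_eq _ _ _ (by omega), sub_self]
        · rw [fund_coeff_gt _ _ _ _ hj, fund_coeff_gt _ _ _ _ (by omega), sub_self]

theorem gPoly_lead (n a : ℕ) (p : List ℕ) : ∀ β, AllPos β →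
    Lead a (gPoly (n + 1) (p ++ [a]) β) (gPoly n p β) := by
  induction p with
  | nil =>
    intro β hβ
    simp only [List.nil_append, gPoly]
    split_ifs with h
    · subst h
      refine ⟨fun j hj => ?_, ?_⟩
      · simp only [List.length_nil]
        rw [gInner_fund n β hβ, Polynomial.coeff_C, if_neg (by omega)]
      · simp only [List.length_nil]
        rw [gInner_fund n β hβ, Polynomial.coeff_C, if_pos rfl]
    · exact ⟨fun j hj => fund_coeff_gt _ _ _ _ hj, fund_coeff_eq _ _ _ (by omega)⟩
  | cons c p ih =>
    intro β hβ
    simp only [List.cons_append, gPoly]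
    split_ifs with h
    · simp only [List.length_append, List.length_singleton]
      exact gInner_lead ih β hβ
    · exact ih _ (hβ.cons (by omega))

/-- The set of `G` polynomials of exponent sum `d` in `n` variables. -/
def gSet (n d : ℕ) : Set (MvPolynomial (Fin n) ℂ) :=
  {f | ∃ p : List ℕ, p.length = n ∧ p.sum = d ∧ f = gPoly n p []}

theorem gSet_homog (n d : ℕ) {f : MvPolynomial (Fin n) ℂ} (hf : f ∈ Submodule.span ℂ (gSet n d)) :
    f.IsHomogeneous d := by
  have : Submodule.span ℂ (gSet n d) ≤ homogeneousSubmodule (Fin n) ℂ d := by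
    rw [Submodule.span_le]
    rintro _ ⟨p, -, hp, rfl⟩
    have := gPoly_homog n p [] AllPos.nil
    simp only [List.sum_nil, add_zero, hp] at this
    exact this
  exact this hf

theorem gSet_lift (n d a : ℕ) {u : MvPolynomial (Fin n) ℂ}
    (hu : u ∈ Submodule.span ℂ (gSet n d)) :
    ∃ g ∈ Submodule.span ℂ (gSet (n + 1) (d + a)), Lead a g u := by
  induction hu using Submodule.span_induction with
  | mem x hx =>
    obtain ⟨p, h1, h2, rfl⟩ := hx
    exact ⟨_, Submodule.subset_span ⟨p ++ [a], by simp [h1], by simp [h2], rfl⟩,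
      gPoly_lead n a p [] AllPos.nil⟩
  | zero => exact ⟨0, Submodule.zero_mem _, by simp [Lead]⟩
  | add x y _ _ hx hy =>
    obtain ⟨g, hg, h⟩ := hx
    obtain ⟨g', hg', h'⟩ := hy
    exact ⟨g + g', Submodule.add_mem _ hg hg', h.add h'⟩
  | smul c x _ hx =>
    obtain ⟨g, hg, h⟩ := hx
    exact ⟨c • g, Submodule.smul_mem _ c hg, h.smul c⟩

theorem gSet_span (n : ℕ) : ∀ (d : ℕ) (f : MvPolynomial (Fin n) ℂ), f.IsHomogeneous d →
    f ∈ Submodule.span ℂ (gSet n d) := by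
  induction n with
  | zero =>
    intro d f hf
    have h0 := isHomogeneous_of_isEmpty (Fin 0) ℂ f
    by_cases hz : f = 0
    · rw [hz]; exact Submodule.zero_mem _
    · have hd := hf.inj_right h0 hz
      subst hd
      have h1 : (1 : MvPolynomial (Fin 0) ℂ) ∈ gSet 0 0 :=
        ⟨[], rfl, rfl, by simp [gPoly, fund_nil]⟩
      have : f = f.coeff 0 • (1 : MvPolynomial (Fin 0) ℂ) := by
        rw [← C_eq_smul_one]
        exact eq_C_of_isEmpty f
      rw [this]
      exact Submodule.smul_mem _ _ (Submodule.subset_span h1)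
  | succ n ih =>
    intro d f hf
    suffices H : ∀ (a : ℕ) (f : MvPolynomial (Fin (n + 1)) ℂ), f.IsHomogeneous d →
        (∀ j, a ≤ j → (finSuccEquiv ℂ n f).coeff j = 0) →
        f ∈ Submodule.span ℂ (gSet (n + 1) d) by
      refine H ((finSuccEquiv ℂ n f).natDegree + 1) f hf (fun j hj => ?_)
      exact Polynomial.coeff_eq_zero_of_natDegree_lt (by omega)
    intro a
    induction a with
    | zero =>
      intro f _ h
      have : finSuccEquiv ℂ n f = 0 := by
        ext1 j
        simpa using h j (Nat.zero_le _)
      rw [EmbeddingLike.map_eq_zero_iff] at this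
      rw [this]; exact Submodule.zero_mem _
    | succ a iha =>
      intro f hf h
      by_cases had : a ≤ d
      · have hu := hf.finSuccEquiv_coeff_isHomogeneous a (d - a) (by omega)
        obtain ⟨g, hg, hl⟩ := gSet_lift n (d - a) a (ih _ _ hu)
        rw [show d - a + a = d by omega] at hg
        have := iha (f - g) (hf.sub (gSet_homog _ _ hg)) (fun j hj => by
          rw [map_sub, Polynomial.coeff_sub]
          rcases Nat.eq_or_lt_of_le hj with rfl | hj
          · rw [hl.2, sub_self]
          · rw [hl.1 j hj, h j hj, sub_self])
        simpa using Submodule.add_mem _ this hg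
      · apply iha f hf
        intro j hj
        ext ν
        rw [finSuccEquiv_coeff_coeff, coeff_zero]
        apply hf.coeff_eq_zero
        rw [Finsupp.degree_eq_sum, Fin.sum_univ_succ]
        simp only [Finsupp.cons_zero]
        omega

/-- All polynomials of large degree lie in the ideal. -/
theorem large_mem (n d : ℕ) (hd : 0 < d) (hnd : n ≤ d) (f : MvPolynomial (Fin n) ℂ)
    (hf : f.IsHomogeneous d) : f ∈ fIdeal n := by
  have h : Submodule.span ℂ (gSet n d) ≤ (fIdeal n).restrictScalars ℂ := by
    rw [Submodule.span_le]
    rintro _ ⟨p, h1, h2, rfl⟩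
    exact gPoly_mem n p [] AllPos.nil (by simp; omega) (by simp; omega)
  exact h (gSet_span n d f hf)


/-! ### Dyck monomials span modulo the ideal -/

/-- Span of Dyck monomials of degree `k`. -/
noncomputable def dSpan (n k : ℕ) : Submodule ℂ (MvPolynomial (Fin n) ℂ) :=
  Submodule.span ℂ {f | ∃ ν : Fin n →₀ ℕ, IsDyck ν ∧ ν.degree = k ∧ f = monomial ν 1}

theorem dSpan_homog (n k : ℕ) : dSpan n k ≤ homogeneousSubmodule (Fin n) ℂ k := by
  unfold dSpan
  rw [Submodule.span_le]
  rintro _ ⟨ν, -, h, rfl⟩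
  exact isHomogeneous_monomial _ h

theorem isDyck_iff {n : ℕ} (η : Fin n → ℕ) :
    IsDyck η ↔ ∀ k : Fin n, ∑ i, (if i ≤ k then η i else 0) ≤ (k : ℕ) := by
  unfold IsDyck
  simp only [Finset.sum_filter]

theorem fIdeal_comp (n k : ℕ) {f : MvPolynomial (Fin n) ℂ} (hf : f ∈ fIdeal n) :
    homogeneousComponent k f ∈ fIdeal n := by
  letI := MvPolynomial.gradedAlgebra (σ := Fin n) (R := ℂ)
  refine homogeneousComponent_mem_of_mem ?_ hf k
  apply Ideal.homogeneous_span
  rintro _ ⟨α, -, rfl⟩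
  exact ⟨_, fund_homog n α⟩

theorem comp_X_mul {n k : ℕ} (i : Fin n) (r : MvPolynomial (Fin n) ℂ) :
    homogeneousComponent (k + 1) (X i * r) = X i * homogeneousComponent k r := by
  classical
  ext m
  rw [coeff_homogeneousComponent, coeff_X_mul', coeff_X_mul', coeff_homogeneousComponent]
  by_cases h : i ∈ m.support
  · simp only [h, if_true]
    have hm : m = (m - Finsupp.single i 1) + Finsupp.single i 1 := by
      rw [tsub_add_cancel_of_le]
      rw [Finsupp.single_le_iff]
      have := Finsupp.mem_support_iff.1 h
      omega
    have : m.degree = (m - Finsupp.single i 1).degree + 1 := by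
      conv_lhs => rw [hm]
      rw [map_add, Finsupp.degree_single]
    simp [this]
  · simp [h]

theorem comp_zero_X_mul {n : ℕ} (i : Fin n) (r : MvPolynomial (Fin n) ℂ) :
    homogeneousComponent 0 (X i * r) = 0 := by
  rw [homogeneousComponent_zero]
  simp [coeff_X_mul']

theorem isDyck_add_last {n : ℕ} (ν : Fin (n + 1) →₀ ℕ) (h : IsDyck ν) (hk : ν.degree < n) :
    IsDyck ⇑(ν + (Finsupp.single (Fin.last n) 1 : Fin (n + 1) →₀ ℕ)) := by
  rw [isDyck_iff] at h ⊢
  intro k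
  by_cases hkn : k = Fin.last n
  · subst hkn
    simp only [Fin.le_last, if_true, Finsupp.add_apply, Finset.sum_add_distrib]
    rw [← Finsupp.degree_eq_sum, ← Finsupp.degree_eq_sum, Finsupp.degree_single]
    simp only [Fin.val_last]; omega
  · refine le_trans (le_of_eq ?_) (h k)
    apply Finset.sum_congr rfl
    intro i _
    split_ifs with hi
    · rw [Finsupp.add_apply, Finsupp.single_apply, if_neg, add_zero]
      rintro rfl
      exact hkn (le_antisymm (Fin.le_last _) hi)
    · rfl

theorem last_mul_dSpan {n k : ℕ} (hk : k < n) {f : MvPolynomial (Fin (n + 1)) ℂ}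
    (hf : f ∈ dSpan (n + 1) k) : X (Fin.last n) * f ∈ dSpan (n + 1) (k + 1) := by
  unfold dSpan at hf
  induction hf using Submodule.span_induction with
  | mem x hx =>
    obtain ⟨ν, h1, h2, rfl⟩ := hx
    refine Submodule.subset_span ⟨ν + Finsupp.single (Fin.last n) 1,
      isDyck_add_last ν h1 (by omega), by rw [map_add, h2, Finsupp.degree_single], ?_⟩
    rw [X, monomial_mul, add_comm ν, one_mul]
  | zero => rw [mul_zero]; exact Submodule.zero_mem _
  | add x y _ _ hx hy => rw [mul_add]; exact Submodule.add_mem _ hx hy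
  | smul c x _ hx => rw [mul_smul_comm]; exact Submodule.smul_mem _ c hx

theorem isDyck_castSucc {n : ℕ} (ν : Fin n →₀ ℕ) (h : IsDyck ν) (hk : ν.degree ≤ n) :
    IsDyck ⇑(ν.mapDomain Fin.castSucc) := by
  have h1 : ∀ i : Fin n, ν.mapDomain Fin.castSucc i.castSucc = ν i := fun i =>
    Finsupp.mapDomain_apply (Fin.castSucc_injective n) _ _
  have h2 : ν.mapDomain Fin.castSucc (Fin.last n) = 0 := by
    apply Finsupp.mapDomain_of_notMem_range
    rintro ⟨i, hi⟩
    exact (Fin.castSucc_lt_last i).ne hi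
  rw [isDyck_iff] at h ⊢
  intro k
  rw [Fin.sum_univ_castSucc]
  simp only [h1, h2, ite_self, add_zero]
  induction k using Fin.lastCases with
  | last =>
    simp only [Fin.le_last, if_true]
    rw [← Finsupp.degree_eq_sum]
    simpa using hk
  | cast k => simpa using h k

theorem rename_dSpan {n k : ℕ} (hk : k ≤ n) {f : MvPolynomial (Fin n) ℂ} (hf : f ∈ dSpan n k) :
    rename Fin.castSucc f ∈ dSpan (n + 1) k := by
  unfold dSpan at hf
  induction hf using Submodule.span_induction with
  | mem x hx =>
    obtain ⟨ν, h1, h2, rfl⟩ := hx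
    refine Submodule.subset_span ⟨ν.mapDomain Fin.castSucc,
      isDyck_castSucc ν h1 (by omega), by rw [Finsupp.degree_mapDomain, h2], ?_⟩
    rw [rename_monomial]
  | zero => rw [map_zero]; exact Submodule.zero_mem _
  | add x y _ _ hx hy => rw [map_add]; exact Submodule.add_mem _ hx hy
  | smul c x _ hx => rw [map_smul]; exact Submodule.smul_mem _ c hx

theorem ofFn_mapDomain_castSucc {n : ℕ} (ν : Fin n →₀ ℕ) :
    List.ofFn ⇑(ν.mapDomain Fin.castSucc) = List.ofFn ν ++ [0] := by
  rw [List.ofFn_succ', List.concat_eq_append]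
  congr 2
  · ext i
    exact Finsupp.mapDomain_apply (Fin.castSucc_injective n) _ _
  · apply Finsupp.mapDomain_of_notMem_range
    rintro ⟨i, hi⟩
    exact (Fin.castSucc_lt_last i).ne hi

theorem eq_mapDomain_castSucc {n : ℕ} (m : Fin (n + 1) →₀ ℕ) (h : m (Fin.last n) = 0) :
    ∃ ν : Fin n →₀ ℕ, m = ν.mapDomain Fin.castSucc := by
  refine ⟨m.comapDomain Fin.castSucc (Fin.castSucc_injective n).injOn, ?_⟩
  rw [Finsupp.mapDomain_comapDomain _ (Fin.castSucc_injective n)]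
  intro i hi
  induction i using Fin.lastCases with
  | last => simp [h] at hi
  | cast i => exact ⟨i, rfl⟩

theorem rename_fund (n : ℕ) (α : List ℕ) :
    rename Fin.castSucc (fund n α) - fund (n + 1) α ∈
      Ideal.span {(X (Fin.last n) : MvPolynomial (Fin (n + 1)) ℂ)} := by
  rw [← Set.image_singleton (f := (X : Fin (n + 1) → MvPolynomial (Fin (n + 1)) ℂ)),
    mem_ideal_span_X_image]
  intro m hm
  refine ⟨Fin.last n, rfl, fun h => ?_⟩
  obtain ⟨ν, rfl⟩ := eq_mapDomain_castSucc m h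
  rw [mem_support_iff, coeff_sub, coeff_rename_mapDomain _ (Fin.castSucc_injective n),
    coeff_fund, coeff_fund, ofFn_mapDomain_castSucc, ← fundCoef_filter (List.ofFn ν ++ [0]),
    List.filter_append] at hm
  apply hm
  rw [← fundCoef_filter (List.ofFn ν)]
  simp

theorem rename_fIdeal (n : ℕ) {f : MvPolynomial (Fin n) ℂ} (hf : f ∈ fIdeal n) :
    ∃ j ∈ fIdeal (n + 1), ∃ r, rename Fin.castSucc f = j + X (Fin.last n) * r := by
  have h1 : Ideal.map (rename (R := ℂ) (Fin.castSucc (n := n))) (fIdeal n) ≤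
      fIdeal (n + 1) ⊔ Ideal.span {(X (Fin.last n) : MvPolynomial (Fin (n + 1)) ℂ)} := by
    unfold fIdeal
    rw [Ideal.map_span, Ideal.span_le]
    rintro _ ⟨_, ⟨α, hα, rfl⟩, rfl⟩
    have : rename (R := ℂ) Fin.castSucc (fund n α) = fund (n + 1) α +
      (rename Fin.castSucc (fund n α) - fund (n + 1) α) := by ring
    rw [SetLike.mem_coe, this]
    exact Submodule.add_mem_sup (Ideal.subset_span ⟨α, hα, rfl⟩) (rename_fund n α)
  have h2 := h1 (Ideal.mem_map_of_mem _ hf)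
  obtain ⟨j, hj, y, hy, e⟩ := Submodule.mem_sup.1 h2
  obtain ⟨r, rfl⟩ := Ideal.mem_span_singleton.1 hy
  exact ⟨j, hj, r, e.symm⟩

theorem dSpan_sup (n : ℕ) : ∀ (k : ℕ) (f : MvPolynomial (Fin n) ℂ), f.IsHomogeneous k →
    f ∈ dSpan n k ⊔ (fIdeal n).restrictScalars ℂ := by
  induction n with
  | zero =>
    intro k f hf
    rcases Nat.eq_zero_or_pos k with rfl | hk
    · apply Submodule.mem_sup_left
      have : f = f.coeff 0 • (1 : MvPolynomial (Fin 0) ℂ) := by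
        rw [← C_eq_smul_one]
        exact eq_C_of_isEmpty f
      rw [this]
      refine Submodule.smul_mem _ _ (Submodule.subset_span ⟨0, ?_, by simp, rfl⟩)
      intro k; exact k.elim0
    · exact Submodule.mem_sup_right (large_mem 0 k hk (Nat.zero_le _) f hf)
  | succ n ih =>
    intro k
    induction k with
    | zero =>
      intro f hf
      rw [← totalDegree_zero_iff_isHomogeneous, totalDegree_eq_zero_iff_eq_C] at hf
      apply Submodule.mem_sup_left
      rw [hf, C_eq_smul_one]
      refine Submodule.smul_mem _ _ (Submodule.subset_span ⟨0, ?_, by simp, rfl⟩)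
      intro k; simp
    | succ k ihk =>
      intro f hf
      by_cases hkn : n ≤ k
      · exact Submodule.mem_sup_right (large_mem (n + 1) (k + 1) (by omega) (by omega) f hf)
      have hX : ∀ r : MvPolynomial (Fin (n + 1)) ℂ, r.IsHomogeneous k →
          X (Fin.last n) * r ∈ dSpan (n + 1) (k + 1) ⊔ (fIdeal (n + 1)).restrictScalars ℂ := by
        intro r hr
        obtain ⟨d, hd, j, hj, rfl⟩ := Submodule.mem_sup.1 (ihk r hr)
        rw [mul_add]
        exact Submodule.add_mem_sup (last_mul_dSpan (by omega) hd)
          (Ideal.mul_mem_left (fIdeal (n + 1)) _ hj)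
      rw [f.as_sum]
      apply Submodule.sum_mem
      intro m hm
      have hdeg : m.degree = k + 1 := (hf.degree_eq_sum_deg_support hm).symm
      by_cases hlast : m (Fin.last n) = 0
      · obtain ⟨ν, rfl⟩ := eq_mapDomain_castSucc m hlast
        rw [← rename_monomial]
        rw [Finsupp.degree_mapDomain] at hdeg
        obtain ⟨d, hd, j, hj, e⟩ := Submodule.mem_sup.1 (ih (k + 1) (monomial ν
          (f.coeff (ν.mapDomain Fin.castSucc))) (isHomogeneous_monomial _ hdeg))
        rw [← e, map_add]
        apply Submodule.add_mem _ (Submodule.mem_sup_left (rename_dSpan (by omega) hd))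
        have hjh : j.IsHomogeneous (k + 1) := by
          have : j = monomial ν (f.coeff (ν.mapDomain Fin.castSucc)) - d := by rw [← e]; ring
          rw [this]
          exact (isHomogeneous_monomial _ hdeg).sub (dSpan_homog _ _ hd)
        obtain ⟨j', hj', r, e'⟩ := rename_fIdeal n hj
        have hh : (rename Fin.castSucc j : MvPolynomial (Fin (n + 1)) ℂ).IsHomogeneous (k + 1) :=
          hjh.rename_isHomogeneous
        rw [← homogeneousComponent_eq_self hh, e', map_add, comp_X_mul]
        exact Submodule.add_mem _ (Submodule.mem_sup_right (fIdeal_comp _ _ hj'))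
          (hX _ (homogeneousComponent_isHomogeneous _ _))
      · have hm' : m = Finsupp.single (Fin.last n) 1 + (m - Finsupp.single (Fin.last n) 1) := by
          rw [add_tsub_cancel_of_le]
          rw [Finsupp.single_le_iff]
          omega
        have e : monomial m (f.coeff m) = X (Fin.last n) *
            monomial (m - Finsupp.single (Fin.last n) 1) (f.coeff m) := by
          rw [X, monomial_mul, ← hm', one_mul]
        rw [e]
        apply hX
        apply isHomogeneous_monomial
        rw [hm', map_add, Finsupp.degree_single] at hdeg
        omega


/-! ### Independence of Dyck monomials modulo the ideal -/

/-- Set the `j`-th variable to zero and relabel. -/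
noncomputable def rz {n : ℕ} (j : Fin (n + 1)) :
    MvPolynomial (Fin (n + 1)) ℂ →ₐ[ℂ] MvPolynomial (Fin n) ℂ :=
  killCompl (Fin.succAbove_right_injective (p := j))

/-- Insert a zero. -/
noncomputable def insZ {n : ℕ} (j : Fin (n + 1)) (ν : Fin n →₀ ℕ) : Fin (n + 1) →₀ ℕ :=
  ν.mapDomain j.succAbove

/-- Delete an entry. -/
noncomputable def delZ {n : ℕ} (j : Fin (n + 1)) (ν : Fin (n + 1) →₀ ℕ) : Fin n →₀ ℕ :=
  ν.comapDomain j.succAbove Fin.succAbove_right_injective.injOn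

theorem insZ_self {n : ℕ} (j : Fin (n + 1)) (ν : Fin n →₀ ℕ) : insZ j ν j = 0 := by
  apply Finsupp.mapDomain_of_notMem_range
  rintro ⟨i, hi⟩
  exact Fin.succAbove_ne j i hi

theorem insZ_above {n : ℕ} (j : Fin (n + 1)) (ν : Fin n →₀ ℕ) (i : Fin n) :
    insZ j ν (j.succAbove i) = ν i :=
  Finsupp.mapDomain_apply Fin.succAbove_right_injective _ _

theorem delZ_apply {n : ℕ} (j : Fin (n + 1)) (ν : Fin (n + 1) →₀ ℕ) (i : Fin n) :
    delZ j ν i = ν (j.succAbove i) := rfl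

theorem coeff_rz {n : ℕ} (j : Fin (n + 1)) (f : MvPolynomial (Fin (n + 1)) ℂ) (ν : Fin n →₀ ℕ) :
    (rz j f).coeff ν = f.coeff (insZ j ν) := coeff_killCompl _

theorem rz_monomial_of_ne {n : ℕ} (j : Fin (n + 1)) (ε : Fin (n + 1) →₀ ℕ) (c : ℂ)
    (h : ε j ≠ 0) : rz j (monomial ε c) = 0 := by
  apply killCompl_monomial_eq_zero_of_not_subset
  intro hs
  obtain ⟨i, hi⟩ := hs (show j ∈ (ε.support : Set _) by simpa using h)
  exact Fin.succAbove_ne j i hi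

theorem rz_monomial_of_eq {n : ℕ} (j : Fin (n + 1)) (ε : Fin (n + 1) →₀ ℕ) (c : ℂ)
    (h : ε j = 0) : rz j (monomial ε c) = monomial (delZ j ε) c := by
  apply killCompl_monomial_eq_monomial_comapDomain_of_subset
  intro i hi
  by_cases hij : i = j
  · subst hij; simp [h] at hi
  · exact Fin.exists_succAbove_eq hij

theorem filter_ofFn_above : ∀ (n : ℕ) (j : Fin (n + 1)) (f : Fin (n + 1) → ℕ), f j = 0 →
    (List.ofFn f).filter (· ≠ 0) = (List.ofFn (fun i => f (j.succAbove i))).filter (· ≠ 0) := by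
  intro n
  induction n with
  | zero =>
    intro j f h
    have : j = 0 := Fin.ext (by omega)
    subst this
    simp [h]
  | succ n ih =>
    intro j f h
    induction j using Fin.cases with
    | zero =>
      rw [List.ofFn_succ]
      simp [h]
    | succ j =>
      rw [List.ofFn_succ, List.ofFn_succ (f := fun i => f (j.succ.succAbove i))]
      simp only [List.filter_cons, Fin.succ_succAbove_zero, Fin.succ_succAbove_succ]
      rw [ih j (fun i => f i.succ) h]

theorem qcomp_insZ {n : ℕ} (j : Fin (n + 1)) (ν : Fin n →₀ ℕ) : qcomp (insZ j ν) = qcomp ν := by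
  unfold qcomp
  rw [filter_ofFn_above n j _ (insZ_self j ν)]
  simp only [insZ_above]

theorem rz_qsym {n : ℕ} (j : Fin (n + 1)) {q : MvPolynomial (Fin (n + 1)) ℂ}
    (hq : q ∈ QSymPlus (n + 1)) : rz j q ∈ QSymPlus n := by
  refine ⟨fun ν μ h => ?_, ?_⟩
  · rw [coeff_rz, coeff_rz]
    apply hq.1
    rw [qcomp_insZ, qcomp_insZ, h]
  · rw [constantCoeff_eq, coeff_rz]
    have := hq.2
    rw [constantCoeff_eq] at this
    simpa [insZ] using this

theorem rz_qsym_eq {n : ℕ} (j j' : Fin (n + 1)) {q : MvPolynomial (Fin (n + 1)) ℂ}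
    (hq : q ∈ QSymPlus (n + 1)) : rz j q = rz j' q := by
  ext ν
  rw [coeff_rz, coeff_rz]
  apply hq.1
  rw [qcomp_insZ, qcomp_insZ]

theorem rz_ideal {n : ℕ} (j : Fin (n + 1)) {f : MvPolynomial (Fin (n + 1)) ℂ}
    (hf : f ∈ Ideal.span (QSymPlus (n + 1))) : rz j f ∈ Ideal.span (QSymPlus n) := by
  have : Ideal.map (rz j) (Ideal.span (QSymPlus (n + 1))) ≤ Ideal.span (QSymPlus n) := by
    rw [Ideal.map_span, Ideal.span_le]
    rintro _ ⟨q, hq, rfl⟩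
    exact Ideal.subset_span (rz_qsym j hq)
  exact this (Ideal.mem_map_of_mem _ hf)

theorem delZ_eq {n : ℕ} (i : Fin n) (ε : Fin (n + 1) →₀ ℕ) (h : ε i.succ = ε i.castSucc) :
    delZ i.succ ε = delZ i.castSucc ε := by
  ext k
  rw [delZ_apply, delZ_apply]
  rcases lt_trichotomy k i with hk | rfl | hk
  · rw [Fin.succAbove_of_castSucc_lt _ _ (by rw [Fin.lt_def] at hk ⊢; simp only [Fin.val_castSucc, Fin.val_succ]; omega),
      Fin.succAbove_of_castSucc_lt _ _ (by rw [Fin.lt_def] at hk ⊢; simp only [Fin.val_castSucc, Fin.val_succ]; omega)]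
  · simp [h]
  · rw [Fin.succAbove_of_le_castSucc _ _ (by rw [Fin.lt_def] at hk; rw [Fin.le_def]; simp only [Fin.val_castSucc, Fin.val_succ]; omega),
      Fin.succAbove_of_le_castSucc _ _ (by rw [Fin.lt_def] at hk; rw [Fin.le_def]; simp only [Fin.val_castSucc, Fin.val_succ]; omega)]

/-- Deleting a zero entry next to position `i`, and lowering position `i`, preserves Dyck
vectors. -/
theorem delZ_dyck {n : ℕ} (i : Fin n) (s : Fin (n + 1)) (hs : s = i.castSucc ∨ s = i.succ)
    (ε : Fin (n + 1) →₀ ℕ) (hε : IsDyck ε) (h0 : ε s = 0) (h1 : delZ s ε i ≠ 0) :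
    ∃ δ : Fin n →₀ ℕ, IsDyck δ ∧ delZ s ε = Finsupp.single i 1 + δ := by
  have hm : delZ s ε = Finsupp.single i 1 + (delZ s ε - Finsupp.single i 1) := by
    rw [add_tsub_cancel_of_le]
    rw [Finsupp.single_le_iff]
    omega
  refine ⟨delZ s ε - Finsupp.single i 1, ?_, hm⟩
  rw [isDyck_iff] at hε ⊢
  intro k
  have key : ∑ j, (if j ≤ k then delZ s ε j else 0) ≤ (s.succAbove k : ℕ) := by
    refine le_trans (le_of_eq ?_) (hε (s.succAbove k))
    rw [Fin.sum_univ_succAbove _ s]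
    simp only [h0, ite_self, zero_add, delZ_apply, Fin.succAbove_le_succAbove_iff]
  have hsplit : ∑ j, (if j ≤ k then delZ s ε j else 0) = (if i ≤ k then 1 else 0) +
      ∑ j, (if j ≤ k then (delZ s ε - (Finsupp.single i 1 : Fin n →₀ ℕ)) j else 0) := by
    have : (if i ≤ k then 1 else 0) = ∑ j, (if j ≤ k then (Finsupp.single i 1 : Fin n →₀ ℕ) j else 0) := by
      rw [Finset.sum_eq_single i]
      · simp
      · intro b _ hb
        simp [Finsupp.single_apply, hb.symm]
      · simp
    rw [this, ← Finset.sum_add_distrib]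
    apply Finset.sum_congr rfl
    intro j _
    split_ifs
    · conv_lhs => rw [hm]
      rfl
    · rfl
  by_cases hik : i ≤ k
  · rw [if_pos hik] at hsplit
    have : (s.succAbove k : ℕ) ≤ k + 1 := by
      unfold Fin.succAbove
      split_ifs <;> simp
    omega
  · rw [if_neg hik] at hsplit
    have : s.succAbove k = k.castSucc := by
      apply Fin.succAbove_of_castSucc_lt
      rw [Fin.lt_def]
      rw [Fin.le_def] at hik
      rcases hs with rfl | rfl <;> simp <;> omega
    rw [this, Fin.val_castSucc] at key
    omega

theorem rz_sub_monomial {n : ℕ} (i : Fin n) (ε : Fin (n + 1) →₀ ℕ) (c : ℂ) :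
    (rz i.succ (monomial ε c) - rz i.castSucc (monomial ε c) = 0) ∨
    (ε i.succ = 0 ∧ delZ i.succ ε i ≠ 0 ∧
      rz i.succ (monomial ε c) - rz i.castSucc (monomial ε c) = monomial (delZ i.succ ε) c) ∨
    (ε i.castSucc = 0 ∧ delZ i.castSucc ε i ≠ 0 ∧
      rz i.succ (monomial ε c) - rz i.castSucc (monomial ε c) =
        - monomial (delZ i.castSucc ε) c) := by
  by_cases h1 : ε i.succ = 0 <;> by_cases h2 : ε i.castSucc = 0
  · left
    rw [rz_monomial_of_eq _ _ _ h1, rz_monomial_of_eq _ _ _ h2, delZ_eq i ε (by rw [h1, h2]),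
      sub_self]
  · right; left
    refine ⟨h1, ?_, ?_⟩
    · rw [delZ_apply]; simpa using h2
    · rw [rz_monomial_of_eq _ _ _ h1, rz_monomial_of_ne _ _ _ h2, sub_zero]
  · right; right
    refine ⟨h2, ?_, ?_⟩
    · rw [delZ_apply]; simpa using h1
    · rw [rz_monomial_of_eq _ _ _ h2, rz_monomial_of_ne _ _ _ h1, zero_sub]
  · left
    rw [rz_monomial_of_ne _ _ _ h1, rz_monomial_of_ne _ _ _ h2, sub_zero]

theorem monomial_dvd {n : ℕ} (i : Fin n) (δ : Fin n →₀ ℕ) (c : ℂ) (h : δ i ≠ 0) :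
    (X i : MvPolynomial (Fin n) ℂ) ∣ monomial δ c := by
  refine ⟨monomial (δ - Finsupp.single i 1) c, ?_⟩
  rw [X, monomial_mul, one_mul, add_tsub_cancel_of_le]
  rw [Finsupp.single_le_iff]
  omega

theorem rz_sub_dvd {n : ℕ} (i : Fin n) (f : MvPolynomial (Fin (n + 1)) ℂ) :
    X i ∣ rz i.succ f - rz i.castSucc f := by
  induction f using MvPolynomial.induction_on' with
  | monomial ε c =>
    rcases rz_sub_monomial i ε c with h | ⟨_, h, e⟩ | ⟨_, h, e⟩
    · rw [h]; exact dvd_zero _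
    · rw [e]; exact monomial_dvd _ _ _ h
    · rw [e]; exact (monomial_dvd _ _ _ h).neg_right
  | add p q hp hq =>
    rw [map_add, map_add, add_sub_add_comm]
    exact dvd_add hp hq

theorem trim_ideal {n : ℕ} (i : Fin n) {f : MvPolynomial (Fin (n + 1)) ℂ}
    (hf : f ∈ Ideal.span (QSymPlus (n + 1))) :
    ∃ h ∈ Ideal.span (QSymPlus n), rz i.succ f - rz i.castSucc f = X i * h := by
  induction hf using Submodule.span_induction with
  | mem q hq => exact ⟨0, Ideal.zero_mem _, by rw [rz_qsym_eq i.succ i.castSucc hq]; simp⟩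
  | zero => exact ⟨0, Ideal.zero_mem _, by simp⟩
  | add x y _ _ hx hy =>
    obtain ⟨a, ha, ea⟩ := hx
    obtain ⟨b, hb, eb⟩ := hy
    exact ⟨a + b, Ideal.add_mem _ ha hb, by rw [map_add, map_add, mul_add, ← ea, ← eb]; ring⟩
  | smul a x hx' hx =>
    obtain ⟨b, hb, eb⟩ := hx
    obtain ⟨t, et⟩ := rz_sub_dvd i a
    refine ⟨t * rz i.succ x + rz i.castSucc a * b, Ideal.add_mem _
      (Ideal.mul_mem_left _ _ (rz_ideal _ hx')) (Ideal.mul_mem_left _ _ hb), ?_⟩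
    rw [smul_eq_mul, map_mul, map_mul]
    linear_combination (rz i.succ x) * et + (rz i.castSucc a) * eb

/-- Span of all Dyck monomials. -/
noncomputable def dAll (n : ℕ) : Submodule ℂ (MvPolynomial (Fin n) ℂ) :=
  Submodule.span ℂ {f | ∃ ν : Fin n →₀ ℕ, IsDyck ν ∧ f = monomial ν 1}

theorem dSpan_le_dAll (n k : ℕ) : dSpan n k ≤ dAll n := by
  apply Submodule.span_mono
  rintro _ ⟨ν, h, -, rfl⟩
  exact ⟨ν, h, rfl⟩

theorem trim_dyck {n : ℕ} (i : Fin n) {f : MvPolynomial (Fin (n + 1)) ℂ}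
    (hf : f ∈ dAll (n + 1)) :
    ∃ h ∈ dAll n, rz i.succ f - rz i.castSucc f = X i * h := by
  unfold dAll at hf
  induction hf using Submodule.span_induction with
  | mem q hq =>
    obtain ⟨ε, hε, rfl⟩ := hq
    rcases rz_sub_monomial i ε 1 with h | ⟨h0, h, e⟩ | ⟨h0, h, e⟩
    · exact ⟨0, Submodule.zero_mem _, by rw [h, mul_zero]⟩
    · obtain ⟨δ, hδ, e'⟩ := delZ_dyck i _ (Or.inr rfl) ε hε h0 h
      refine ⟨monomial δ 1, Submodule.subset_span ⟨δ, hδ, rfl⟩, ?_⟩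
      rw [e, e', X, monomial_mul, one_mul]
    · obtain ⟨δ, hδ, e'⟩ := delZ_dyck i _ (Or.inl rfl) ε hε h0 h
      refine ⟨- monomial δ 1, Submodule.neg_mem _ (Submodule.subset_span ⟨δ, hδ, rfl⟩), ?_⟩
      rw [e, e', X, mul_neg, monomial_mul, one_mul]
  | zero => exact ⟨0, Submodule.zero_mem _, by simp⟩
  | add x y _ _ hx hy =>
    obtain ⟨a, ha, ea⟩ := hx
    obtain ⟨b, hb, eb⟩ := hy
    exact ⟨a + b, Submodule.add_mem _ ha hb, by rw [map_add, map_add, mul_add, ← ea, ← eb]; ring⟩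
  | smul c x _ hx =>
    obtain ⟨b, hb, eb⟩ := hx
    exact ⟨c • b, Submodule.smul_mem _ c hb, by
      rw [map_smul, map_smul, ← smul_sub, eb, mul_smul_comm]⟩

theorem dAll_coeff {n : ℕ} {f : MvPolynomial (Fin n) ℂ} (hf : f ∈ dAll n) (ν : Fin n →₀ ℕ)
    (hν : ¬ IsDyck ν) : f.coeff ν = 0 := by
  classical
  unfold dAll at hf
  induction hf using Submodule.span_induction with
  | mem q hq =>
    obtain ⟨ε, hε, rfl⟩ := hq
    rw [coeff_monomial, if_neg]
    rintro rfl
    exact hν hε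
  | zero => simp
  | add x y _ _ hx hy => rw [coeff_add, hx, hy, add_zero]
  | smul c x _ hx => rw [coeff_smul, hx, smul_zero]

theorem ideal_constantCoeff {n : ℕ} {f : MvPolynomial (Fin n) ℂ}
    (hf : f ∈ Ideal.span (QSymPlus n)) : constantCoeff f = 0 := by
  have : Ideal.span (QSymPlus n) ≤ RingHom.ker (constantCoeff (R := ℂ) (σ := Fin n)) := by
    rw [Ideal.span_le]
    intro q hq
    exact hq.2
  exact this hf

theorem insZ_move {n : ℕ} {f : MvPolynomial (Fin (n + 1)) ℂ}
    (h : ∀ i : Fin n, rz i.succ f = rz i.castSucc f) (j : Fin (n + 1)) : rz j f = rz 0 f := by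
  induction j using Fin.induction with
  | zero => rfl
  | succ i ih => rw [h i, ih]

theorem dAll_disjoint (n : ℕ) : ∀ f : MvPolynomial (Fin n) ℂ, f ∈ dAll n →
    f ∈ Ideal.span (QSymPlus n) → f = 0 := by
  induction n with
  | zero =>
    intro f _ hf
    have h0 := ideal_constantCoeff hf
    rw [constantCoeff_eq] at h0
    rw [eq_C_of_isEmpty f, h0, C_0]
  | succ n ih =>
    intro f hd hI
    have hmove : ∀ i : Fin n, rz i.succ f = rz i.castSucc f := by
      intro i
      obtain ⟨a, ha, ea⟩ := trim_ideal i hI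
      obtain ⟨b, hb, eb⟩ := trim_dyck i hd
      have hab : a = b := by
        apply mul_left_cancel₀ (X_ne_zero (R := ℂ) i)
        rw [← ea, eb]
      subst hab
      rw [ih a hb ha, mul_zero, sub_eq_zero] at ea
      exact ea
    have hcoef : ∀ ν : Fin n →₀ ℕ, f.coeff (insZ 0 ν) = f.coeff (insZ (Fin.last n) ν) := by
      intro ν
      rw [← coeff_rz, ← coeff_rz, insZ_move hmove (Fin.last n)]
    have main : ∀ (N : ℕ) (η : Fin (n + 1) →₀ ℕ), ∑ i : Fin (n + 1), (i : ℕ) * η i = N → η ≠ 0 →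
        f.coeff η = 0 := by
      intro N
      induction N using Nat.strong_induction_on with
      | _ N ihN =>
        intro η hN hη
        by_cases hD : IsDyck η
        · have hη0 : η 0 = 0 := by
            have h1 : η 0 ≤ ∑ i ∈ Finset.univ.filter (· ≤ (0 : Fin (n + 1))), η i :=
              Finset.single_le_sum (f := fun i => η i) (fun _ _ => Nat.zero_le _) (by simp)
            have h2 := hD 0
            simp only [Fin.val_zero] at h2
            omega
          have e0 : η = insZ 0 (delZ 0 η) := by
            ext k
            induction k using Fin.cases with
            | zero => rw [insZ_self, hη0]
            | succ k =>
              rw [← Fin.succAbove_zero_apply k, insZ_above, delZ_apply]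
          set ν := delZ 0 η with hν
          rw [e0, hcoef]
          have hν0 : ν ≠ 0 := by
            intro h
            apply hη
            rw [e0, h]
            simp [insZ]
          refine ihN _ ?_ _ rfl ?_
          · rw [← hN, Fin.sum_univ_castSucc, Fin.sum_univ_succ]
            have h1 : ∀ i : Fin n, insZ (Fin.last n) ν i.castSucc = ν i := by
              intro i
              have := insZ_above (Fin.last n) ν i
              rwa [Fin.succAbove_last_apply] at this
            have h2 : ∀ i : Fin n, η i.succ = ν i := by
              intro i
              rw [hν, delZ_apply, Fin.succAbove_zero_apply]
            simp only [h1, h2, insZ_self, Fin.val_castSucc, Fin.val_succ, mul_zero, add_zero, hη0,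
              zero_add]
            obtain ⟨i, hi⟩ : ∃ i, ν i ≠ 0 := by
              by_contra hcon
              push Not at hcon
              exact hν0 (by ext i; simpa using hcon i)
            apply Finset.sum_lt_sum
            · intro i _
              exact Nat.mul_le_mul_right _ (by omega)
            · exact ⟨i, Finset.mem_univ _, Nat.mul_lt_mul_of_pos_right (by omega) (by omega)⟩
          · intro h
            apply hν0
            ext i
            rw [← insZ_above (Fin.last n) ν i, h]
            rfl
        · exact dAll_coeff hd η hD
    ext η
    rw [coeff_zero]
    by_cases hη : η = 0
    · subst hη
      have := ideal_constantCoeff hI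
      rwa [constantCoeff_eq] at this
    · exact main _ η rfl hη


/-! ### Counting Dyck vectors -/

/-- Dyck vectors of total degree `k`. -/
def dyckSet (n k : ℕ) : Set (Fin n → ℕ) := {η | IsDyck η ∧ ∑ i, η i = k}

/-- Dyck vectors of total degree at most `k`. -/
def dyckLe (n k : ℕ) : Set (Fin n → ℕ) := {η | IsDyck η ∧ ∑ i, η i ≤ k}

theorem dyckLe_finite (n k : ℕ) : (dyckLe n k).Finite := by
  apply (Set.finite_Iic (fun _ : Fin n => k)).subset
  intro η hη i
  exact le_trans (Finset.single_le_sum (f := η) (fun _ _ => Nat.zero_le _) (Finset.mem_univ i)) hη.2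

theorem dyckSet_finite (n k : ℕ) : (dyckSet n k).Finite :=
  (dyckLe_finite n k).subset fun _ h => ⟨h.1, h.2.le⟩

theorem isDyck_succ {n : ℕ} (η : Fin (n + 1) → ℕ) :
    IsDyck η ↔ IsDyck (fun i : Fin n => η i.castSucc) ∧ ∑ i, η i ≤ n := by
  rw [isDyck_iff, isDyck_iff, Fin.forall_fin_succ']
  apply and_congr
  · apply forall_congr'
    intro k
    rw [Fin.sum_univ_castSucc, if_neg (not_le.2 (Fin.castSucc_lt_last k))]
    simp
  · simp [Fin.le_last]

theorem ncard_dyckLe (n k : ℕ) (hk : k ≤ n) : (dyckSet (n + 1) k).ncard = (dyckLe n k).ncard := by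
  refine Set.ncard_congr (fun η _ i => η (Fin.castSucc i)) ?_ ?_ ?_
  · intro η hη
    refine ⟨((isDyck_succ η).1 hη.1).1, ?_⟩
    rw [← hη.2, Fin.sum_univ_castSucc]
    exact Nat.le_add_right _ _
  · intro η θ hη hθ h
    have h' : ∀ i : Fin n, η i.castSucc = θ i.castSucc := fun i => congrFun h i
    have h1 := hη.2
    have h2 := hθ.2
    rw [Fin.sum_univ_castSucc] at h1 h2
    simp only [h'] at h1
    funext i
    induction i using Fin.lastCases with
    | last => omega
    | cast i => exact h' i
  · intro ν hν
    have hs : ∑ i, (Fin.snoc ν (k - ∑ i, ν i) : Fin (n + 1) → ℕ) i = k := by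
      rw [Fin.sum_univ_castSucc]
      simp only [Fin.snoc_castSucc, Fin.snoc_last]
      have := hν.2
      omega
    refine ⟨Fin.snoc ν (k - ∑ i, ν i), ⟨?_, hs⟩, ?_⟩
    · rw [isDyck_succ, hs]
      simp only [Fin.snoc_castSucc]
      exact ⟨hν.1, hk⟩
    · funext i
      simp only [Fin.snoc_castSucc]

theorem ncard_rec (n k : ℕ) (hk : k + 1 ≤ n) :
    (dyckSet (n + 1) (k + 1)).ncard = (dyckSet n (k + 1)).ncard + (dyckSet (n + 1) k).ncard := by
  rw [ncard_dyckLe n (k + 1) hk, ncard_dyckLe n k (by omega),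
    ← Set.ncard_union_eq _ (dyckSet_finite _ _) (dyckLe_finite _ _)]
  · congr 1
    ext η
    constructor
    · rintro ⟨h1, h2⟩
      rcases Nat.lt_or_ge k (∑ i, η i) with h | h
      · exact Or.inl ⟨h1, by omega⟩
      · exact Or.inr ⟨h1, h⟩
    · rintro (⟨h1, h2⟩ | ⟨h1, h2⟩)
      · exact ⟨h1, by omega⟩
      · exact ⟨h1, by omega⟩
  · rw [Set.disjoint_left]
    rintro η ⟨_, h1⟩ ⟨_, h2⟩
    omega

theorem ncard_zero (n : ℕ) : (dyckSet n 0).ncard = 1 := by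
  rw [Set.ncard_eq_one]
  refine ⟨0, ?_⟩
  ext η
  constructor
  · rintro ⟨_, h⟩
    funext i
    have := Finset.sum_eq_zero_iff.1 h i (Finset.mem_univ i)
    simpa using this
  · rintro rfl
    refine ⟨fun k => by simp, by simp⟩

theorem ncard_large (n k : ℕ) (h : n + 1 ≤ k) : (dyckSet (n + 1) k).ncard = 0 := by
  have : dyckSet (n + 1) k = ∅ := by
    ext η
    simp only [Set.mem_empty_iff_false, iff_false]
    rintro ⟨h1, h2⟩
    have := ((isDyck_succ η).1 h1).2
    omega
  rw [this, Set.ncard_empty]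

theorem ncard_ballot (m : ℕ) : ∀ k, k + 1 ≤ m + 1 →
    (dyckSet (m + 1) (k + 1)).ncard + (m + k + 1).choose k = (m + k + 1).choose (k + 1) := by
  induction m with
  | zero =>
    intro k hk
    obtain rfl : k = 0 := by omega
    rw [ncard_large _ _ (by omega)]
    simp
  | succ m ih =>
    intro k
    induction k with
    | zero =>
      intro hk
      have h := ih 0 (by omega)
      rw [ncard_rec _ _ (by omega), ncard_zero]
      simp at h ⊢
      omega
    | succ k ihk =>
      intro hk
      rcases Nat.lt_or_ge k m with hkm | hkm
      · have h1 := ih (k + 1) (by omega)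
        have h2 := ihk (by omega)
        rw [ncard_rec _ _ (by omega)]
        have e1 : m + 1 + (k + 1) + 1 = (m + k + 2) + 1 := by omega
        have e2 : m + (k + 1) + 1 = m + k + 2 := by omega
        have e3 : m + 1 + k + 1 = m + k + 2 := by omega
        rw [e1, Nat.choose_succ_succ, Nat.choose_succ_succ _ (k + 1)]
        rw [e2] at h1
        rw [e3] at h2
        simp only [Nat.succ_eq_add_one] at *
        omega
      · obtain rfl : k = m := by omega
        rw [ncard_large _ _ (by omega), zero_add]
        exact Nat.choose_symm_of_eq_add (by omega)

theorem ncard_formula (n : ℕ) (hn : 0 < n) (k : ℕ) :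
    (dyckSet n k).ncard = (n - k) * (n + k).choose k / (n + k) := by
  obtain ⟨m, rfl⟩ : ∃ m, n = m + 1 := ⟨n - 1, by omega⟩
  symm
  apply Nat.div_eq_of_eq_mul_right (by omega)
  rcases Nat.lt_or_ge m k with h | h
  · rw [ncard_large _ _ (by omega), Nat.sub_eq_zero_of_le (by omega)]
    simp
  · rcases k with _ | k
    · rw [ncard_zero]; simp
    · have hb := ncard_ballot m k (by omega)
      have e : m + 1 + (k + 1) = (m + k + 1) + 1 := by omega
      rw [e, Nat.choose_succ_succ]
      have h3 := Nat.choose_succ_right_eq (m + k + 1) k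
      have e4 : m + k + 1 - k = m + 1 := by omega
      rw [e4] at h3
      simp only [Nat.succ_eq_add_one]
      generalize (m + k + 1).choose k = A at *
      generalize (m + k + 1).choose (k + 1) = B at *
      generalize (dyckSet (m + 1) (k + 1)).ncard = N at *
      obtain ⟨d, rfl⟩ : ∃ d, m = k + 1 + d := ⟨m - (k + 1), by omega⟩
      have e5 : k + 1 + d + 1 - (k + 1) = d + 1 := by omega
      rw [e5]
      subst hb
      zify at *
      linear_combination (-2) * h3

/-! ### Dimensions -/

theorem fIdeal_le (n : ℕ) : fIdeal n ≤ Ideal.span (QSymPlus n) := by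
  unfold fIdeal
  rw [Ideal.span_le]
  rintro _ ⟨α, hα, rfl⟩
  refine Ideal.subset_span ⟨fund_quasi n α, ?_⟩
  rw [constantCoeff_eq]
  apply (fund_homog n α).coeff_eq_zero
  simp only [map_zero]
  omega

theorem finrank_dSpan (n k : ℕ) : Module.finrank ℂ (dSpan n k) = (dyckSet n k).ncard := by
  have hli : LinearIndependent ℂ (fun η : dyckSet n k =>
      (monomial (Finsupp.equivFunOnFinite.symm η.1) 1 : MvPolynomial (Fin n) ℂ)) := by
    have h := (basisMonomials (Fin n) ℂ).linearIndependent
    rw [coe_basisMonomials] at h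
    exact h.comp (fun η : dyckSet n k => Finsupp.equivFunOnFinite.symm η.1)
      (Finsupp.equivFunOnFinite.symm.injective.comp Subtype.val_injective)
  haveI : Fintype (dyckSet n k) := (dyckSet_finite n k).fintype
  have h := finrank_span_eq_card hli
  rw [← Nat.card_eq_fintype_card, Nat.card_coe_set_eq] at h
  rw [← h]
  have : dSpan n k = Submodule.span ℂ (Set.range (fun η : dyckSet n k =>
      (monomial (Finsupp.equivFunOnFinite.symm η.1) 1 : MvPolynomial (Fin n) ℂ))) := by
    unfold dSpan
    congr 1
    ext f
    constructor
    · rintro ⟨ν, h1, h2, rfl⟩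
      rw [Finsupp.degree_eq_sum] at h2
      refine ⟨⟨ν, h1, h2⟩, ?_⟩
      simp
    · rintro ⟨⟨η, h1, h2⟩, rfl⟩
      refine ⟨Finsupp.equivFunOnFinite.symm η, by simpa using h1, ?_, rfl⟩
      rw [Finsupp.degree_eq_sum]
      simpa using h2
  rw [this]

theorem map_homog (n k : ℕ) :
    Submodule.map (Ideal.Quotient.mkₐ ℂ (Ideal.span (QSymPlus n))).toLinearMap
      (MvPolynomial.homogeneousSubmodule (Fin n) ℂ k) =
    Submodule.map (Ideal.Quotient.mkₐ ℂ (Ideal.span (QSymPlus n))).toLinearMap (dSpan n k) := by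
  apply le_antisymm
  · rintro _ ⟨f, hf, rfl⟩
    obtain ⟨a, ha, b, hb, rfl⟩ := Submodule.mem_sup.1 (dSpan_sup n k f hf)
    refine ⟨a, ha, ?_⟩
    simp only [AlgHom.toLinearMap_apply, map_add]
    have : Ideal.Quotient.mkₐ ℂ (Ideal.span (QSymPlus n)) b = 0 := by
      rw [Ideal.Quotient.mkₐ_eq_mk, Ideal.Quotient.eq_zero_iff_mem]
      exact fIdeal_le n hb
    rw [this, add_zero]
  · exact Submodule.map_mono (dSpan_homog n k)

theorem finrank_map (n k : ℕ) :
    Module.finrank ℂ (Submodule.map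
      (Ideal.Quotient.mkₐ ℂ (Ideal.span (QSymPlus n))).toLinearMap
      (MvPolynomial.homogeneousSubmodule (Fin n) ℂ k)) = (dyckSet n k).ncard := by
  rw [map_homog, ← finrank_dSpan]
  set φ := (Ideal.Quotient.mkₐ ℂ (Ideal.span (QSymPlus n))).toLinearMap with hφ
  have hinj : Function.Injective (φ.domRestrict (dSpan n k)) := by
    rw [injective_iff_map_eq_zero]
    rintro ⟨f, hf⟩ h0
    have h1 : Ideal.Quotient.mk (Ideal.span (QSymPlus n)) f = 0 := h0
    rw [Ideal.Quotient.eq_zero_iff_mem] at h1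
    exact Subtype.ext (dAll_disjoint n f (dSpan_le_dAll n k hf) h1)
  have h2 := LinearMap.finrank_range_of_inj hinj
  rwa [LinearMap.range_domRestrict] at h2

theorem hilbert_series_qsym_quotient (n : ℕ) (hn : 0 < n) :
    (∀ k : ℕ,
      Module.finrank ℂ
        (Submodule.map (Ideal.Quotient.mkₐ ℂ (Ideal.span (QSymPlus n))).toLinearMap
          (MvPolynomial.homogeneousSubmodule (Fin n) ℂ k))
        = (n - k) * (n + k).choose k / (n + k)) ∧
    ∀ k : ℕ, Nat.card {η : Fin n → ℕ // IsDyck η ∧ ∑ i, η i = k}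
        = (n - k) * (n + k).choose k / (n + k) := by
  refine ⟨fun k => ?_, fun k => ?_⟩
  · rw [finrank_map, ncard_formula n hn]
  · rw [← ncard_formula n hn]
    exact Nat.card_coe_set_eq (dyckSet n k)
end

section
/- For the hyperoctahedral group B_n = G_{n,2}, the dimension of the super-coinvariant space C[x_1,...,x_n]/⟨QInv_{n,2}^+⟩ equals 2^n · C_n, where C_n is the n-th Catalan number. -/
open MvPolynomial

/-- The quasi-invariants of the hyperoctahedral group `Bₙ = G_{n,2}`:
polynomials `Q(x₁², …, xₙ²)` with `Q` quasi-symmetric. -/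
def QInvB (n : ℕ) : Set (MvPolynomial (Fin n) ℂ) :=
  {P | ∃ Q : MvPolynomial (Fin n) ℂ, IsQuasiSym Q ∧
    P = MvPolynomial.bind₁ (fun i => (X i : MvPolynomial (Fin n) ℂ) ^ 2) Q}

/-- Quasi-invariants with zero constant term. -/
def QInvBPlus (n : ℕ) : Set (MvPolynomial (Fin n) ℂ) :=
  {P | P ∈ QInvB n ∧ constantCoeff P = 0}

namespace SuperCoinv

/-- The ideal generated by quasi-symmetric polynomials without constant term. -/
noncomputable def QI (n : ℕ) : Ideal (MvPolynomial (Fin n) ℂ) :=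
  Ideal.span {Q | IsQuasiSym Q ∧ constantCoeff Q = 0}

/-- Generalized ballot condition on exponent vectors. -/
def Bal (n j : ℕ) (a : Fin n →₀ ℕ) : Prop :=
  ∀ k : Fin n, (∑ i, if i ≤ k then a i else 0) < (k : ℕ) + j

lemma bal_cons (n j b : ℕ) (a : Fin n →₀ ℕ) :
    Bal (n + 1) j (Finsupp.cons b a) ↔ b < j ∧ Bal n (j + 1 - b) a := by
  unfold Bal
  rw [Fin.forall_fin_succ]
  simp only [Fin.sum_univ_succ, Finsupp.cons_zero, Finsupp.cons_succ, Fin.succ_le_succ_iff,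
    Fin.zero_le, if_true, Fin.val_succ, Fin.val_zero, le_refl]
  have h0 : ∀ i : Fin n, ¬ (i.succ ≤ 0) := fun i => by simp
  simp only [h0, if_false, Finset.sum_const_zero]
  constructor
  · rintro ⟨h1, h2⟩
    refine ⟨by omega, fun k => ?_⟩
    have := h2 k
    omega
  · rintro ⟨h1, h2⟩
    refine ⟨by omega, fun k => ?_⟩
    have := h2 k
    omega

/-- inclusion of polynomials in the last variables -/
noncomputable abbrev iota (n : ℕ) : MvPolynomial (Fin n) ℂ →ₐ[ℂ] MvPolynomial (Fin (n + 1)) ℂ :=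
  rename Fin.succ

lemma X_pow_mul_iota_monomial (n b : ℕ) (s : Fin n →₀ ℕ) (c : ℂ) :
    (X 0 : MvPolynomial (Fin (n + 1)) ℂ) ^ b * iota n (monomial s c)
      = monomial (Finsupp.cons b s) c := by
  rw [iota, rename_monomial, X_pow_eq_monomial, monomial_mul, one_mul]
  congr 2
  ext i
  refine Fin.cases ?_ (fun i => ?_) i
  · simp [Finsupp.mapDomain_of_notMem_range]
  · simp [Finsupp.mapDomain_apply (Fin.succ_injective n)]

lemma coeff_X_pow_mul_iota (n b i : ℕ) (s : Fin n →₀ ℕ) (p : MvPolynomial (Fin n) ℂ) :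
    coeff (Finsupp.cons b s) ((X 0 : MvPolynomial (Fin (n + 1)) ℂ) ^ i * iota n p)
      = if b = i then coeff s p else 0 := by
  induction p using MvPolynomial.induction_on' with
  | monomial u a =>
    rw [X_pow_mul_iota_monomial, coeff_monomial, coeff_monomial]
    simp only [Finsupp.cons_injective2.eq_iff]
    by_cases h : b = i <;> by_cases h' : u = s <;> simp [h, h', eq_comm]
  | add p q hp hq =>
    rw [map_add, mul_add, coeff_add, hp, hq, coeff_add]
    split_ifs <;> simp

/-- Fundamental quasi-symmetric polynomials; the list records the parts minus one. -/
noncomputable def FF : (n : ℕ) → List ℕ → MvPolynomial (Fin n) ℂ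
  | _, [] => 1
  | 0, _ :: _ => 0
  | n + 1, a :: β => (∑ i ∈ Finset.range (a + 1), X 0 ^ i * iota n (FF n ((a - i) :: β)))
      + X 0 ^ (a + 1) * iota n (FF n β)

lemma FF_nil (n : ℕ) : FF n [] = 1 := by cases n <;> rfl

lemma FF_cons (n a : ℕ) (β : List ℕ) : FF (n + 1) (a :: β) =
    (∑ i ∈ Finset.range (a + 1), X 0 ^ i * iota n (FF n ((a - i) :: β)))
      + X 0 ^ (a + 1) * iota n (FF n β) := rfl

lemma FF_zero_cons (n : ℕ) (β : List ℕ) : FF (n + 1) (0 :: β) =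
    iota n (FF n (0 :: β)) + X 0 * iota n (FF n β) := by
  rw [FF_cons]; simp

lemma FF_succ_cons (n a : ℕ) (β : List ℕ) : FF (n + 1) ((a + 1) :: β) =
    iota n (FF n ((a + 1) :: β)) + X 0 * FF (n + 1) (a :: β) := by
  rw [FF_cons, FF_cons, Finset.sum_range_succ']
  simp only [mul_add, Finset.mul_sum, Nat.add_sub_add_right, pow_zero, one_mul, Nat.sub_zero]
  have : ∀ i, (X 0 : MvPolynomial (Fin (n+1)) ℂ) ^ (i + 1) * iota n (FF n ((a - i) :: β))
    = X 0 * (X 0 ^ i * iota n (FF n ((a - i) :: β))) := fun i => by ring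
  simp only [this]
  ring

/-- coefficients of fundamentals -/
def rr : List ℕ → List ℕ → ℂ
  | [], [] => 1
  | _ :: _, [] => 0
  | [], _ :: _ => 0
  | a :: β, c :: γ => if c ≤ a then rr ((a - c) :: β) γ else if c = a + 1 then rr β γ else 0

lemma qcomp_cons (n b : ℕ) (s : Fin n →₀ ℕ) :
    qcomp (Finsupp.cons b s) = if b = 0 then qcomp s else b :: qcomp s := by
  unfold qcomp
  rw [List.ofFn_succ]
  simp only [Finsupp.cons_zero, Finsupp.cons_succ, List.filter_cons]
  by_cases h : b = 0 <;> simp [h]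

lemma qcomp_zero (n : ℕ) : qcomp (0 : Fin n →₀ ℕ) = [] := by
  simp [qcomp]

lemma qcomp_eq_nil {n : ℕ} (s : Fin n →₀ ℕ) (h : qcomp s = []) : s = 0 := by
  ext i
  simp only [qcomp, List.filter_eq_nil_iff, List.mem_ofFn'] at h
  simpa using h (s i) ⟨i, rfl⟩

lemma coeff_FF (n : ℕ) : ∀ (α : List ℕ) (s : Fin n →₀ ℕ), coeff s (FF n α) = rr α (qcomp s) := by
  have hnil : ∀ (n : ℕ) (s : Fin n →₀ ℕ), coeff s (FF n []) = rr [] (qcomp s) := by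
    intro n s
    rw [FF_nil, coeff_one]
    split_ifs with h
    · subst h; rw [qcomp_zero]; rfl
    · cases hq : qcomp s with
      | nil => exact absurd (qcomp_eq_nil s hq).symm h
      | cons => rfl
  induction n with
  | zero =>
    intro α s
    cases α with
    | nil => exact hnil _ _
    | cons a β =>
      have : s = 0 := Subsingleton.elim _ _
      rw [this, qcomp_zero]; simp [FF, rr]
  | succ n ih =>
    intro α s
    cases α with
    | nil => exact hnil _ _
    | cons a β =>
      rw [← Finsupp.cons_tail s, FF_cons, coeff_add, coeff_sum]
      simp only [coeff_X_pow_mul_iota, ih]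
      rw [Finset.sum_ite_eq, qcomp_cons]
      generalize s 0 = b
      generalize qcomp s.tail = q
      by_cases hb : b = 0
      · subst hb; simp
      · rw [if_neg hb]
        simp only [rr, Finset.mem_range]
        by_cases h1 : b ≤ a
        · rw [if_pos (by omega), if_neg (by omega), if_pos h1, add_zero]
        · rw [if_neg (by omega), if_neg h1, zero_add]

lemma FF_quasi (n : ℕ) (α : List ℕ) : IsQuasiSym (FF n α) := by
  intro ν μ h
  rw [coeff_FF, coeff_FF, h]

lemma FF_const (n a : ℕ) (α : List ℕ) : constantCoeff (FF n (a :: α)) = 0 := by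
  rw [constantCoeff_eq, coeff_FF, qcomp_zero]; rfl

/-- Auxiliary ideals for the upper bound. -/
noncomputable def QJ (n j : ℕ) : Ideal (MvPolynomial (Fin n) ℂ) :=
  Ideal.span {f | ∃ a α, j ≤ (a :: α).sum + 1 ∧ f = FF n (a :: α)}

lemma QJ_le (n j : ℕ) : QJ n j ≤ QI n := by
  apply Ideal.span_mono
  rintro f ⟨a, α, -, rfl⟩
  exact ⟨FF_quasi _ _, FF_const _ _ _⟩

lemma FF_mem_QJ (n j a : ℕ) (α : List ℕ) (h : j ≤ (a :: α).sum + 1) : FF n (a :: α) ∈ QJ n j :=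
  Ideal.subset_span ⟨a, α, h, rfl⟩

lemma iota_FF_mem (n j : ℕ) (hj : 1 ≤ j) : ∀ (α : List ℕ), j + 1 ≤ α.sum + 1 →
    iota n (FF n α) ∈ QJ (n + 1) j := by
  intro α
  induction α with
  | nil => intro h; simp at h; omega
  | cons a α ih =>
    intro h
    simp only [List.sum_cons] at h
    cases a with
    | zero =>
      have h1 : iota n (FF n (0 :: α)) = FF (n + 1) (0 :: α) - X 0 * iota n (FF n α) := by
        rw [FF_zero_cons]; ring
      rw [h1]
      refine Ideal.sub_mem _ (FF_mem_QJ _ _ _ _ (by simp; omega)) (Ideal.mul_mem_left _ _ (ih (by omega)))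
    | succ a =>
      have h1 : iota n (FF n ((a + 1) :: α)) = FF (n + 1) ((a + 1) :: α) - X 0 * FF (n + 1) (a :: α) := by
        rw [FF_succ_cons]; ring
      rw [h1]
      exact Ideal.sub_mem _ (FF_mem_QJ _ _ _ _ (by simp; omega))
        (Ideal.mul_mem_left _ _ (FF_mem_QJ _ _ _ _ (by simp; omega)))

lemma iota_QJ (n j : ℕ) (hj : 1 ≤ j) (f) (hf : f ∈ QJ n (j + 1)) : iota n f ∈ QJ (n + 1) j := by
  have : QJ n (j + 1) ≤ (QJ (n + 1) j).comap (iota n) := by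
    apply Ideal.span_le.2
    rintro f ⟨a, α, h, rfl⟩
    exact iota_FF_mem n j hj _ h
  exact this hf

/-- span of ballot monomials plus the ideal -/
noncomputable def WW (n j : ℕ) : Submodule ℂ (MvPolynomial (Fin n) ℂ) :=
  restrictSupport ℂ {a | Bal n j a} ⊔ (QJ n j).restrictScalars ℂ

lemma mem_WW_of_QJ {n j : ℕ} {f} (h : f ∈ QJ n j) : f ∈ WW n j :=
  Submodule.mem_sup_right h

lemma X_pow_mul_restrict (n j b : ℕ) (hb : b < j) (f : MvPolynomial (Fin n) ℂ)
    (hf : f ∈ restrictSupport ℂ {a | Bal n (j + 1 - b) a}) :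
    X 0 ^ b * iota n f ∈ WW (n + 1) j := by
  rw [restrictSupport_eq_span] at hf
  induction hf using Submodule.span_induction with
  | mem x hx =>
    obtain ⟨a, ha, rfl⟩ := hx
    simp only
    rw [X_pow_mul_iota_monomial]
    refine Submodule.mem_sup_left ?_
    rw [monomial_mem_restrictSupport]
    exact Or.inl ((bal_cons _ _ _ _).2 ⟨hb, ha⟩)
  | zero => simp
  | add x y _ _ hx hy => rw [map_add, mul_add]; exact add_mem hx hy
  | smul c x _ hx =>
    rw [map_smul, mul_smul_comm]; exact Submodule.smul_mem _ _ hx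

lemma WW_top (n : ℕ) : ∀ j, 1 ≤ j → ∀ f, f ∈ WW n j := by
  induction n with
  | zero =>
    intro j hj f
    refine Submodule.mem_sup_left ?_
    rw [mem_restrictSupport_iff]
    intro a _ k
    exact k.elim0
  | succ n ih =>
    intro j hj
    have key : ∀ b (h : MvPolynomial (Fin n) ℂ), X 0 ^ b * iota n h ∈ WW (n + 1) j := by
      intro b
      induction b using Nat.strong_induction_on with
      | _ b ihb =>
        have step : ∀ (b' : ℕ) (β : List ℕ) (h : MvPolynomial (Fin n) ℂ), b = b' + 1 →
            j ≤ (b' :: β).sum + 1 → X 0 ^ b * iota n (FF n β * h) ∈ WW (n + 1) j := by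
          intro b' β h hb hj'
          have e : X 0 ^ b * iota n (FF n β * h) = iota n h * FF (n + 1) (b' :: β)
              - ∑ i ∈ Finset.range (b' + 1), X 0 ^ i * iota n (FF n ((b' - i) :: β) * h) := by
            rw [FF_cons, hb]
            simp only [map_mul, mul_add, Finset.mul_sum]
            rw [add_sub_right_comm, ← Finset.sum_sub_distrib, Finset.sum_eq_zero]
            · ring
            · intros; ring
          rw [e]
          refine sub_mem (mem_WW_of_QJ (Ideal.mul_mem_left _ _ (FF_mem_QJ _ _ _ _ hj'))) ?_
          refine sum_mem fun i hi => ihb i ?_ _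
          rw [Finset.mem_range] at hi; omega
        intro h
        by_cases hbj : j ≤ b
        · have := step (b - 1) [] h (by omega) (by simp; omega)
          rwa [FF_nil, one_mul] at this
        · push Not at hbj
          obtain ⟨u, hu, v, hv, rfl⟩ := Submodule.mem_sup.1 (ih (j + 1 - b) (by omega) h)
          rw [map_add, mul_add]
          refine add_mem (X_pow_mul_restrict n j b hbj u hu) ?_
          rw [Submodule.restrictScalars_mem] at hv
          rcases Nat.eq_zero_or_pos b with rfl | hb
          · rw [pow_zero, one_mul]
            exact mem_WW_of_QJ (iota_QJ n j hj v hv)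
          · suffices H : ∀ w, X 0 ^ b * iota n (v * w) ∈ WW (n + 1) j by
              have := H 1
              rwa [mul_one] at this
            unfold QJ Ideal.span at hv
            induction hv using Submodule.span_induction with
            | mem x hx =>
              obtain ⟨a, α, h1, rfl⟩ := hx
              intro w
              exact step (b - 1) (a :: α) w (by omega) (by simp at h1 ⊢; omega)
            | zero => simp
            | add x y _ _ hx hy =>
              intro w
              rw [add_mul, map_add, mul_add]; exact add_mem (hx w) (hy w)
            | smul c x _ hx =>
              intro w
              have := hx (c * w)
              rwa [smul_eq_mul, mul_comm c x, mul_assoc]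
    intro f
    induction f using MvPolynomial.induction_on' with
    | monomial u a =>
      rw [← Finsupp.cons_tail u, ← X_pow_mul_iota_monomial]
      exact key _ _
    | add p q hp hq => exact add_mem hp hq

/-- Insert a zero entry at position `p`. -/
noncomputable def ins {n : ℕ} (p : Fin (n + 1)) (μ : Fin n →₀ ℕ) : Fin (n + 1) →₀ ℕ :=
  Finsupp.equivFunOnFinite.symm (Fin.insertNth (α := fun _ => ℕ) p 0 μ)

@[simp] lemma ins_same {n : ℕ} (p : Fin (n + 1)) (μ : Fin n →₀ ℕ) : ins p μ p = 0 := by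
  simp [ins]

@[simp] lemma ins_succAbove {n : ℕ} (p : Fin (n + 1)) (μ : Fin n →₀ ℕ) (k : Fin n) :
    ins p μ (p.succAbove k) = μ k := by
  simp [ins]

lemma eq_ins {n : ℕ} (p : Fin (n + 1)) (μ : Fin n →₀ ℕ) (a : Fin (n + 1) →₀ ℕ)
    (h0 : a p = 0) (h : ∀ k, a (p.succAbove k) = μ k) : a = ins p μ := by
  ext i
  revert i
  rw [Fin.forall_iff_succAbove p]
  exact ⟨by simp [h0], fun k => by simp [h]⟩

lemma qcomp_ins : ∀ {n : ℕ} (p : Fin (n + 1)) (μ : Fin n →₀ ℕ), qcomp (ins p μ) = qcomp μ := by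
  intro n
  induction n with
  | zero =>
    intro p μ
    have : ins p μ = 0 := by
      symm; exact eq_ins _ _ _ rfl (fun k => k.elim0)
    rw [this, qcomp_zero, Subsingleton.elim μ 0, qcomp_zero]
  | succ n ih =>
    intro p μ
    refine Fin.cases ?_ (fun p => ?_) p
    · have : ins 0 μ = Finsupp.cons 0 μ := by
        symm; exact eq_ins _ _ _ (by simp) (fun k => by simp)
      rw [this, qcomp_cons, if_pos rfl]
    · have : ins p.succ μ = Finsupp.cons (μ 0) (ins p μ.tail) := by
        symm
        refine eq_ins _ _ _ (by simp) (fun k => ?_)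
        refine Fin.cases ?_ (fun k => ?_) k
        · simp
        · simp [Finsupp.tail_apply]
      rw [this, qcomp_cons, ih, ← qcomp_cons, Finsupp.cons_tail]

/-- Setting the variable `p` to zero. -/
noncomputable def RR {n : ℕ} (p : Fin (n + 1)) :
    MvPolynomial (Fin (n + 1)) ℂ →ₐ[ℂ] MvPolynomial (Fin n) ℂ :=
  aeval (Fin.insertNth (α := fun _ => MvPolynomial (Fin n) ℂ) p 0 X)

lemma RR_X_same {n : ℕ} (p : Fin (n + 1)) : RR p (X p) = 0 := by simp [RR]

lemma RR_X_succAbove {n : ℕ} (p : Fin (n + 1)) (k : Fin n) : RR p (X (p.succAbove k)) = X k := by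
  simp [RR]

lemma coeff_RR {n : ℕ} (p : Fin (n + 1)) (f : MvPolynomial (Fin (n + 1)) ℂ) :
    ∀ ν, coeff ν (RR p f) = coeff (ins p ν) f := by
  induction f using MvPolynomial.induction_on with
  | C c =>
    intro ν
    rw [show RR p (C c) = C c from by simp [RR], coeff_C, coeff_C]
    congr 1
    rw [eq_iff_iff]
    constructor
    · rintro rfl; exact eq_ins _ _ _ rfl (fun _ => rfl)
    · intro h
      ext k
      rw [← ins_succAbove p ν k, ← h]; rfl
  | add f g hf hg => intro ν; rw [map_add, coeff_add, coeff_add, hf, hg]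
  | mul_X f i hf =>
    intro ν
    rw [map_mul]
    revert i
    rw [Fin.forall_iff_succAbove p]
    constructor
    · rw [RR_X_same, mul_zero, coeff_mul_X']
      simp
    · intro k
      rw [RR_X_succAbove, coeff_mul_X', coeff_mul_X']
      simp only [Finsupp.mem_support_iff, ins_succAbove]
      split_ifs with h
      · rw [hf]
        congr 1
        symm
        refine eq_ins _ _ _ (by simp) (fun l => ?_)
        simp [Finsupp.single_apply]
      · rfl

lemma RR_quasi {n : ℕ} (p : Fin (n + 1)) (f) (hf : IsQuasiSym f) : IsQuasiSym (RR p f) := by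
  intro ν μ h
  rw [coeff_RR, coeff_RR]
  apply hf
  rw [qcomp_ins, qcomp_ins, h]

lemma ins_zero {n : ℕ} (p : Fin (n + 1)) : ins p (0 : Fin n →₀ ℕ) = 0 :=
  (eq_ins _ _ _ rfl (fun _ => rfl)).symm

lemma RR_eq {n : ℕ} (p q : Fin (n + 1)) (f) (hf : IsQuasiSym f) : RR p f = RR q f := by
  ext ν
  rw [coeff_RR, coeff_RR]
  apply hf
  rw [qcomp_ins, qcomp_ins]

lemma X_dvd {n : ℕ} (i : Fin n) (f) : X i ∣ RR i.succ f - RR i.castSucc f := by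
  induction f using MvPolynomial.induction_on with
  | C c => simp [RR]
  | add f g hf hg =>
    rw [map_add, map_add, add_sub_add_comm]; exact dvd_add hf hg
  | mul_X f k hf =>
    have hX : X i ∣ RR i.succ (X k) - RR i.castSucc (X k) := by
      rcases lt_trichotomy k i.castSucc with h | h | h
      · obtain ⟨l, rfl⟩ : ∃ l : Fin n, k = l.castSucc :=
          ⟨⟨k, by have := i.2; have := Fin.lt_def.1 h; simp at this; omega⟩, by ext; simp⟩
        have hl : l < i := by simpa using h
        have e1 := RR_X_succAbove i.succ l
        have e2 := RR_X_succAbove i.castSucc l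
        rw [Fin.succAbove_of_castSucc_lt _ _ (by simp; exact hl.le)] at e1
        rw [Fin.succAbove_of_castSucc_lt _ _ (by simpa using hl)] at e2
        rw [e1, e2]; simp
      · subst h
        have e1 := RR_X_succAbove i.succ i
        rw [Fin.succAbove_of_castSucc_lt _ _ (by simp)] at e1
        rw [e1, RR_X_same]; simp
      · obtain ⟨l, rfl⟩ : ∃ l : Fin n, k = l.succ :=
          ⟨k.pred (by rintro rfl; simp at h), by simp⟩
        have hl : i ≤ l := by
          rw [Fin.lt_def] at h; simp at h; rw [Fin.le_def]; omega
        have e2 := RR_X_succAbove i.castSucc l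
        rw [Fin.succAbove_of_le_castSucc _ _ (by simpa using hl)] at e2
        rw [e2]
        rcases hl.eq_or_lt with rfl | hl
        · rw [RR_X_same]; simp
        · have e1 := RR_X_succAbove i.succ l
          rw [Fin.succAbove_of_le_castSucc _ _ (by rw [Fin.le_def]; simp; exact hl)] at e1
          rw [e1]; simp
    rw [map_mul, map_mul]
    have : RR i.succ f * RR i.succ (X k) - RR i.castSucc f * RR i.castSucc (X k)
      = RR i.succ f * (RR i.succ (X k) - RR i.castSucc (X k))
        + (RR i.succ f - RR i.castSucc f) * RR i.castSucc (X k) := by ring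
    rw [this]
    exact dvd_add (hX.mul_left _) (hf.mul_right _)

lemma exists_trim {n : ℕ} (i : Fin n) (f) (hf : f ∈ QI (n + 1)) :
    ∃ t ∈ QI n, X i * t = RR i.succ f - RR i.castSucc f := by
  unfold QI Ideal.span at hf
  suffices H : ∀ w, ∃ t ∈ QI n, X i * t = RR i.succ (f * w) - RR i.castSucc (f * w) by
    simpa using H 1
  induction hf using Submodule.span_induction with
  | mem f hf =>
    obtain ⟨h1, h2⟩ := hf
    intro w
    obtain ⟨t, ht⟩ := X_dvd i w
    refine ⟨RR i.succ f * t, Ideal.mul_mem_right _ _ (Ideal.subset_span ⟨RR_quasi _ _ h1, ?_⟩), ?_⟩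
    · rw [constantCoeff_eq, coeff_RR, ins_zero]; exact h2
    · rw [map_mul, map_mul, RR_eq i.castSucc i.succ f h1, ← mul_sub, ht]; ring
  | zero => intro w; exact ⟨0, zero_mem _, by simp⟩
  | add f g _ _ hf hg =>
    intro w
    obtain ⟨t, ht, e⟩ := hf w
    obtain ⟨t', ht', e'⟩ := hg w
    refine ⟨t + t', add_mem ht ht', ?_⟩
    rw [mul_add, e, e', add_mul, map_add, map_add]; ring
  | smul c f _ hf =>
    intro w
    have := hf (c * w)
    rwa [smul_eq_mul, mul_comm c f, mul_assoc]

lemma bal_of_ins {n : ℕ} (i : Fin n) (p : Fin (n + 1)) (hp : p = i.castSucc ∨ p = i.succ)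
    (ν : Fin n →₀ ℕ) (h : Bal (n + 1) 1 (ins p (ν + Finsupp.single i 1))) : Bal n 1 ν := by
  intro k
  by_cases hk : k < i
  · have h1 := h k.castSucc
    rw [Fin.sum_univ_succAbove _ p] at h1
    simp only [ins_same, ite_self, zero_add, ins_succAbove] at h1
    refine lt_of_le_of_lt (Finset.sum_le_sum fun l _ => ?_) h1
    by_cases hl : l ≤ k
    · have : p.succAbove l = l.castSucc := by
        apply Fin.succAbove_of_castSucc_lt
        have : l < i := lt_of_le_of_lt hl hk
        rcases hp with rfl | rfl
        · simpa using this
        · simp; exact this.le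
      rw [if_pos hl, this, if_pos (by simpa using hl)]
      simp
    · rw [if_neg hl]; exact Nat.zero_le _
  · push Not at hk
    have h1 := h k.succ
    rw [Fin.sum_univ_succAbove _ p] at h1
    simp only [ins_same, ite_self, zero_add, ins_succAbove] at h1
    have h2 : (∑ l, ((if l ≤ k then ν l else 0) + (if l = i then 1 else 0))) ≤
        ∑ l, if p.succAbove l ≤ k.succ then (ν + Finsupp.single i 1 : Fin n →₀ ℕ) l else 0 := by
      refine Finset.sum_le_sum fun l _ => ?_
      by_cases hl : l ≤ k
      · have : p.succAbove l ≤ k.succ := by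
          refine le_trans ?_ (Fin.succ_le_succ_iff.2 hl)
          rw [Fin.succAbove]
          split_ifs
          · exact Fin.castSucc_le_succ l
          · exact le_rfl
        rw [if_pos hl, if_pos this]
        simp [Finsupp.single_apply, eq_comm]
      · rw [if_neg hl, if_neg (by rintro rfl; exact hl hk)]; exact Nat.zero_le _
    rw [Finset.sum_add_distrib, Finset.sum_ite_eq' Finset.univ i] at h2
    simp only [Finset.mem_univ, if_true, Fin.val_succ] at h1 h2
    omega

lemma constantCoeff_QI {n : ℕ} {f} (hf : f ∈ QI n) : constantCoeff f = 0 := by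
  have : QI n ≤ RingHom.ker (constantCoeff (R := ℂ) (σ := Fin n)) :=
    Ideal.span_le.2 fun f hf => hf.2
  exact this hf

lemma lower (n : ℕ) : ∀ f ∈ QI n, (∀ a, coeff a f ≠ 0 → Bal n 1 a) → f = 0 := by
  induction n with
  | zero =>
    intro f hf _
    ext a
    rw [Subsingleton.elim a 0]
    exact constantCoeff_QI hf
  | succ n ih =>
    intro f hf hb
    have h1 : ∀ (i : Fin n) (μ : Fin n →₀ ℕ),
        coeff (ins i.succ μ) f = coeff (ins i.castSucc μ) f := by
      intro i μ
      obtain ⟨t, ht, e⟩ := exists_trim i f hf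
      have hc : ∀ ν, coeff ν t = coeff (ins i.succ (ν + Finsupp.single i 1)) f
          - coeff (ins i.castSucc (ν + Finsupp.single i 1)) f := by
        intro ν
        rw [← coeff_RR, ← coeff_RR, ← coeff_sub, ← e, add_comm, coeff_X_mul]
      have ht0 : t = 0 := by
        refine ih t ht fun ν hν => ?_
        rw [hc] at hν
        by_cases h2 : coeff (ins i.succ (ν + Finsupp.single i 1)) f = 0
        · refine bal_of_ins i _ (Or.inl rfl) ν (hb _ ?_)
          intro h3; rw [h2, h3] at hν; simp at hν
        · exact bal_of_ins i _ (Or.inr rfl) ν (hb _ h2)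
      rw [ht0, mul_zero] at e
      rw [← coeff_RR, ← coeff_RR, sub_eq_zero.1 e.symm]
    have h2 : ∀ (p : Fin (n + 1)) (μ : Fin n →₀ ℕ), coeff (ins p μ) f = coeff (ins 0 μ) f := by
      intro p μ
      induction p using Fin.induction with
      | zero => rfl
      | succ i hi => rw [h1, hi]
    have h3 : ∀ (p : Fin (n + 1)) (a : Fin (n + 1) →₀ ℕ), a p ≠ 0 → coeff a f = 0 := by
      intro p
      induction p using Fin.induction with
      | zero =>
        intro a ha
        by_contra hc
        have := hb a hc
        rw [← Finsupp.cons_tail a, bal_cons] at this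
        omega
      | succ i hi =>
        intro a ha
        have e : a = ins 0 a.tail ∨ a 0 ≠ 0 := by
          by_cases h0 : a 0 = 0
          · left; exact eq_ins _ _ _ h0 (fun k => by simp [Finsupp.tail_apply])
          · right; exact h0
        rcases e with e | e
        · rw [e, ← h2 (Fin.last n)]
          apply hi
          have := ins_succAbove (Fin.last n) a.tail i
          rw [Fin.succAbove_last] at this
          rw [this]; exact ha
        · by_contra hc
          have := hb a hc
          rw [← Finsupp.cons_tail a, bal_cons] at this
          omega
    ext a
    by_cases ha : a = 0
    · subst ha; exact constantCoeff_QI hf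
    · obtain ⟨p, hp⟩ : ∃ p, a p ≠ 0 := by
        by_contra hc
        push Not at hc
        exact ha (Finsupp.ext hc)
      exact h3 p a hp

/-- The finite set of ballot vectors. -/
noncomputable def DD : (n : ℕ) → ℕ → Finset (Fin n →₀ ℕ)
  | 0, _ => {0}
  | n + 1, j => (Finset.range j).biUnion fun b => (DD n (j + 1 - b)).image (Finsupp.cons b)

lemma mem_DD (n : ℕ) : ∀ j a, a ∈ DD n j ↔ Bal n j a := by
  induction n with
  | zero =>
    intro j a
    simp only [DD, Finset.mem_singleton, Subsingleton.elim a 0, true_iff]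
    intro k; exact k.elim0
  | succ n ih =>
    intro j a
    rw [← Finsupp.cons_tail a, bal_cons]
    simp only [DD, Finset.mem_biUnion, Finset.mem_range, Finset.mem_image]
    constructor
    · rintro ⟨b, hb, s, hs, e⟩
      obtain ⟨rfl, rfl⟩ := Finsupp.cons_injective2 e
      exact ⟨hb, (ih _ _).1 hs⟩
    · rintro ⟨hb, hs⟩
      exact ⟨_, hb, _, (ih _ _).2 hs, rfl⟩

lemma card_DD_succ (n j : ℕ) :
    (DD (n + 1) j).card = ∑ b ∈ Finset.range j, (DD n (j + 1 - b)).card := by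
  rw [DD, Finset.card_biUnion]
  · refine Finset.sum_congr rfl fun b _ => ?_
    exact Finset.card_image_of_injective _ (Finsupp.cons_right_injective _)
  · intro b _ c _ hbc
    rw [Function.onFun, Finset.disjoint_left]
    intro a h1 h2
    simp only [Finset.mem_image] at h1 h2
    obtain ⟨s, _, rfl⟩ := h1
    obtain ⟨t, _, e⟩ := h2
    exact hbc (Finsupp.cons_injective2 e).1.symm

lemma card_DD_rec (n j : ℕ) :
    (DD (n + 1) (j + 1)).card = (DD (n + 1) j).card + (DD n (j + 2)).card := by
  rw [card_DD_succ, card_DD_succ, Finset.sum_range_succ']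
  simp only [Nat.add_sub_add_right, Nat.sub_zero]

lemma card_DD (n : ℕ) : ∀ j,
    (DD (n + 1) j).card + (2 * n + j + 1).choose n = (2 * n + j + 1).choose (n + 1) := by
  induction n with
  | zero =>
    intro j
    rw [card_DD_succ]
    simp [DD]
  | succ n ih =>
    intro j
    induction j with
    | zero =>
      rw [card_DD_succ]
      simp only [Finset.range_zero, Finset.sum_empty, zero_add, add_zero]
      rw [← Nat.choose_symm_of_eq_add]; omega
    | succ j ihj =>
      rw [card_DD_rec]
      have h := ih (j + 2)
      have e1 : 2 * (n + 1) + (j + 1) + 1 = (2 * n + j + 3) + 1 := by ring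
      have e2 : 2 * (n + 1) + j + 1 = 2 * n + j + 3 := by ring
      have e3 : 2 * n + (j + 2) + 1 = 2 * n + j + 3 := by ring
      rw [e1, Nat.choose_succ_succ, Nat.choose_succ_succ (2 * n + j + 3) (n + 1)]
      rw [e2] at ihj
      rw [e3] at h
      simp only [Nat.succ_eq_add_one] at *
      omega

lemma card_DD_one (n : ℕ) : (DD n 1).card = catalan n := by
  cases n with
  | zero => simp [DD]
  | succ n =>
    have h := card_DD n 1
    have hc := succ_mul_catalan_eq_centralBinom (n + 1)
    rw [Nat.centralBinom] at hc
    have e : 2 * (n + 1) = 2 * n + 1 + 1 := by ring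
    rw [e] at hc
    have h2 := Nat.choose_succ_right_eq (2 * n + 1 + 1) n
    have e2 : 2 * n + 1 + 1 - n = n + 2 := by omega
    rw [e2] at h2
    have : (n + 1 + 1) * (DD (n + 1) 1).card = (n + 1 + 1) * catalan (n + 1) := by
      rw [hc]
      nlinarith
    exact Nat.eq_of_mul_eq_mul_left (by omega) this

/-- halves of exponents -/
noncomputable def hf {n : ℕ} (a : Fin n →₀ ℕ) : Fin n →₀ ℕ :=
  Finsupp.equivFunOnFinite.symm fun i => a i / 2

/-- parities of exponents -/
noncomputable def par {n : ℕ} (a : Fin n →₀ ℕ) : Fin n →₀ ℕ :=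
  Finsupp.equivFunOnFinite.symm fun i => a i % 2

@[simp] lemma hf_apply {n : ℕ} (a : Fin n →₀ ℕ) (i) : hf a i = a i / 2 := rfl
@[simp] lemma par_apply {n : ℕ} (a : Fin n →₀ ℕ) (i) : par a i = a i % 2 := rfl

lemma two_hf_add_par {n : ℕ} (a : Fin n →₀ ℕ) : 2 • hf a + par a = a := by
  ext i; simp; omega

/-- substitution of squares -/
noncomputable abbrev phi (n : ℕ) : MvPolynomial (Fin n) ℂ →ₐ[ℂ] MvPolynomial (Fin n) ℂ :=
  bind₁ fun i => (X i : MvPolynomial (Fin n) ℂ) ^ 2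

lemma phi_monomial {n : ℕ} (s : Fin n →₀ ℕ) (c : ℂ) :
    phi n (monomial s c) = monomial (2 • s) c := by
  rw [phi, bind₁_monomial, monomial_eq (s := 2 • s)]
  congr 1
  rw [Finsupp.prod_fintype _ _ (by simp)]
  rw [Finset.prod_subset (Finset.subset_univ _)]
  · refine Finset.prod_congr rfl fun i _ => ?_
    simp [pow_mul]
  · intro i _ hi
    simp at hi
    simp [hi]

lemma constantCoeff_phi {n : ℕ} (f) : constantCoeff (phi n f) = constantCoeff f := by
  induction f using MvPolynomial.induction_on with
  | C c => simp
  | add f g hf hg => simp [hf, hg]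
  | mul_X f i hf => simp

lemma span_QInvBPlus (n : ℕ) : Ideal.span (QInvBPlus n) = (QI n).map (phi n) := by
  rw [QI, Ideal.map_span]
  congr 1
  ext P
  constructor
  · rintro ⟨⟨Q, hQ, rfl⟩, h⟩
    exact ⟨Q, ⟨hQ, (constantCoeff_phi Q).symm.trans h⟩, rfl⟩
  · rintro ⟨Q, ⟨hQ, h⟩, rfl⟩
    exact ⟨⟨Q, hQ, rfl⟩, (constantCoeff_phi Q).trans h⟩

open Classical in
/-- extraction of the part with parity vector `e` -/
noncomputable def prj {n : ℕ} (e : Fin n →₀ ℕ) :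
    MvPolynomial (Fin n) ℂ →ₗ[ℂ] MvPolynomial (Fin n) ℂ :=
  (basisMonomials (Fin n) ℂ).constr ℂ fun m => if par m = e then monomial (hf m) 1 else 0

open Classical in
lemma prj_monomial {n : ℕ} (e m : Fin n →₀ ℕ) (c : ℂ) :
    prj e (monomial m c) = if par m = e then monomial (hf m) c else 0 := by
  have h := (basisMonomials (Fin n) ℂ).constr_basis ℂ
    (fun m => if par m = e then (monomial (hf m) 1 : MvPolynomial (Fin n) ℂ) else 0) m
  rw [coe_basisMonomials] at h
  have : (monomial m c : MvPolynomial (Fin n) ℂ) = c • monomial m 1 := by simp [smul_monomial]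
  rw [this, map_smul, prj, h]
  split_ifs <;> simp [smul_monomial]

lemma prj_mul {n : ℕ} (e : Fin n →₀ ℕ) (g h : MvPolynomial (Fin n) ℂ) :
    prj e (h * phi n g) = prj e h * g := by
  induction h using MvPolynomial.induction_on' with
  | add p q hp hq => rw [add_mul, map_add, hp, hq, map_add, add_mul]
  | monomial u a =>
    induction g using MvPolynomial.induction_on' with
    | add p q hp hq => rw [map_add, mul_add, map_add, hp, hq, mul_add]
    | monomial s c =>
      rw [phi_monomial, monomial_mul, prj_monomial, prj_monomial]
      have e1 : par (u + 2 • s) = par u := by ext i; simp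
      have e2 : hf (u + 2 • s) = hf u + s := by ext i; simp; omega
      rw [e1, e2]
      split_ifs
      · rw [monomial_mul]
      · simp

lemma prj_mem {n : ℕ} (e : Fin n →₀ ℕ) (f) (h : f ∈ (QI n).map (phi n)) : prj e f ∈ QI n := by
  unfold Ideal.map Ideal.span at h
  suffices H : ∀ w, prj e (w * f) ∈ QI n by simpa using H 1
  induction h using Submodule.span_induction with
  | mem f hf =>
    obtain ⟨g, hg, rfl⟩ := hf
    intro w
    have h2 : prj e w * g ∈ QI n := Ideal.mul_mem_left _ _ hg
    rw [← prj_mul e g w] at h2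
    exact h2
  | zero => simp
  | add f g _ _ hf hg => intro w; rw [mul_add, map_add]; exact add_mem (hf w) (hg w)
  | smul c f _ hf => intro w; rw [smul_eq_mul, ← mul_assoc]; exact hf _

lemma coeff_prj {n : ℕ} (a : Fin n →₀ ℕ) (ν : Fin n →₀ ℕ) (f) :
    coeff ν (prj (par a) f) = coeff (2 • ν + par a) f := by
  induction f using MvPolynomial.induction_on' with
  | add p q hp hq => rw [map_add, coeff_add, coeff_add, hp, hq]
  | monomial u c =>
    rw [prj_monomial, coeff_monomial]
    by_cases h : par u = par a
    · rw [if_pos h, coeff_monomial]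
      congr 1
      rw [eq_iff_iff]
      constructor
      · rintro rfl; rw [← h, two_hf_add_par]
      · rintro rfl; ext i; simp; omega
    · rw [if_neg h, coeff_zero, if_neg]
      rintro rfl
      apply h; ext i; simp

/-- exponents of the monomial basis in type B -/
def SB (n : ℕ) : Set (Fin n →₀ ℕ) := {a | Bal n 1 (hf a)}

lemma lowerB (n : ℕ) (f) (h : f ∈ (QI n).map (phi n)) (hs : f ∈ restrictSupport ℂ (SB n)) :
    f = 0 := by
  rw [mem_restrictSupport_iff] at hs
  ext a
  have : prj (par a) f = 0 := by
    refine lower n _ (prj_mem _ _ h) fun ν hν => ?_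
    rw [coeff_prj] at hν
    have h1 : Bal n 1 (hf (2 • ν + par a)) := hs (mem_support_iff.2 hν)
    have h2 : hf (2 • ν + par a) = ν := by ext i; simp; omega
    rwa [h2] at h1
  have h3 := coeff_prj a (hf a) f
  rw [this, two_hf_add_par] at h3
  rw [← h3]; simp

lemma upperB (n : ℕ) (f) : f ∈ restrictSupport ℂ (SB n) ⊔ ((QI n).map (phi n)).restrictScalars ℂ := by
  induction f using MvPolynomial.induction_on' with
  | add p q hp hq => exact add_mem hp hq
  | monomial u a =>
    obtain ⟨v, hv, w, hw, e⟩ := Submodule.mem_sup.1 (WW_top n 1 le_rfl (monomial (hf u) a))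
    have : (monomial u a : MvPolynomial (Fin n) ℂ)
        = monomial (par u) 1 * phi n v + monomial (par u) 1 * phi n w := by
      rw [← mul_add, ← map_add, e, phi_monomial, monomial_mul, add_comm, two_hf_add_par, one_mul]
    rw [this]
    refine add_mem (Submodule.mem_sup_left ?_) (Submodule.mem_sup_right ?_)
    · clear e this
      rw [restrictSupport_eq_span] at hv
      induction hv using Submodule.span_induction with
      | mem x hx =>
        obtain ⟨s, hs, rfl⟩ := hx
        simp only
        rw [phi_monomial, monomial_mul, monomial_mem_restrictSupport]
        left
        have h2 : hf (par u + 2 • s) = s := by ext i; simp; omega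
        change Bal n 1 _
        rw [h2]; exact hs
      | zero => simp
      | add x y _ _ hx hy => rw [map_add, mul_add]; exact add_mem hx hy
      | smul c x _ hx => rw [map_smul, mul_smul_comm]; exact Submodule.smul_mem _ _ hx
    · exact Ideal.mul_mem_left _ _ (Ideal.mem_map_of_mem _ (QJ_le n 1 hw))

lemma card_SB (n : ℕ) : Nat.card (SB n) = 2 ^ n * catalan n := by
  have e : SB n ≃ (Fin n → Fin 2) × (DD n 1) :=
    { toFun := fun a => (fun i => ⟨a.1 i % 2, Nat.mod_lt _ (by norm_num)⟩,
        ⟨hf a.1, (mem_DD n 1 _).2 a.2⟩)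
      invFun := fun x => ⟨2 • x.2.1 + Finsupp.equivFunOnFinite.symm (fun i => (x.1 i : ℕ)), by
        have h2 : hf (2 • x.2.1 + Finsupp.equivFunOnFinite.symm (fun i => (x.1 i : ℕ))) = x.2.1 := by
          ext i; simp; omega
        change Bal n 1 _
        rw [h2]; exact (mem_DD n 1 _).1 x.2.2⟩
      left_inv := fun a => by
        apply Subtype.ext
        exact two_hf_add_par a.1
      right_inv := fun x => by
        refine Prod.ext ?_ (Subtype.ext ?_)
        · funext i; apply Fin.ext; simp; omega
        · ext i; simp; omega }
  rw [Nat.card_congr e, Nat.card_prod, ← card_DD_one]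
  simp

end SuperCoinv

/-- for the hyperoctahedral group `Bₙ = G_{n,2}`,
`dim_ℂ ℂ[x₁,…,xₙ]/⟨QInv⁺_{n,2}⟩ = 2^n · Cₙ`. -/
theorem finrank_super_coinvariants_typeB (n : ℕ) (hn : 0 < n) :
    Module.finrank ℂ (MvPolynomial (Fin n) ℂ ⧸ Ideal.span (QInvBPlus n))
      = 2 ^ n * catalan n := by
  have hc : IsCompl ((Ideal.span (QInvBPlus n)).restrictScalars ℂ)
      (restrictSupport ℂ (SuperCoinv.SB n)) := by
    rw [SuperCoinv.span_QInvBPlus]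
    constructor
    · rw [Submodule.disjoint_def]
      intro f h1 h2
      exact SuperCoinv.lowerB n f h1 h2
    · rw [codisjoint_iff, sup_comm, eq_top_iff]
      intro f _
      exact SuperCoinv.upperB n f
  have e1 := (Submodule.Quotient.restrictScalarsEquiv ℂ (Ideal.span (QInvBPlus n))).symm
  have e2 := Submodule.quotientEquivOfIsCompl _ _ hc
  rw [(e1.trans e2).finrank_eq, Module.finrank_eq_nat_card_basis (basisRestrictSupport ℂ _),
    SuperCoinv.card_SB]
end
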